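/- Let ⟨S | R⟩ be a classical C'(1/6) presentation with S finite and group G. Then every infinite-order element g ∈ G has rational translation length: the sequence |gⁿ|_S/n converges to a rational number as n → ∞. -/

import Mathlib

/- Common definitions: words, classical C'(1/6) presentations, word metrics,
   contraction, Morse property, etc. -/

namespace GSC

open Filter

/-- A word over the alphabet `S`: a list of letters with an exponent `±1`
(`true` = the letter, `false` = its formal inverse). -/
abbrev Word (S : Type) := List (S × Bool)

/-- The formal inverse of a word. -/
def wordInv {S : Type} (w : Word S) : Word S := (w.map fun l => (l.1, !l.2)).reverse

/-- A word is (freely) reduced if no letter is followed by its formal inverse. -/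
def Reduced {S : Type} (w : Word S) : Prop :=
  List.Chain' (fun a b => a.1 ≠ b.1 ∨ a.2 = b.2) w

/-- A word is cyclically reduced if its square is reduced. -/
def CyclicallyReduced {S : Type} (w : Word S) : Prop := Reduced (w ++ w)

/-- A piece with respect to a set of relators `R`: a word occurring as a prefix of
two distinct elements of `R`. -/
def IsPiece {S : Type} (R : Set (Word S)) (p : Word S) : Prop :=
  ∃ r₁ ∈ R, ∃ r₂ ∈ R, r₁ ≠ r₂ ∧ p <+: r₁ ∧ p <+: r₂

/-- Closure of a set of words under inversion and cyclic permutation. -/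
def symmClosure {S : Type} (R : Set (Word S)) : Set (Word S) :=
  {w | ∃ r ∈ R, ∃ n : ℕ, w = r.rotate n ∨ w = wordInv (r.rotate n)}

/-- A classical `C'(1/den)` collection of cyclically reduced words: after closing under
inversion and cyclic permutation, every piece `p` contained in a relator `r` satisfies
`den * |p| < |r|`. -/
def CprimeCollection {S : Type} (den : ℕ) (R : Set (Word S)) : Prop :=
  (∀ r ∈ R, CyclicallyReduced r) ∧
  ∀ r ∈ symmClosure R, ∀ p : Word S, p <+: r → IsPiece (symmClosure R) p →
    den * p.length < r.length

/-- A classical `C'(1/6)` presentation: a set of cyclically reduced relators, closed under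
inversion and cyclic permutation, in which every piece contained in a relator `r` has
length `< |r|/6`. -/
structure C6Presentation (S : Type) where
  rels : Set (Word S)
  cyclically_reduced : ∀ r ∈ rels, CyclicallyReduced r
  inv_mem : ∀ r ∈ rels, wordInv r ∈ rels
  rotate_mem : ∀ r ∈ rels, ∀ n : ℕ, r.rotate n ∈ rels
  small_cancellation : ∀ r ∈ rels, ∀ p : Word S, p <+: r → IsPiece rels p →
    6 * p.length < r.length

/-- The element of the free group represented by a word. -/
def wordVal {S : Type} (w : Word S) : FreeGroup S :=
  (w.map fun l => (FreeGroup.of l.1) ^ (if l.2 then (1 : ℤ) else -1)).prod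

/-- The group defined by a `C'(1/6)` presentation. -/
abbrev C6Presentation.Grp {S : Type} (P : C6Presentation S) : Type :=
  PresentedGroup (wordVal '' P.rels)

/-- The generating set of the presented group (the images of the letters of `S`). -/
def C6Presentation.gens {S : Type} (P : C6Presentation S) : Set P.Grp :=
  Set.range fun a : S => (PresentedGroup.of a : P.Grp)

/-- The element of the presented group represented by a word. -/
def C6Presentation.elt {S : Type} (P : C6Presentation S) (w : Word S) : P.Grp :=
  (w.map fun l => (PresentedGroup.of l.1 : P.Grp) ^ (if l.2 then (1 : ℤ) else -1)).prod

/-- The word length of `g` with respect to a generating set `S ⊆ G`: the least `n`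
such that `g` is a product of `n` elements of `S ∪ S⁻¹`. -/
noncomputable def wordLength {G : Type*} [Group G] (S : Set G) (g : G) : ℕ :=
  sInf {n : ℕ | ∃ l : List G, l.length = n ∧ (∀ x ∈ l, x ∈ S ∨ x⁻¹ ∈ S) ∧ l.prod = g}

/-- The word metric on `G` with respect to `S`, as a real-valued function. -/
noncomputable def wdist {G : Type*} [Group G] (S : Set G) (g h : G) : ℝ :=
  (wordLength S (g⁻¹ * h) : ℝ)

/-- Distance from a point to a subset, in the word metric. -/
noncomputable def setDist {G : Type*} [Group G] (S : Set G) (x : G) (Y : Set G) : ℝ :=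
  sInf (wdist S x '' Y)

/-- Closest point projection to a subset `Y`, in the word metric. -/
def proj {G : Type*} [Group G] (S : Set G) (Y : Set G) (x : G) : Set G :=
  {y ∈ Y | wdist S x y = setDist S x Y}

/-- Diameter of a subset, in the word metric. -/
noncomputable def setDiam {G : Type*} [Group G] (S : Set G) (A : Set G) : ℝ :=
  sSup {d : ℝ | ∃ x ∈ A, ∃ y ∈ A, d = wdist S x y}

/-- Admissibility of a pair of contraction gauges `(ρ₁, ρ₂)`: both non-decreasing and
eventually non-negative, `ρ₁ r ≤ r`, `ρ₁` unbounded, and `ρ₂/ρ₁ → 0` at infinity. -/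
def Admissible (ρ₁ ρ₂ : ℝ → ℝ) : Prop :=
  Monotone ρ₁ ∧ Monotone ρ₂ ∧
  (∀ᶠ r in atTop, 0 ≤ ρ₁ r) ∧ (∀ᶠ r in atTop, 0 ≤ ρ₂ r) ∧
  (∀ r : ℝ, ρ₁ r ≤ r) ∧ (∀ M : ℝ, ∃ r : ℝ, M ≤ ρ₁ r) ∧
  Tendsto (fun r => ρ₂ r / ρ₁ r) atTop (nhds 0)

/-- `Y` is `(ρ₁,ρ₂)`-contracting inside the subspace `X` (with the metric induced by the
word metric of `S`): whenever `x, x' ∈ X` satisfy `d(x,x') ≤ ρ₁(d(x,Y))`, the projections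
`π(x) ∪ π(x')` have diameter at most `ρ₂(d(x,Y))`. -/
def ContractingIn {G : Type*} [Group G] (S : Set G) (X Y : Set G) (ρ₁ ρ₂ : ℝ → ℝ) : Prop :=
  Admissible ρ₁ ρ₂ ∧
  ∀ x ∈ X, ∀ x' ∈ X, wdist S x x' ≤ ρ₁ (setDist S x Y) →
    ∀ y ∈ proj S Y x ∪ proj S Y x', ∀ y' ∈ proj S Y x ∪ proj S Y x',
      wdist S y y' ≤ ρ₂ (setDist S x Y)

/-- `Y` is `(ρ₁,ρ₂)`-contracting in `Cay(G,S)`. -/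
def ContractingWith {G : Type*} [Group G] (S : Set G) (ρ₁ ρ₂ : ℝ → ℝ) (Y : Set G) : Prop :=
  ContractingIn S Set.univ Y ρ₁ ρ₂

/-- `Y` is strongly contracting: `(r, C)`-contracting for some constant `C`. -/
def StronglyContracting {G : Type*} [Group G] (S : Set G) (Y : Set G) : Prop :=
  ∃ C : ℝ, ContractingWith S (fun r => r) (fun _ => C) Y

/-- A sublinear function: non-decreasing, eventually non-negative, `f(r)/r → 0`. -/
def Sublinear (f : ℝ → ℝ) : Prop :=
  Monotone f ∧ (∀ᶠ r in atTop, 0 ≤ f r) ∧ Tendsto (fun r => f r / r) atTop (nhds 0)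

/-- `f ⪯ g`: there are constants `C₁, C₂ > 0` and `C₃, C₄ ≥ 0` with
`f(x) ≤ C₁ g(C₂ x + C₃) + C₄` for all `x`. -/
def Preceq (f g : ℝ → ℝ) : Prop :=
  ∃ C₁ C₂ C₃ C₄ : ℝ, 0 < C₁ ∧ 0 < C₂ ∧ 0 ≤ C₃ ∧ 0 ≤ C₄ ∧
    ∀ x : ℝ, f x ≤ C₁ * g (C₂ * x + C₃) + C₄

/-- `f ≍ g`: `f ⪯ g` and `g ⪯ f`. -/
def Asymp (f g : ℝ → ℝ) : Prop := Preceq f g ∧ Preceq g f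

/-- `α ⊆ G` is a geodesic of `Cay(G,S)`: the image of an isometric embedding of a
subinterval of `ℤ` into `(G, d_S)`. -/
def IsGeodesic {G : Type*} [Group G] (S : Set G) (α : Set G) : Prop :=
  ∃ (I : Set ℤ) (γ : ℤ → G), I.OrdConnected ∧
    (∀ m ∈ I, ∀ n ∈ I, wdist S (γ m) (γ n) = |(m : ℝ) - (n : ℝ)|) ∧ α = γ '' I

/-- `α ⊆ G` is a bi-infinite geodesic of `Cay(G,S)`. -/
def IsBiInfGeodesic {G : Type*} [Group G] (S : Set G) (α : Set G) : Prop :=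
  ∃ γ : ℤ → G, (∀ m n : ℤ, wdist S (γ m) (γ n) = |(m : ℝ) - (n : ℝ)|) ∧ α = Set.range γ

/-- `Y` is Morse: there is `μ` such that every `(L,A)`-quasi-geodesic with endpoints on
`Y` stays in the `μ(L,A)`-neighborhood of `Y`. -/
def IsMorse {G : Type*} [Group G] (S : Set G) (Y : Set G) : Prop :=
  ∃ μ : ℝ → ℝ → ℝ, ∀ L A : ℝ, 1 ≤ L → 0 ≤ A →
    ∀ (q : ℤ → G) (m n : ℤ), m ≤ n → q m ∈ Y → q n ∈ Y →
    (∀ i j : ℤ, m ≤ i → i ≤ n → m ≤ j → j ≤ n →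
      L⁻¹ * |(i : ℝ) - (j : ℝ)| - A ≤ wdist S (q i) (q j) ∧
      wdist S (q i) (q j) ≤ L * |(i : ℝ) - (j : ℝ)| + A) →
    ∀ i : ℤ, m ≤ i → i ≤ n → setDist S (q i) Y ≤ μ L A

/-- Two subsets are at finite Hausdorff distance in the word metric. -/
def FinHausdorffDist {G : Type*} [Group G] (S : Set G) (A B : Set G) : Prop :=
  ∃ ε : ℝ, (∀ a ∈ A, ∃ b ∈ B, wdist S a b ≤ ε) ∧ ∀ b ∈ B, ∃ a ∈ A, wdist S a b ≤ ε

/-- The embedded relator cycle determined by `g ∈ G(Γ)` and a relator `r`: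
the set `{g ⋅ p̄ : p a prefix of r}`. -/
def relatorCycle {S : Type} (P : C6Presentation S) (g : P.Grp) (r : Word S) :
    Set P.Grp :=
  {x | ∃ p : Word S, p <+: r ∧ x = g * P.elt p}

/-- A geodesic `α` is locally `(ρ₁,ρ₂)`-contracting: for every embedded relator cycle
`Γ₀` meeting `α`, the set `Γ₀ ∩ α` is `(ρ₁,ρ₂)`-contracting as a subspace of `Γ₀`. -/
def LocallyContracting {S : Type} (P : C6Presentation S) (α : Set P.Grp)
    (ρ₁ ρ₂ : ℝ → ℝ) : Prop :=
  ∀ (g : P.Grp) (r : Word S), r ∈ P.rels → (relatorCycle P g r ∩ α).Nonempty →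
    ContractingIn P.gens (relatorCycle P g r) (relatorCycle P g r ∩ α) ρ₁ ρ₂

/-- The generating set `S ∪ W` of the coned-off space: `W` is the set of elements
represented by subwords of cyclic permutations of relators (equivalently, by prefixes
of relators, since the relator set is closed under cyclic permutation). -/
def conedGens {S : Type} (P : C6Presentation S) : Set P.Grp :=
  P.gens ∪ {x | ∃ r ∈ P.rels, ∃ p : Word S, p <+: r ∧ x = P.elt p}

/-- The exponential growth rate of `(G,S)`. -/
noncomputable def growthRate {G : Type*} [Group G] (S : Set G) : ℝ :=
  limsup (fun n : ℕ => Real.log (Nat.card {g : G // wordLength S g ≤ n}) / (n : ℝ)) atTop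

/-- Quasi-isometry of marked groups `(G,S)` and `(H,T)` via word metrics. -/
def QIsom {G H : Type*} [Group G] [Group H] (S : Set G) (T : Set H) : Prop :=
  ∃ (f : G → H) (L A : ℝ), 1 ≤ L ∧ 0 ≤ A ∧
    (∀ x y : G, L⁻¹ * wdist S x y - A ≤ wdist T (f x) (f y) ∧
      wdist T (f x) (f y) ≤ L * wdist S x y + A) ∧
    ∀ h : H, ∃ x : G, wdist T (f x) h ≤ A

/-- A subgroup is virtually cyclic if it contains a cyclic subgroup of finite index. -/
def VirtuallyCyclic {G : Type*} [Group G] (E : Subgroup G) : Prop :=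
  ∃ g : G, Subgroup.zpowers g ≤ E ∧ ((Subgroup.zpowers g).subgroupOf E).index ≠ 0

end GSC
namespace GSC

open FreeGroup (mk invRev)

variable {S : Type}

/-- The formal inverse of a letter. -/
def linv (a : S × Bool) : S × Bool := (a.1, !a.2)

@[simp] theorem linv_linv (a : S × Bool) : linv (linv a) = a := by simp [linv]

theorem _root_.FreeGroup.IsReduced.subword {x y : Word S} (h : FreeGroup.IsReduced y)
    (hx : x <:+: y) : FreeGroup.IsReduced x := by
  obtain ⟨a, b, rfl⟩ := hx
  exact List.IsChain.right_of_append (List.IsChain.left_of_append h)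

theorem nil_isInfix {α : Type*} {x : List α} : [] <:+: x := ⟨[], x, rfl⟩

theorem invRev_cons' (a : S × Bool) (w : Word S) : invRev (a :: w) = invRev w ++ [linv a] := by
  simp [invRev, linv]

theorem invRev_singleton (a : S × Bool) : invRev [a] = [linv a] := by
  simp [invRev, linv]

theorem invRev_append' (u v : Word S) : invRev (u ++ v) = invRev v ++ invRev u := by
  simp [invRev]

/-- `Ar P k x`: the element `x` of the free group is a product of at most `k` conjugates of
relators. -/
inductive Ar (P : C6Presentation S) : ℕ → FreeGroup S → Prop
  | one (k : ℕ) : Ar P k 1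
  | step {k : ℕ} {r : Word S} {x : FreeGroup S} (g : FreeGroup S) (hr : r ∈ P.rels)
      (hx : Ar P k x) : Ar P (k + 1) (g * mk r * g⁻¹ * x)

namespace Ar

variable {P : C6Presentation S}

theorem mono {k l : ℕ} {x : FreeGroup S} (h : Ar P k x) (hkl : k ≤ l) : Ar P l x := by
  induction h generalizing l with
  | one k => exact one _
  | step g hr hx ih =>
    obtain ⟨l, rfl⟩ : ∃ m, l = m + 1 := ⟨l - 1, by omega⟩
    exact step g hr (ih (by omega))

theorem mul {k l : ℕ} {x y : FreeGroup S} (hx : Ar P k x) (hy : Ar P l y) :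
    Ar P (k + l) (x * y) := by
  induction hx with
  | one k => simpa using hy.mono (by omega)
  | @step k r x g hr hx ih =>
    have := step g hr ih
    rw [show k + 1 + l = k + l + 1 by omega]
    simpa [mul_assoc] using this

theorem conj {k : ℕ} {x : FreeGroup S} (hx : Ar P k x) (h : FreeGroup S) :
    Ar P k (h * x * h⁻¹) := by
  induction hx with
  | one k => simpa using one k
  | @step k r x g hr hx ih =>
    have := step (h * g) hr ih
    convert this using 1
    group

theorem rel {r : Word S} (hr : r ∈ P.rels) : Ar P 1 (mk r) := by
  simpa using step 1 hr (one 0)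

end Ar

/-- Derivations of words of area at most `k`, peeling from the left. -/
inductive Der (P : C6Presentation S) : ℕ → Word S → Prop
  | nil (k : ℕ) : Der P k []
  | bridge {k l : ℕ} {x y : Word S} (a : S × Bool) (hx : Der P k x) (hy : Der P l y) :
      Der P (k + l) (a :: (x ++ linv a :: y))
  | cell {k : ℕ} {e s w : Word S} (he : e ≠ []) (hr : e ++ s ∈ P.rels)
      (h : Der P k (invRev s ++ w)) : Der P (k + 1) (e ++ w)

theorem rels_rotate {P : C6Presentation S} {u v : Word S} (h : u ++ v ∈ P.rels) :
    v ++ u ∈ P.rels := by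
  have := P.rotate_mem _ h u.length
  simpa using this

theorem rels_invRev {P : C6Presentation S} {u : Word S} (h : u ∈ P.rels) :
    invRev u ∈ P.rels := P.inv_mem _ h

theorem isReduced_iff (w : Word S) : FreeGroup.IsReduced w ↔ Reduced w := by
  unfold FreeGroup.IsReduced Reduced
  constructor <;> intro h <;> refine List.IsChain.imp ?_ h <;> intro a b hab <;> tauto

theorem rels_cyclic {P : C6Presentation S} {u : Word S} (h : u ∈ P.rels) :
    FreeGroup.IsReduced (u ++ u) :=
  (isReduced_iff _).2 (P.cyclically_reduced _ h)

theorem rels_reduced {P : C6Presentation S} {u : Word S} (h : u ∈ P.rels) :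
    FreeGroup.IsReduced u :=
  (rels_cyclic h).subword ⟨[], u, by simp⟩

theorem not_isReduced_pair {u v : Word S} {a : S × Bool} :
    ¬ FreeGroup.IsReduced (u ++ a :: linv a :: v) := by
  intro h
  have h2 : FreeGroup.IsReduced [a, linv a] := h.subword ⟨u, v, by simp⟩
  simp [FreeGroup.IsReduced, linv] at h2

namespace Der

variable {P : C6Presentation S}

theorem mono {k l : ℕ} {w : Word S} (h : Der P k w) (hkl : k ≤ l) : Der P l w := by
  induction h generalizing l with
  | nil k => exact nil _
  | @bridge k k' x y a hx hy ihx ihy =>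
    obtain ⟨m, rfl⟩ : ∃ m, l = k + m := ⟨l - k, by omega⟩
    exact bridge a hx (ihy (by omega))
  | cell he hr h ih =>
    obtain ⟨l, rfl⟩ : ∃ m, l = m + 1 := ⟨l - 1, by omega⟩
    exact cell he hr (ih (by omega))

theorem append {k l : ℕ} {x y : Word S} (hx : Der P k x) (hy : Der P l y) :
    Der P (k + l) (x ++ y) := by
  induction hx with
  | nil k => simpa using hy.mono (by omega)
  | @bridge k k' x z a hx hz ihx ihz =>
    have := bridge a hx ihz
    rw [add_assoc]; simpa using this
  | @cell k e s w he hr h ih =>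
    have := cell (w := w ++ y) he hr (by simpa using ih)
    rw [show k + 1 + l = k + l + 1 by omega]
    simpa using this

theorem conjLetter {k : ℕ} {x : Word S} (hx : Der P k x) (a : S × Bool) :
    Der P k (a :: (x ++ [linv a])) := by
  simpa using bridge a hx (nil 0)

theorem conjWord {k : ℕ} {x : Word S} (hx : Der P k x) (u : Word S) :
    Der P k (u ++ x ++ invRev u) := by
  induction u with
  | nil => simpa using hx
  | cons a u ih =>
    have := ih.conjLetter a
    simpa [invRev_cons'] using this

theorem insert {k : ℕ} {w : Word S} (h : Der P k w) :
    ∀ {l : ℕ} {p q x : Word S}, w = p ++ q → Der P l x → Der P (k + l) (p ++ x ++ q) := by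
  induction h with
  | nil k =>
    intro l p q x hw hx
    obtain ⟨rfl, rfl⟩ := List.append_eq_nil_iff.1 hw.symm
    simpa using hx.mono (by omega)
  | @bridge k k' x y a hx hy ihx ihy =>
    intro l p q z hw hz
    rcases p with _ | ⟨b, p⟩
    · simp only [List.nil_append] at hw
      subst hw
      have := hz.append (bridge a hx hy)
      rw [add_comm]; simpa using this
    · simp only [List.cons_append, List.cons.injEq] at hw
      obtain ⟨rfl, hw⟩ := hw
      rcases List.append_eq_append_iff.1 hw with ⟨c, rfl, hc⟩ | ⟨c, rfl, rfl⟩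
      · rcases c with _ | ⟨d, c⟩
        · simp only [List.nil_append] at hc
          subst hc
          have := bridge a (ihx (p := x) (q := []) (by simp) hz) hy
          rw [show k + k' + l = k + l + k' by omega]
          simpa using this
        · simp only [List.cons_append, List.cons.injEq] at hc
          obtain ⟨rfl, rfl⟩ := hc
          have := bridge a hx (ihy (p := c) (q := q) rfl hz)
          rw [add_assoc]
          simpa using this
      · have := bridge a (ihx (p := p) (q := c) rfl hz) hy
        rw [show k + k' + l = k + l + k' by omega]
        simpa using this
  | @cell k e s w he hr h ih =>
    intro l p q x hw hx
    rw [show k + 1 + l = k + l + 1 by omega]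
    rcases List.append_eq_append_iff.1 hw with ⟨c, rfl, rfl⟩ | ⟨c, rfl, rfl⟩
    · have := cell (w := c ++ x ++ q) he hr
        (by simpa using ih (p := invRev s ++ c) (q := q) (by simp) hx)
      simpa using this
    · by_cases hp : p = []
      · subst hp
        have := hx.append (cell he hr h)
        rw [show l + (k + 1) = k + l + 1 by omega] at this
        simpa using this
      · have h1 := ih (p := invRev s) (q := w) rfl (hx.conjWord (invRev c))
        have := cell (w := x ++ c ++ w) hp (s := c ++ s) (by simpa using hr)
          (by simpa [invRev_append', FreeGroup.invRev_invRev] using h1)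
        simpa using this

theorem rot_one {k : ℕ} (hrot : ∀ j < k, ∀ u v : Word S, Der P j (u ++ v) → Der P j (v ++ u))
    (hrep : ∀ j < k, ∀ e s p : Word S, e ++ s ∈ P.rels → Der P j (p ++ invRev s) →
      Der P (j + 1) (p ++ e))
    {a : S × Bool} {w : Word S} (h : Der P k (a :: w)) : Der P k (w ++ [a]) := by
  generalize hz : a :: w = z at h
  cases h with
  | nil => simp at hz
  | @bridge k l x y b hx hy =>
    simp only [List.cons.injEq] at hz
    obtain ⟨rfl, rfl⟩ := hz
    have := hx.append (hy.conjLetter (linv a))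
    simpa using this
  | @cell k e s w2 he hr h =>
    rcases e with _ | ⟨b, e⟩
    · simp at he
    simp only [List.cons_append, List.cons.injEq] at hz
    obtain ⟨rfl, rfl⟩ := hz
    by_cases h0 : e = []
    · subst h0
      have h1 := hrot k (by omega) _ _ h
      exact hrep k (by omega) [a] s w2 (by simpa using hr) h1
    · have := cell (w := w2 ++ [a]) h0 (s := s ++ [a])
        (by have := rels_rotate (u := [a]) (v := e ++ s) (by simpa using hr); simpa using this)
        (by have := h.conjLetter (linv a); simpa [invRev_append', invRev_singleton] using this)
      simpa using this

theorem rot_rep (k : ℕ) :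
    (∀ u v : Word S, Der P k (u ++ v) → Der P k (v ++ u)) ∧
    (∀ e s p : Word S, e ++ s ∈ P.rels → Der P k (p ++ invRev s) → Der P (k + 1) (p ++ e)) := by
  induction k using Nat.strong_induction_on with
  | _ k IH =>
  have hrot : ∀ u v : Word S, Der P k (u ++ v) → Der P k (v ++ u) := by
    intro u
    induction u with
    | nil => intro v h; simpa using h
    | cons a u ih =>
      intro v h
      have := ih (v ++ [a]) (by
        have := rot_one (fun j hj => (IH j hj).1) (fun j hj => (IH j hj).2) h
        simpa using this)
      simpa using this
  refine ⟨hrot, ?_⟩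
  intro e s p
  induction hn : p.length using Nat.strong_induction_on generalizing e s p with
  | _ n ih =>
  subst hn
  intro hr h
  rcases p with _ | ⟨b, p⟩
  · by_cases h0 : e = []
    · subst h0; exact nil _
    · simpa using cell (w := []) h0 hr (by simpa using h)
  generalize hz : b :: p ++ invRev s = z at h
  cases h with
  | nil => simp at hz
  | @bridge kx ky x y b hx hy =>
    simp only [List.cons_append, List.cons.injEq] at hz
    obtain ⟨rfl, hz⟩ := hz
    have straddle : ∀ σ, x = p ++ σ → invRev s = σ ++ linv b :: y →
        Der P (kx + ky + 1) (b :: (p ++ e)) := by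
      intro σ h1 h2
      subst h1
      have hs : s = invRev y ++ b :: invRev σ := by
        rw [← FreeGroup.invRev_invRev (L₁ := s), h2]
        simp [invRev_cons']
      subst hs
      have hrel : [b] ++ (invRev σ ++ e ++ invRev y) ∈ P.rels := by
        have := rels_rotate (u := e ++ invRev y) (v := b :: invRev σ) (by simpa using hr)
        simpa using this
      have hx' : Der P kx (σ ++ p) := by
        rcases Nat.lt_or_ge kx (kx + ky) with hlt | hge
        · exact (IH kx hlt).1 _ _ hx
        · have : kx + ky = kx := by omega
          rw [this] at hrot
          exact hrot _ _ hx
      have hd := hy.append (hx'.conjWord (invRev e))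
      have := cell (w := p ++ e) (by simp) hrel
        (by simpa [invRev_append', FreeGroup.invRev_invRev] using hd)
      rw [show kx + ky + 1 = ky + kx + 1 by omega]
      simpa using this
    rcases List.append_eq_append_iff.1 hz with ⟨c, h1, h2⟩ | ⟨c, h1, h2⟩
    · exact straddle c h1 h2
    · rcases c with _ | ⟨d, c⟩
      · exact straddle [] (by simpa using h1.symm) (by simpa using h2.symm)
      · simp only [List.cons_append, List.cons.injEq] at h2
        obtain ⟨rfl, rfl⟩ := h2
        subst h1
        have hy' : Der P (ky + 1) (c ++ e) := by
          rcases Nat.lt_or_ge ky (kx + ky) with hlt | hge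
          · exact (IH ky hlt).2 e s c hr hy
          · have hk : kx + ky = ky := by omega
            rw [hk] at ih
            exact ih c.length (by simp; omega) e s c rfl hr hy
        have := bridge b hx hy'
        simpa [add_assoc] using this
  | @cell k0 e1 s1 w2 he hr1 h =>
    rcases List.append_eq_append_iff.1 hz with ⟨σ, h1, h2⟩ | ⟨c, h1, h2⟩
    · subst h1
      have hs : s = invRev w2 ++ invRev σ := by
        rw [← FreeGroup.invRev_invRev (L₁ := s), h2]
        simp
      have h3 := (IH k0 (by omega)).2 (invRev σ ++ e) (invRev w2) (invRev s1)
        (by have := rels_rotate (u := e ++ invRev w2) (v := invRev σ) (by simpa [hs] using hr)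
            simpa using this)
        (by simpa [FreeGroup.invRev_invRev] using h)
      exact cell (w := e) (e := b :: p) (s := σ ++ s1) (by simp) (by simpa using hr1)
        (by simpa [invRev_append'] using h3)
    · subst h2
      have h3 := (IH k0 (by omega)).2 e s (invRev s1 ++ c) hr (by simpa using h)
      have := cell (w := c ++ e) he hr1 (by simpa using h3)
      rw [h1]
      simpa using this

theorem rot {k : ℕ} {u v : Word S} (h : Der P k (u ++ v)) : Der P k (v ++ u) :=
  (rot_rep k).1 u v h

theorem rep {k : ℕ} {e s p : Word S} (hr : e ++ s ∈ P.rels) (h : Der P k (p ++ invRev s)) :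
    Der P (k + 1) (p ++ e) :=
  (rot_rep k).2 e s p hr h

theorem delete {k : ℕ} {w : Word S} (h : Der P k w) :
    ∀ {u v : Word S} {a : S × Bool}, w = u ++ a :: linv a :: v → Der P k (u ++ v) := by
  induction h with
  | nil => intro u v a hw; simp at hw
  | @bridge kx ky x y b hx hy ihx ihy =>
    intro u v a hw
    rcases u with _ | ⟨b', u⟩
    · simp only [List.nil_append, List.cons.injEq] at hw
      obtain ⟨rfl, hw⟩ := hw
      rcases x with _ | ⟨c, x⟩
      · simp only [List.nil_append, List.cons.injEq, true_and] at hw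
        subst hw
        simpa using hy.mono (by omega)
      · simp only [List.cons_append, List.cons.injEq] at hw
        obtain ⟨rfl, rfl⟩ := hw
        have := (rot (u := [linv b]) (v := x) (by simpa using hx)).append hy
        simpa using this
    · simp only [List.cons_append, List.cons.injEq] at hw
      obtain ⟨rfl, hw⟩ := hw
      have special : x = u → linv b :: y = a :: linv a :: v →
          Der P (kx + ky) (b :: u ++ v) := by
        rintro rfl h2
        simp only [List.cons.injEq] at h2
        obtain ⟨rfl, rfl⟩ := h2
        have := hy.insert (p := [b]) (q := v) (by simp) hx
        rw [add_comm]
        simpa using this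
      rcases List.append_eq_append_iff.1 hw with ⟨c, h1, h2⟩ | ⟨c, h1, h2⟩
      · rcases c with _ | ⟨d, c⟩
        · exact special (by simpa using h1.symm) (by simpa using h2)
        · simp only [List.cons_append, List.cons.injEq] at h2
          obtain ⟨rfl, rfl⟩ := h2
          have := bridge b hx (ihy rfl)
          simpa [h1] using this
      · rcases c with _ | ⟨d, c⟩
        · exact special (by simpa using h1) (by simpa using h2.symm)
        · simp only [List.cons_append, List.cons.injEq] at h2
          obtain ⟨rfl, h2⟩ := h2
          rcases c with _ | ⟨d, c⟩
          · simp only [List.nil_append, List.cons.injEq] at h2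
            obtain ⟨h2, rfl⟩ := h2
            have hab : a = b := by rw [← linv_linv a, h2, linv_linv]
            subst hab
            subst h1
            have := (rot hx).append hy
            simpa using this
          · simp only [List.cons_append, List.cons.injEq] at h2
            obtain ⟨rfl, rfl⟩ := h2
            have := bridge b (ihx h1) hy
            simpa using this
  | @cell k e s w2 he hr h ih =>
    intro u v a hw
    have special : ∀ c, u = e ++ c → w2 = c ++ a :: linv a :: v → Der P (k + 1) (u ++ v) := by
      rintro c rfl rfl
      have := cell (w := c ++ v) he hr
        (by simpa using ih (u := invRev s ++ c) (v := v) (a := a) (by simp))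
      simpa using this
    rcases List.append_eq_append_iff.1 hw with ⟨c, h1, h2⟩ | ⟨c, h1, h2⟩
    · exact special c h1 h2
    · rcases c with _ | ⟨d, c⟩
      · exact special [] (by simpa using h1.symm) (by simpa using h2.symm)
      · simp only [List.cons_append, List.cons.injEq] at h2
        obtain ⟨rfl, h2⟩ := h2
        rcases c with _ | ⟨d, c⟩
        · simp only [List.nil_append] at h2
          subst h2
          subst h1
          by_cases hu : u = []
          · subst hu
            have h3 := rot (u := invRev s ++ [linv a]) (v := v) (by simpa using h)
            have := rep (e := []) (s := a :: s) (p := v) (by simpa using hr)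
              (by simpa [invRev_cons'] using h3)
            simpa using this
          · exact cell (s := a :: s) hu (by simpa using hr) (by simpa [invRev_cons'] using h)
        · simp only [List.cons_append, List.cons.injEq] at h2
          obtain ⟨rfl, rfl⟩ := h2
          subst h1
          exact absurd (rels_reduced hr)
            (by simpa using not_isReduced_pair (u := u) (v := c ++ s) (a := a))

theorem ar {k : ℕ} {w : Word S} (h : Der P k w) : Ar P k (mk w) := by
  induction h with
  | nil k => exact Ar.one k
  | @bridge k l x y a hx hy ihx ihy =>
    have := (ihx.conj (mk [a])).mul ihy
    convert this using 1
    simp [FreeGroup.inv_mk, FreeGroup.mul_mk, invRev_singleton]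
  | @cell k e s w he hr h ih =>
    have := Ar.step 1 hr ih
    convert this using 1
    simp [← FreeGroup.mul_mk, ← FreeGroup.inv_mk]

theorem step {k : ℕ} {w w' : Word S} (h : FreeGroup.Red.Step w w') :
    Der P k w ↔ Der P k w' := by
  cases h with
  | @not u v x b =>
    constructor
    · intro h
      exact h.delete (a := (x, b)) rfl
    · intro h
      have := h.insert (p := u) (q := v) rfl
        (show Der P 0 [(x, b), (x, !b)] from bridge (x, b) (nil 0) (nil 0))
      simpa using this

theorem red {k : ℕ} {w w' : Word S} (h : FreeGroup.Red w w') :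
    Der P k w ↔ Der P k w' := by
  induction h with
  | refl => rfl
  | tail _ h ih => exact ih.trans (step h)

theorem congr {k : ℕ} {w w' : Word S} (h : mk w = mk w') (hw : Der P k w) : Der P k w' := by
  obtain ⟨z, h1, h2⟩ := FreeGroup.Red.exact.1 h
  exact (red h2).2 ((red h1).1 hw)

end Der

theorem der_iff_ar {P : C6Presentation S} {k : ℕ} {w : Word S} :
    Der P k w ↔ Ar P k (mk w) := by
  refine ⟨Der.ar, fun h => ?_⟩
  suffices H : ∀ {k x}, Ar P k x → ∃ w', mk w' = x ∧ Der P k w' by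
    obtain ⟨w', h1, h2⟩ := H h
    exact h2.congr h1
  intro k x h
  induction h with
  | one k => exact ⟨[], rfl, Der.nil k⟩
  | @step k r x g hr hx ih =>
    obtain ⟨w', rfl, hw'⟩ := ih
    obtain ⟨u, rfl⟩ := Quot.exists_rep g
    have h1 : Der P 1 r := by
      by_cases h0 : r = []
      · subst h0; exact Der.nil _
      · simpa using Der.cell (w := []) h0 (s := []) (by simpa using hr) (Der.nil 0)
    refine ⟨u ++ r ++ invRev u ++ w', ?_, ?_⟩
    · simp [← FreeGroup.mul_mk, ← FreeGroup.inv_mk, mul_assoc]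
    · have := (h1.conjWord u).append hw'
      rwa [add_comm] at this

theorem wordVal_eq_mk (w : Word S) : wordVal w = mk w := by
  induction w with
  | nil => rfl
  | cons a w ih =>
    rw [show a :: w = [a] ++ w by rfl, ← FreeGroup.mul_mk, ← ih]
    rcases a with ⟨a, _ | _⟩ <;> simp [wordVal, FreeGroup.of, FreeGroup.inv_mk, invRev]

namespace C6Presentation

variable (P : C6Presentation S)

theorem elt_eq_mk (w : Word S) :
    P.elt w = PresentedGroup.mk (wordVal '' P.rels) (FreeGroup.mk w) := by
  induction w with
  | nil => exact (map_one _).symm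
  | cons a w ih =>
    rw [show a :: w = [a] ++ w by rfl, ← FreeGroup.mul_mk, map_mul, ← ih]
    rcases a with ⟨a, _ | _⟩
    · simp only [elt, List.singleton_append, List.map_cons, List.prod_cons]
      congr 1
    · simp only [elt, List.singleton_append, List.map_cons, List.prod_cons]
      congr 1

theorem elt_append (u v : Word S) : P.elt (u ++ v) = P.elt u * P.elt v := by
  simp [elt_eq_mk, ← FreeGroup.mul_mk]

theorem elt_invRev (u : Word S) : P.elt (invRev u) = (P.elt u)⁻¹ := by
  simp [elt_eq_mk, ← FreeGroup.inv_mk]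

@[simp] theorem elt_nil : P.elt [] = 1 := rfl

end C6Presentation

theorem ar_of_mem_normalClosure {P : C6Presentation S} {x : FreeGroup S}
    (hx : x ∈ Subgroup.normalClosure (wordVal '' P.rels)) : ∃ k, Ar P k x := by
  induction hx using Subgroup.closure_induction with
  | mem x hx =>
    obtain ⟨y, ⟨r, hr, rfl⟩, hxy⟩ := Group.mem_conjugatesOfSet_iff.1 hx
    obtain ⟨c, rfl⟩ := isConj_iff.1 hxy
    rw [wordVal_eq_mk]
    exact ⟨1, (Ar.rel hr).conj c⟩
  | one => exact ⟨0, Ar.one 0⟩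
  | mul x y _ _ hx hy =>
    obtain ⟨k, hk⟩ := hx
    obtain ⟨l, hl⟩ := hy
    exact ⟨_, hk.mul hl⟩
  | inv x hmem hx =>
    obtain ⟨k, hk⟩ := hx
    refine ⟨k, ?_⟩
    clear hmem
    induction hk with
    | one k => simpa using Ar.one k
    | @step k r x g hr hx ih =>
      have h1 := ih.mul ((Ar.rel (rels_invRev hr)).conj g)
      convert h1 using 1
      simp [← FreeGroup.inv_mk, mul_assoc]

theorem Ar.map_eq_one {P : C6Presentation S} {k : ℕ} {x : FreeGroup S} (h : Ar P k x) :
    PresentedGroup.mk (wordVal '' P.rels) x = 1 := by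
  induction h with
  | one k => simp
  | @step k r x g hr hx ih =>
    have : PresentedGroup.mk (wordVal '' P.rels) (mk r) = 1 := by
      rw [← wordVal_eq_mk]
      exact PresentedGroup.one_of_mem ⟨r, hr, rfl⟩
    simp [ih, this]

theorem elt_eq_one_iff {P : C6Presentation S} {w : Word S} :
    P.elt w = 1 ↔ ∃ k, Ar P k (mk w) := by
  rw [P.elt_eq_mk]
  refine ⟨fun h => ar_of_mem_normalClosure ?_, fun ⟨k, h⟩ => h.map_eq_one⟩
  exact PresentedGroup.mk_eq_one_iff.1 h

theorem exists_isPrefix_maximal {P : C6Presentation S} {k : ℕ} {s : Word S} :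
    ∀ {e w : Word S}, e ++ s ∈ P.rels → Ar P k (mk (invRev s ++ w)) →
      FreeGroup.IsReduced (e ++ w) →
    ∃ c s' w', s = c ++ s' ∧ w = c ++ w' ∧ Ar P k (mk (invRev s' ++ w')) ∧
      FreeGroup.IsReduced (invRev s' ++ w') := by
  induction s with
  | nil =>
    intro e w hr ha hw
    exact ⟨[], [], w, rfl, rfl, ha, by simpa using hw.subword ⟨e, [], by simp⟩⟩
  | cons a s ih =>
    intro e w hr ha hw
    rcases w with _ | ⟨b, w⟩
    · refine ⟨[], a :: s, [], rfl, rfl, ha, ?_⟩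
      have : FreeGroup.IsReduced (invRev (e ++ a :: s)) := rels_reduced (rels_invRev hr)
      rw [invRev_append'] at this
      exact this.subword ⟨[], invRev e, by simp⟩
    · by_cases hab : a = b
      · subst hab
        obtain ⟨c, s', w', rfl, rfl, h3, h4⟩ := ih (e := e ++ [a]) (w := w) (by simpa using hr)
          (by
            convert ha using 1
            simp only [← FreeGroup.mul_mk, ← FreeGroup.inv_mk,
              show a :: s = [a] ++ s from rfl, show a :: w = [a] ++ w from rfl]
            group)
          (by simpa using hw)
        exact ⟨a :: c, s', w', rfl, rfl, h3, h4⟩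
      · refine ⟨[], a :: s, b :: w, rfl, rfl, ha, ?_⟩
        have h1 : FreeGroup.IsReduced (invRev (e ++ a :: s)) := rels_reduced (rels_invRev hr)
        rw [invRev_append'] at h1
        have h2 : FreeGroup.IsReduced (invRev (a :: s)) := h1.subword ⟨[], invRev e, by simp⟩
        have h3 : FreeGroup.IsReduced (b :: w) := hw.subword ⟨e, [], by simp⟩
        rw [invRev_cons'] at h2 ⊢
        refine h2.append_overlap (L₂ := [linv a]) ?_ (by simp)
        rw [FreeGroup.IsReduced, List.singleton_append, List.isChain_cons_cons]
        refine ⟨fun h => ?_, h3⟩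
        by_contra hne
        apply hab
        rcases a with ⟨a, ba⟩
        rcases b with ⟨b, bb⟩
        simp only [linv] at h hne
        subst h
        simp only [Prod.mk.injEq, true_and]
        revert hne; cases ba <;> cases bb <;> simp

/-- A nonempty reduced null word either starts along a relator or along a bridge. -/
theorem peel_cases {P : C6Presentation S} {k : ℕ} {w : Word S} (hw : FreeGroup.IsReduced w)
    (hne : w ≠ []) (h : Ar P k (mk w)) :
    (∃ j e s w₂, k = j + 1 ∧ w = e ++ w₂ ∧ e ≠ [] ∧ e ++ s ∈ P.rels ∧
      Ar P j (mk (invRev s ++ w₂)) ∧ FreeGroup.IsReduced (invRev s ++ w₂)) ∨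
    (∃ a x y kx ky, w = a :: (x ++ linv a :: y) ∧ Ar P kx (mk x) ∧ Ar P ky (mk y) ∧
      kx + ky = k) := by
  cases der_iff_ar.2 h with
  | nil => exact absurd rfl hne
  | @bridge kx ky x y a hx hy =>
    exact Or.inr ⟨a, x, y, kx, ky, rfl, hx.ar, hy.ar, rfl⟩
  | @cell j e s w2 he hr hd =>
    obtain ⟨c, s', w', rfl, rfl, h3, h4⟩ := exists_isPrefix_maximal hr hd.ar hw
    exact Or.inl ⟨j, e ++ c, s', w', rfl, by simp, by simp [he], by simpa using hr, h3, h4⟩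

/-- The concatenation of the words of a list of labelled words. -/
def cat (A : List (ℕ × Word S)) : Word S := (A.map Prod.snd).flatten

@[simp] theorem cat_nil : cat ([] : List (ℕ × Word S)) = [] := rfl
@[simp] theorem cat_cons (e : ℕ × Word S) (A : List (ℕ × Word S)) :
    cat (e :: A) = e.2 ++ cat A := by simp [cat]
@[simp] theorem cat_append (A B : List (ℕ × Word S)) : cat (A ++ B) = cat A ++ cat B := by
  simp [cat]

/-- The list of labelled words, each together with its starting point on the path. -/
def walk : FreeGroup S → List (ℕ × Word S) → List (FreeGroup S × ℕ × Word S)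
  | _, [] => []
  | v, e :: A => (v, e.1, e.2) :: walk (v * mk e.2) A

@[simp] theorem walk_nil (v : FreeGroup S) : walk v [] = [] := rfl
@[simp] theorem walk_cons (v : FreeGroup S) (e : ℕ × Word S) (A : List (ℕ × Word S)) :
    walk v (e :: A) = (v, e.1, e.2) :: walk (v * mk e.2) A := rfl

@[simp] theorem walk_append (v : FreeGroup S) (A B : List (ℕ × Word S)) :
    walk v (A ++ B) = walk v A ++ walk (v * mk (cat A)) B := by
  induction A generalizing v with
  | nil => simp [← FreeGroup.one_eq_mk]
  | cons e A ih => simp [ih, ← FreeGroup.mul_mk, mul_assoc]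

theorem walk_mul (g v : FreeGroup S) (A : List (ℕ × Word S)) :
    walk (g * v) A = (walk v A).map (fun x => (g * x.1, x.2)) := by
  induction A generalizing v with
  | nil => simp
  | cons e A ih => simp [← ih, mul_assoc]

theorem mem_walk_mul {g v q : FreeGroup S} {A : List (ℕ × Word S)} {e : ℕ × Word S} :
    (q, e) ∈ walk (g * v) A ↔ (g⁻¹ * q, e) ∈ walk v A := by
  rw [walk_mul]
  simp only [List.mem_map, Prod.mk.injEq, Prod.exists]
  constructor
  · rintro ⟨a, i, α, h, rfl, rfl⟩
    simpa using h
  · intro h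
    exact ⟨g⁻¹ * q, e.1, e.2, h, by simp, rfl⟩

theorem mem_walk_iff {v q : FreeGroup S} {A : List (ℕ × Word S)} {e : ℕ × Word S} :
    (q, e) ∈ walk v A ↔ ∃ A₁ A₂, A = A₁ ++ e :: A₂ ∧ q = v * mk (cat A₁) := by
  constructor
  · intro h
    induction A generalizing v with
    | nil => simp at h
    | cons d A ih =>
      simp only [walk_cons, List.mem_cons, Prod.mk.injEq] at h
      rcases h with ⟨rfl, rfl⟩ | h
      · exact ⟨[], A, rfl, by simp [← FreeGroup.one_eq_mk]⟩
      · obtain ⟨A₁, A₂, rfl, rfl⟩ := ih h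
        exact ⟨d :: A₁, A₂, rfl, by simp [← FreeGroup.mul_mk, mul_assoc]⟩
  · rintro ⟨A₁, A₂, rfl, rfl⟩
    simp

theorem mem_of_mem_walk {v q : FreeGroup S} {A : List (ℕ × Word S)} {e : ℕ × Word S}
    (h : (q, e) ∈ walk v A) : e ∈ A := by
  obtain ⟨A₁, A₂, rfl, -⟩ := mem_walk_iff.1 h
  simp

theorem exists_mem_walk {A : List (ℕ × Word S)} {e : ℕ × Word S} (v : FreeGroup S)
    (h : e ∈ A) : ∃ q, (q, e) ∈ walk v A := by
  obtain ⟨A₁, A₂, rfl⟩ := List.append_of_mem h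
  exact ⟨_, mem_walk_iff.2 ⟨A₁, A₂, rfl, rfl⟩⟩

theorem walk_flatMap {f : ℕ × Word S → List (ℕ × Word S)} {A : List (ℕ × Word S)}
    (hf : ∀ e ∈ A, cat (f e) = e.2) (v : FreeGroup S) :
    walk v (A.flatMap f) = (walk v A).flatMap (fun x => walk x.1 (f x.2)) := by
  induction A generalizing v with
  | nil => simp
  | cons e A ih =>
    simp only [List.flatMap_cons, walk_append, walk_cons]
    rw [hf e (by simp), ih (fun d hd => hf d (by simp [hd]))]

theorem cat_flatMap {f : ℕ × Word S → List (ℕ × Word S)} {A : List (ℕ × Word S)}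
    (hf : ∀ e ∈ A, cat (f e) = e.2) : cat (A.flatMap f) = cat A := by
  induction A with
  | nil => simp
  | cons e A ih =>
    simp only [List.flatMap_cons, cat_append, cat_cons]
    rw [hf e (by simp), ih (fun d hd => hf d (by simp [hd]))]

/-- The labelled path traversed backwards. -/
def revPath (A : List (ℕ × Word S)) : List (ℕ × Word S) :=
  (A.map fun e => (e.1, invRev e.2)).reverse

theorem cat_revPath (A : List (ℕ × Word S)) : cat (revPath A) = invRev (cat A) := by
  induction A with
  | nil => rfl
  | cons e A ih =>
    simp only [revPath, List.map_cons, List.reverse_cons, cat_append, cat_cons, cat_nil,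
      invRev_append'] at ih ⊢
    rw [ih]; simp

theorem mem_walk_revPath {A : List (ℕ × Word S)} {v p : FreeGroup S} {i : ℕ} {β : Word S}
    (h : (p, i, β) ∈ walk (v * mk (cat A)) (revPath A)) :
    ∃ q α, (q, i, α) ∈ walk v A ∧ β = invRev α ∧ p = q * mk α := by
  induction A generalizing v with
  | nil => simp [revPath] at h
  | cons e A ih =>
    have hr : revPath (e :: A) = revPath A ++ [(e.1, invRev e.2)] := by simp [revPath]
    rw [hr, walk_append, List.mem_append] at h
    rcases h with h | h
    · obtain ⟨q, α, h1, h2, h3⟩ := ih (v := v * mk e.2)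
        (by simpa [← FreeGroup.mul_mk, mul_assoc] using h)
      exact ⟨q, α, by simp [h1], h2, h3⟩
    · simp only [cat_revPath, walk_cons, walk_nil, List.mem_singleton, Prod.mk.injEq] at h
      obtain ⟨rfl, rfl, rfl⟩ := h
      refine ⟨v, e.2, by simp, rfl, ?_⟩
      simp [← FreeGroup.mul_mk, ← FreeGroup.inv_mk, mul_assoc]

theorem ids_revPath (A : List (ℕ × Word S)) (i : ℕ) :
    ((revPath A).map Prod.fst).count i = (A.map Prod.fst).count i := by
  simp [revPath, List.map_reverse, Function.comp_def]

theorem length_revPath (A : List (ℕ × Word S)) : (revPath A).length = A.length := by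
  simp [revPath]

theorem mem_revPath {A : List (ℕ × Word S)} {e : ℕ × Word S} (h : e ∈ revPath A) :
    ∃ α, (e.1, α) ∈ A ∧ e.2 = invRev α := by
  simp only [revPath, List.mem_reverse, List.mem_map] at h
  obtain ⟨d, hd, rfl⟩ := h
  exact ⟨d.2, hd, rfl⟩

/-- The projection from the free group to the presented group. -/
abbrev C6Presentation.toGrp (P : C6Presentation S) : FreeGroup S →* P.Grp :=
  PresentedGroup.mk (wordVal '' P.rels)

/-- The rotation of a relator starting at a given arc of its boundary path. -/
theorem rotate_at {P : C6Presentation S} {C : List (ℕ × Word S)} (hC : cat C ∈ P.rels)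
    {p : FreeGroup S} {e : ℕ × Word S} (h : (p, e) ∈ walk 1 C) :
    ∃ D, e.2 ++ D ∈ P.rels ∧ mk (e.2 ++ D) = p⁻¹ * mk (cat C) * p ∧
      (e.2 ++ D).length = (cat C).length := by
  obtain ⟨C₁, C₂, rfl, rfl⟩ := mem_walk_iff.1 h
  refine ⟨cat C₂ ++ cat C₁, ?_, ?_, ?_⟩
  · have := rels_rotate (P := P) (u := cat C₁) (v := e.2 ++ cat C₂) (by simpa using hC)
    simpa using this
  · simp only [cat_append, cat_cons, ← FreeGroup.mul_mk]
    group
  · simp; omega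

theorem piece_bound {P : C6Presentation S} {α D₁ D₂ : Word S} (h₁ : α ++ D₁ ∈ P.rels)
    (h₂ : α ++ D₂ ∈ P.rels) (h : α ++ D₁ ≠ α ++ D₂) :
    6 * α.length < (α ++ D₁).length :=
  P.small_cancellation _ h₁ α (List.prefix_append _ _)
    ⟨_, h₁, _, h₂, h, List.prefix_append _ _, List.prefix_append _ _⟩

theorem eq_nil_of_invRev_eq {u : Word S} (hu : FreeGroup.IsReduced u) (h : invRev u = u) :
    u = [] := by
  have h1 : (mk u) ^ 2 = 1 := by
    rw [pow_two]
    nth_rewrite 1 [← h]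
    rw [← FreeGroup.inv_mk, inv_mul_cancel]
  have h2 : mk u = 1 := by
    exact pow_eq_one_iff_left (two_ne_zero) |>.1 h1
  classical
  have h3 := congrArg FreeGroup.toWord h2
  rw [FreeGroup.toWord_mk, FreeGroup.toWord_one] at h3
  rwa [hu.reduce_eq] at h3

/-- The boundary path `C` of a cell and the exterior boundary path `A` (spelling `w`) agree along
their common arcs; removing the cell through such an arc lowers the area below `k`. -/
def Exposed (P : C6Presentation S) (k : ℕ) (w : FreeGroup S) (A C : List (ℕ × Word S)) : Prop :=
  ∃ v₀ : P.Grp, ∀ p i α q β, (p, i, α) ∈ walk 1 C → (q, i, β) ∈ walk 1 A →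
    α = β ∧ P.toGrp q = v₀ * P.toGrp p ∧
      ∃ j < k, Ar P j (q * p⁻¹ * (mk (cat C))⁻¹ * p * q⁻¹ * w)

/-- Two occurrences of the same arc on the exterior boundary path form a bridge. -/
def BrRel (P : C6Presentation S) (k : ℕ) (w : FreeGroup S) (x y : FreeGroup S × ℕ × Word S) :
    Prop :=
  x.2.1 = y.2.1 → y.2.2 = invRev x.2.2 ∧ ∃ k₁ k₂, k₁ + k₂ ≤ k ∧
    Ar P k₁ ((x.1 * mk x.2.2)⁻¹ * y.1) ∧ Ar P k₂ (x.1 * (y.1 * mk y.2.2)⁻¹ * w)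

/-- Combinatorial data of a diagram with exterior boundary path `A` and cells `recs`, whose arcs
are labelled by numbers in `[N, N')`. -/
structure Diag (P : C6Presentation S) (k : ℕ) (w : Word S) (N N' : ℕ) (A : List (ℕ × Word S))
    (recs : List (List (ℕ × Word S))) : Prop where
  cat_eq : cat A = w
  le : N ≤ N'
  ids : ∀ e ∈ A ++ recs.flatten, N ≤ e.1 ∧ e.1 < N'
  ne : ∀ e ∈ A ++ recs.flatten, e.2 ≠ []
  rel : ∀ C ∈ recs, cat C ∈ P.rels
  exp : ∀ C ∈ recs, Exposed P k (mk w) A C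
  int : ∀ C ∈ recs, ∀ e ∈ C, e.1 ∉ A.map Prod.fst → 6 * e.2.length < (cat C).length
  cnt : ∀ i ∈ A.map Prod.fst, ((A ++ recs.flatten).map Prod.fst).count i = 2
  br : (walk 1 A).Pairwise (BrRel P k (mk w))

/-- The combinatorial curvature of a diagram. -/
def euler (A : List (ℕ × Word S)) (recs : List (List (ℕ × Word S))) : ℤ :=
  (recs.map fun C => (6 : ℤ) - C.length).sum - A.length

theorem euler_eq (A : List (ℕ × Word S)) (recs : List (List (ℕ × Word S))) :
    euler A recs = 6 * recs.length - (A ++ recs.flatten).length := by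
  unfold euler
  induction recs with
  | nil => simp
  | cons C recs ih =>
    simp only [List.map_cons, List.sum_cons, List.length_cons, List.flatten_cons,
      List.length_append] at ih ⊢
    push_cast at ih ⊢
    linarith

theorem split_cat {A : List (ℕ × Word S)} : ∀ {u v : Word S}, cat A = u ++ v →
    (∃ A₁ A₂, A = A₁ ++ A₂ ∧ cat A₁ = u ∧ cat A₂ = v) ∨
    ∃ B₁ B₂ i α₁ α₂, A = B₁ ++ (i, α₁ ++ α₂) :: B₂ ∧ α₁ ≠ [] ∧ α₂ ≠ [] ∧
      u = cat B₁ ++ α₁ ∧ v = α₂ ++ cat B₂ := by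
  induction A with
  | nil =>
    intro u v h
    obtain ⟨rfl, rfl⟩ := List.append_eq_nil_iff.1 h.symm
    exact Or.inl ⟨[], [], rfl, rfl, rfl⟩
  | cons e A ih =>
    intro u v h
    rw [cat_cons] at h
    have key : ∀ c, u = e.2 ++ c → cat A = c ++ v →
      (∃ A₁ A₂, e :: A = A₁ ++ A₂ ∧ cat A₁ = u ∧ cat A₂ = v) ∨
      ∃ B₁ B₂ i α₁ α₂, e :: A = B₁ ++ (i, α₁ ++ α₂) :: B₂ ∧ α₁ ≠ [] ∧ α₂ ≠ [] ∧
        u = cat B₁ ++ α₁ ∧ v = α₂ ++ cat B₂ := by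
      rintro c rfl hc
      rcases ih hc with ⟨A₁, A₂, rfl, rfl, rfl⟩ | ⟨B₁, B₂, i, α₁, α₂, rfl, h1, h2, rfl, rfl⟩
      · exact Or.inl ⟨e :: A₁, A₂, rfl, by simp, rfl⟩
      · exact Or.inr ⟨e :: B₁, B₂, i, α₁, α₂, rfl, h1, h2, by simp, rfl⟩
    rcases List.append_eq_append_iff.1 h with ⟨c, h1, h2⟩ | ⟨c, h1, h2⟩
    · exact key c h1 h2
    · by_cases hc : c = []
      · subst hc
        exact key [] (by simpa using h1.symm) (by simpa using h2.symm)
      · by_cases hu : u = []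
        · subst hu
          exact Or.inl ⟨[], e :: A, rfl, rfl, by simpa [h1] using h2.symm⟩
        · exact Or.inr ⟨[], A, e.1, u, c, by simp [← h1], hu, hc, by simp, h2⟩

/-- Subdivision of the arc `i`, labelled `α₁ ++ α₂`, into the arcs `i` and `j`. -/
noncomputable def sub (i j : ℕ) (α₁ α₂ : Word S) (e : ℕ × Word S) : List (ℕ × Word S) :=
  open Classical in
  if e.1 = i then (if e.2 = α₁ ++ α₂ then [(i, α₁), (j, α₂)]
    else [(j, invRev α₂), (i, invRev α₁)]) else [e]

theorem cat_sub {i j : ℕ} {α₁ α₂ : Word S} {e : ℕ × Word S}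
    (h : e.1 = i → e.2 = α₁ ++ α₂ ∨ e.2 = invRev (α₁ ++ α₂)) : cat (sub i j α₁ α₂ e) = e.2 := by
  unfold sub
  split_ifs with h1 h2
  · simp [h2]
  · have := (h h1).resolve_left h2
    rw [this]; simp
  · simp

theorem count_sub {i j : ℕ} {α₁ α₂ : Word S} (hij : i ≠ j) {L : List (ℕ × Word S)}
    (hj : ∀ e ∈ L, e.1 ≠ j) (m : ℕ) :
    ((L.flatMap (sub i j α₁ α₂)).map Prod.fst).count m =
      (L.map Prod.fst).count (if m = j then i else m) := by
  induction L with
  | nil => simp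
  | cons e L ih =>
    have h1 := ih (fun e he => hj e (by simp [he]))
    have h2 := hj e (by simp)
    simp only [List.flatMap_cons, List.map_append, List.count_append, h1, List.map_cons,
      List.count_cons]
    rw [add_comm]
    congr 1
    unfold sub
    split_ifs <;> simp_all [List.count_cons] <;> try omega

theorem length_sub {i j : ℕ} {α₁ α₂ : Word S} {L : List (ℕ × Word S)} :
    (L.flatMap (sub i j α₁ α₂)).length = L.length + (L.map Prod.fst).count i := by
  induction L with
  | nil => simp
  | cons e L ih =>
    simp only [List.flatMap_cons, List.length_append, ih, List.map_cons, List.count_cons,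
      List.length_cons]
    unfold sub
    split_ifs <;> simp_all <;> omega

theorem mem_walk_sub {i j : ℕ} {α₁ α₂ : Word S} {q₀ q : FreeGroup S} {e₀ : ℕ × Word S} {m : ℕ}
    {γ : Word S} (h : (q, m, γ) ∈ walk q₀ (sub i j α₁ α₂ e₀)) :
    (e₀.1 ≠ i ∧ q = q₀ ∧ e₀ = (m, γ)) ∨
    (e₀ = (i, α₁ ++ α₂) ∧ ((q = q₀ ∧ m = i ∧ γ = α₁) ∨ (q = q₀ * mk α₁ ∧ m = j ∧ γ = α₂))) ∨
    (e₀.1 = i ∧ e₀.2 ≠ α₁ ++ α₂ ∧ ((q = q₀ ∧ m = j ∧ γ = invRev α₂) ∨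
      (q = q₀ * (mk α₂)⁻¹ ∧ m = i ∧ γ = invRev α₁))) := by
  unfold sub at h
  rcases e₀ with ⟨n, δ⟩
  split_ifs at h with h1 h2
  · simp only [walk_cons, walk_nil, List.mem_cons, Prod.mk.injEq, List.not_mem_nil, or_false]
      at h h1 h2
    subst h1 h2
    tauto
  · simp only [walk_cons, walk_nil, List.mem_cons, Prod.mk.injEq, List.not_mem_nil, or_false,
      ← FreeGroup.inv_mk] at h h1 h2
    subst h1
    tauto
  · simp only [walk_cons, walk_nil, List.mem_cons, Prod.mk.injEq, List.not_mem_nil, or_false]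
      at h h1
    obtain ⟨rfl, rfl, rfl⟩ := h
    exact Or.inl ⟨h1, rfl, rfl⟩

theorem invRev_ne_self {u : Word S} (hu : FreeGroup.IsReduced u) (h0 : u ≠ []) : invRev u ≠ u :=
  fun h => h0 (eq_nil_of_invRev_eq hu h)

namespace Diag

variable {P : C6Presentation S} {k : ℕ} {w : Word S} {N N' : ℕ} {A : List (ℕ × Word S)}
  {recs : List (List (ℕ × Word S))}

theorem word_of_id (h : Diag P k w N N' A recs) {i : ℕ} {α β : Word S}
    (h1 : (i, α) ∈ A) (h2 : (i, β) ∈ A) : β = α ∨ β = invRev α := by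
  obtain ⟨p, hp⟩ := exists_mem_walk 1 h1
  obtain ⟨q, hq⟩ := exists_mem_walk 1 h2
  have hpw := h.br
  obtain ⟨a, b, hab, -⟩ := mem_walk_iff.1 hp
  have key : ∀ {l : List (FreeGroup S × ℕ × Word S)}, l.Pairwise (BrRel P k (FreeGroup.mk w)) →
      ∀ x ∈ l, ∀ y ∈ l, x = y ∨ BrRel P k (FreeGroup.mk w) x y ∨ BrRel P k (FreeGroup.mk w) y x := by
    intro l hl
    induction hl with
    | nil => simp
    | @cons a l ha hl ih =>
      intro x hx y hy
      rcases List.mem_cons.1 hx with hx | hx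
      · rcases List.mem_cons.1 hy with hy | hy
        · exact Or.inl (hx.trans hy.symm)
        · exact Or.inr (Or.inl (hx ▸ ha _ hy))
      · rcases List.mem_cons.1 hy with hy | hy
        · exact Or.inr (Or.inr (hy ▸ ha _ hx))
        · exact ih _ hx _ hy
  rcases key hpw _ hp _ hq with h3 | h3 | h3
  · simp only [Prod.mk.injEq, true_and] at h3; exact Or.inl h3.2.symm
  · exact Or.inr (h3 rfl).1
  · right; have := (h3 rfl).1; simp only at this; rw [this, FreeGroup.invRev_invRev]

theorem reduced_of_mem (h : Diag P k w N N' A recs) (hw : FreeGroup.IsReduced w)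
    {e : ℕ × Word S} (he : e ∈ A) : FreeGroup.IsReduced e.2 := by
  obtain ⟨A₁, A₂, rfl⟩ := List.append_of_mem he
  have := h.cat_eq
  subst this
  exact hw.subword ⟨cat A₁, cat A₂, by simp⟩

theorem cut_arc (h : Diag P k w N N' A recs) (hw : FreeGroup.IsReduced w)
    {B₁ B₂ : List (ℕ × Word S)} {i : ℕ} {α₁ α₂ : Word S}
    (hA : A = B₁ ++ (i, α₁ ++ α₂) :: B₂) (h1 : α₁ ≠ []) (h2 : α₂ ≠ []) :
    Diag P k w N (N' + 1) (A.flatMap (sub i N' α₁ α₂))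
      (recs.map fun C => C.flatMap (sub i N' α₁ α₂)) := by
  have hiA : (i, α₁ ++ α₂) ∈ A := by simp [hA]
  have hred : FreeGroup.IsReduced (α₁ ++ α₂) := h.reduced_of_mem hw hiA
  have hself : invRev (α₁ ++ α₂) ≠ α₁ ++ α₂ := invRev_ne_self hred (by simp [h1])
  obtain ⟨qi, hqi⟩ := exists_mem_walk 1 hiA
  have hwA : ∀ e ∈ A, e.1 = i → e.2 = α₁ ++ α₂ ∨ e.2 = invRev (α₁ ++ α₂) := by
    rintro ⟨j, β⟩ he rfl
    exact h.word_of_id hiA he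
  have hwC : ∀ C ∈ recs, ∀ e ∈ C, e.1 = i → e.2 = α₁ ++ α₂ := by
    rintro C hC ⟨j, β⟩ he rfl
    obtain ⟨p, hp⟩ := exists_mem_walk 1 he
    obtain ⟨v₀, hv⟩ := h.exp C hC
    exact (hv _ _ _ _ _ hp hqi).1
  have hcatA : ∀ e ∈ A, cat (sub i N' α₁ α₂ e) = e.2 := fun e he => cat_sub (hwA e he)
  have hcatC : ∀ C ∈ recs, ∀ e ∈ C, cat (sub i N' α₁ α₂ e) = e.2 :=
    fun C hC e he => cat_sub (fun hi => Or.inl (hwC C hC e he hi))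
  have hflat : A.flatMap (sub i N' α₁ α₂) ++ (recs.map fun C => C.flatMap (sub i N' α₁ α₂)).flatten
      = (A ++ recs.flatten).flatMap (sub i N' α₁ α₂) := by
    simp [List.flatMap_def, List.map_flatten, List.flatten_flatten, Function.comp_def]
  have hN' : ∀ e ∈ A ++ recs.flatten, e.1 ≠ N' := fun e he => by
    have := (h.ids e he).2; omega
  have hiN : N ≤ i ∧ i < N' := h.ids (i, α₁ ++ α₂) (by simp [hiA])
  have hids : ∀ m, m ∈ (A.flatMap (sub i N' α₁ α₂)).map Prod.fst ↔
      (if m = N' then i else m) ∈ A.map Prod.fst := by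
    intro m
    rw [← List.count_pos_iff, ← List.count_pos_iff,
      count_sub (by omega) (fun e he => hN' e (by simp [he]))]
  have hiids : i ∈ A.map Prod.fst := List.mem_map.2 ⟨_, hiA, rfl⟩
  refine ⟨?_, ?_, ?_, ?_, ?_, ?_, ?_, ?_, ?_⟩
  · rw [cat_flatMap hcatA, h.cat_eq]
  · have := h.le; omega
  · rw [hflat]
    intro e he
    obtain ⟨d, hd, he⟩ := List.mem_flatMap.1 he
    have := h.ids d hd
    unfold sub at he
    split_ifs at he <;> simp at he
    · rcases he with rfl | rfl <;> simp <;> omega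
    · rcases he with rfl | rfl <;> simp <;> omega
    · subst he; omega
  · rw [hflat]
    intro e he
    obtain ⟨d, hd, he⟩ := List.mem_flatMap.1 he
    have := h.ne d hd
    have h1' : invRev α₁ ≠ [] := by simpa [FreeGroup.invRev] using h1
    have h2' : invRev α₂ ≠ [] := by simpa [FreeGroup.invRev] using h2
    unfold sub at he
    split_ifs at he <;> simp at he
    · rcases he with rfl | rfl <;> assumption
    · rcases he with rfl | rfl <;> assumption
    · subst he; assumption
  · intro C' hC'
    obtain ⟨C, hC, rfl⟩ := List.mem_map.1 hC'
    rw [cat_flatMap (hcatC C hC)]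
    exact h.rel C hC
  · intro C' hC'
    obtain ⟨C, hC, rfl⟩ := List.mem_map.1 hC'
    obtain ⟨v₀, hv⟩ := h.exp C hC
    refine ⟨v₀, ?_⟩
    intro p m γ q δ hp hq
    rw [walk_flatMap (hcatC C hC)] at hp
    rw [walk_flatMap hcatA] at hq
    rw [cat_flatMap (hcatC C hC)]
    obtain ⟨⟨p₀, c⟩, hp₀, hp⟩ := List.mem_flatMap.1 hp
    obtain ⟨⟨q₀, a⟩, hq₀, hq⟩ := List.mem_flatMap.1 hq
    have hcC := mem_of_mem_walk hp₀
    have haA := mem_of_mem_walk hq₀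
    have hcN : c.1 ≠ N' := hN' c (by simp; exact Or.inr ⟨C, hC, hcC⟩)
    have haN : a.1 ≠ N' := hN' a (by simp [haA])
    rcases mem_walk_sub hp with ⟨hc, rfl, rfl⟩ | ⟨rfl, hp⟩ | ⟨hc, hc', -⟩
    · rcases mem_walk_sub hq with ⟨ha, rfl, rfl⟩ | ⟨rfl, ⟨-, hm, -⟩ | ⟨-, hm, -⟩⟩ |
        ⟨ha, ha', ⟨-, hm, -⟩ | ⟨-, hm, -⟩⟩
      · exact hv _ _ _ _ _ hp₀ hq₀
      all_goals exact absurd hm ‹_›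
    · rcases mem_walk_sub hq with ⟨ha, rfl, rfl⟩ | ⟨rfl, hq⟩ | ⟨ha, ha', -⟩
      · rcases hp with ⟨-, hm, -⟩ | ⟨-, hm, -⟩
        · exact absurd hm ha
        · exact absurd hm haN
      · have := hv _ _ _ _ _ hp₀ hq₀
        rcases hp with ⟨rfl, rfl, rfl⟩ | ⟨rfl, rfl, rfl⟩ <;>
        rcases hq with ⟨rfl, hm, rfl⟩ | ⟨rfl, hm, rfl⟩
        · exact ⟨rfl, this.2⟩
        · omega
        · omega
        · refine ⟨rfl, ?_, ?_⟩
          · rw [map_mul, map_mul, this.2.1, mul_assoc]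
          · obtain ⟨j, hj, har⟩ := this.2.2
            refine ⟨j, hj, ?_⟩
            convert har using 1
            group
      · exact absurd (hv _ _ _ q₀ a.2 hp₀ (by rw [← ha]; exact hq₀)).1.symm ha'
    · exact absurd (hwC C hC c hcC hc) hc'
  · intro C' hC' e he hne
    obtain ⟨C, hC, rfl⟩ := List.mem_map.1 hC'
    rw [cat_flatMap (hcatC C hC)]
    obtain ⟨d, hd, he⟩ := List.mem_flatMap.1 he
    rw [hids] at hne
    unfold sub at he
    split_ifs at he <;> simp at he
    · rcases he with rfl | rfl
      · simp only at hne; rw [if_neg (by omega)] at hne; exact absurd hiids hne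
      · simp only [if_true] at hne; exact absurd hiids hne
    · rcases he with rfl | rfl
      · simp only [if_true] at hne; exact absurd hiids hne
      · simp only at hne; rw [if_neg (by omega)] at hne; exact absurd hiids hne
    · subst he
      have : e.1 ≠ N' := hN' e (by simp; exact Or.inr ⟨C, hC, hd⟩)
      rw [if_neg this] at hne
      exact h.int C hC e hd hne
  · intro m hm
    rw [hids] at hm
    rw [hflat, count_sub (by omega) hN']
    exact h.cnt _ hm
  · rw [walk_flatMap hcatA, List.pairwise_flatMap]
    constructor
    · rintro ⟨q, e⟩ he
      simp only
      unfold sub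
      split_ifs <;> simp [BrRel] <;> intro h <;> omega
    · have hmem := List.Pairwise.and_mem.1 h.br
      refine hmem.imp ?_
      rintro ⟨q, e⟩ ⟨q', e'⟩ ⟨hmq, hmq', hbr⟩ ⟨x, m, γ⟩ hx ⟨x', m', γ'⟩ hx' hmm
      simp only at hmm hx hx'
      subst hmm
      have heA := mem_of_mem_walk hmq
      have heA' := mem_of_mem_walk hmq'
      have heN : e.1 ≠ N' := hN' e (by simp [heA])
      have heN' : e'.1 ≠ N' := hN' e' (by simp [heA'])
      rcases mem_walk_sub hx with ⟨ha, rfl, rfl⟩ | ⟨rfl, hy⟩ | ⟨rfl, ha', hy⟩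
      · rcases mem_walk_sub hx' with ⟨ha, rfl, rfl⟩ | ⟨rfl, ⟨-, hm, -⟩ | ⟨-, hm, -⟩⟩ |
          ⟨ha, ha', ⟨-, hm, -⟩ | ⟨-, hm, -⟩⟩
        · exact hbr rfl
        all_goals exact absurd hm ‹_›
      · rcases mem_walk_sub hx' with ⟨ha, rfl, rfl⟩ | ⟨rfl, hy'⟩ | ⟨ha, ha', hy'⟩
        · rcases hy with ⟨-, hm, -⟩ | ⟨-, hm, -⟩
          · exact absurd hm ha
          · exact absurd hm heN'
        · exact absurd (hbr rfl).1.symm hself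
        · obtain ⟨hb, k₁, k₂, hk, hk1, hk2⟩ := hbr ha.symm
          simp only at hb hk1 hk2 ⊢
          rw [hb] at hk2
          rcases hy with ⟨rfl, rfl, rfl⟩ | ⟨rfl, rfl, rfl⟩ <;>
          rcases hy' with ⟨rfl, hm, rfl⟩ | ⟨rfl, hm, rfl⟩
          · omega
          · refine ⟨rfl, k₁, k₂, hk, ?_, ?_⟩
            · have := hk1.conj (FreeGroup.mk α₂)
              convert this using 1
              rw [← FreeGroup.mul_mk]; group
            · convert hk2 using 1
              simp only [← FreeGroup.mul_mk, ← FreeGroup.inv_mk]; group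
          · refine ⟨rfl, k₁, k₂, hk, ?_, ?_⟩
            · convert hk1 using 1
              rw [← FreeGroup.mul_mk]; group
            · convert hk2 using 1
              simp only [← FreeGroup.mul_mk, ← FreeGroup.inv_mk]; group
          · omega
      · rcases mem_walk_sub hx' with ⟨ha, rfl, rfl⟩ | ⟨rfl, hy'⟩ | ⟨ha, hb', -⟩
        · rcases hy with ⟨-, hm, -⟩ | ⟨-, hm, -⟩
          · exact absurd hm heN'
          · exact absurd hm ha
        · obtain ⟨hb, k₁, k₂, hk, hk1, hk2⟩ := hbr rfl
          simp only at hb hk1 hk2 ⊢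
          have hb2 : e.2 = invRev (α₁ ++ α₂) := by rw [hb, FreeGroup.invRev_invRev]
          rw [hb2] at hk1
          rcases hy with ⟨rfl, rfl, rfl⟩ | ⟨rfl, rfl, rfl⟩ <;>
          rcases hy' with ⟨rfl, hm, rfl⟩ | ⟨rfl, hm, rfl⟩
          · omega
          · refine ⟨by rw [FreeGroup.invRev_invRev], k₁, k₂, hk, ?_, ?_⟩
            · have := hk1.conj (FreeGroup.mk α₁)⁻¹
              convert this using 1
              simp only [← FreeGroup.mul_mk, ← FreeGroup.inv_mk]; group
            · convert hk2 using 1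
              simp only [← FreeGroup.mul_mk]; group
          · refine ⟨by rw [FreeGroup.invRev_invRev], k₁, k₂, hk, ?_, ?_⟩
            · convert hk1 using 1
              simp only [← FreeGroup.mul_mk, ← FreeGroup.inv_mk]; group
            · convert hk2 using 1
              simp only [← FreeGroup.mul_mk]; group
          · omega
        · exfalso
          have h3 := (hwA e heA rfl).resolve_left ha'
          have h4 := (hwA e' heA' ha).resolve_left hb'
          have h5 := (hbr ha.symm).1
          simp only at h5
          rw [h3, h4, FreeGroup.invRev_invRev] at h5
          exact hself h5

theorem cut (h : Diag P k w N N' A recs) (hw : FreeGroup.IsReduced w) {u v : Word S}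
    (huv : w = u ++ v) :
    ∃ N'' A₁ A₂ recs', Diag P k w N N'' (A₁ ++ A₂) recs' ∧ cat A₁ = u ∧ cat A₂ = v ∧
      euler A recs - 2 ≤ euler (A₁ ++ A₂) recs' := by
  rcases split_cat (h.cat_eq.trans huv) with ⟨A₁, A₂, rfl, h1, h2⟩ |
    ⟨B₁, B₂, i, α₁, α₂, hA, h1, h2, hu, hv⟩
  · exact ⟨N', A₁, A₂, recs, h, h1, h2, by omega⟩
  · have hcut := h.cut_arc hw hA h1 h2
    have hiA : (i, α₁ ++ α₂) ∈ A := by simp [hA]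
    have hwA : ∀ e ∈ A, cat (sub i N' α₁ α₂ e) = e.2 := by
      rintro ⟨j, β⟩ he
      exact cat_sub (by rintro rfl; exact h.word_of_id hiA he)
    have hA' : A.flatMap (sub i N' α₁ α₂) = (B₁.flatMap (sub i N' α₁ α₂) ++ [(i, α₁)]) ++
        ((N', α₂) :: B₂.flatMap (sub i N' α₁ α₂)) := by
      rw [hA]; simp [sub]
    refine ⟨N' + 1, B₁.flatMap (sub i N' α₁ α₂) ++ [(i, α₁)],
      (N', α₂) :: B₂.flatMap (sub i N' α₁ α₂), _, hA' ▸ hcut, ?_, ?_, ?_⟩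
    · rw [cat_append, cat_flatMap (fun e he => hwA e (by simp [hA, he])), hu]; simp
    · rw [cat_cons, cat_flatMap (fun e he => hwA e (by simp [hA, he])), hv]
    · rw [← hA', euler_eq, euler_eq]
      have hflat : A.flatMap (sub i N' α₁ α₂) ++
          (recs.map fun C => C.flatMap (sub i N' α₁ α₂)).flatten
          = (A ++ recs.flatten).flatMap (sub i N' α₁ α₂) := by
        simp [List.flatMap_def, List.map_flatten, List.flatten_flatten, Function.comp_def]
      rw [hflat, length_sub, h.cnt i (List.mem_map.2 ⟨_, hiA, rfl⟩), List.length_map]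
      push_cast
      linarith

end Diag

theorem length_invRev' (u : Word S) : (invRev u).length = u.length := by simp

theorem not_isReduced_append_invRev {u v α : Word S} (hα : α ≠ []) :
    ¬ FreeGroup.IsReduced (u ++ α ++ invRev α ++ v) := by
  obtain ⟨β, a, rfl⟩ := List.eq_nil_or_concat α |>.resolve_left hα
  rw [List.concat_eq_append, invRev_append', invRev_singleton]
  have := @not_isReduced_pair S (u ++ β) (invRev β ++ v) a
  simpa using this

theorem exists_two_of_count {A : List (ℕ × Word S)} {i : ℕ} (h : 2 ≤ (A.map Prod.fst).count i) :
    ∃ B₁ B₂ B₃ α β, A = B₁ ++ (i, α) :: (B₂ ++ (i, β) :: B₃) := by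
  induction A with
  | nil => simp at h
  | cons e A ih =>
    by_cases he : e.1 = i
    · subst he
      simp only [List.map_cons, List.count_cons_self] at h
      have h1 : 0 < (A.map Prod.fst).count e.1 := by omega
      obtain ⟨d, hd, hde⟩ := List.mem_map.1 (List.count_pos_iff.1 h1)
      obtain ⟨B₂, B₃, rfl⟩ := List.append_of_mem hd
      exact ⟨[], B₂, B₃, e.2, d.2, by simp [Prod.ext_iff, hde]⟩
    · rw [List.map_cons, List.count_cons_of_ne he] at h
      obtain ⟨B₁, B₂, B₃, α, β, rfl⟩ := ih h
      exact ⟨e :: B₁, B₂, B₃, α, β, rfl⟩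

/-- The relator read from the cell at the end of a path `A` spelling `s⁻¹`, closed up by `e`. -/
theorem inv_rotate_at {P : C6Presentation S} {e s : Word S} (hr : e ++ s ∈ P.rels)
    {A : List (ℕ × Word S)} (hA : cat A = invRev s) {q : FreeGroup S} {d : ℕ × Word S}
    (h : (q, d) ∈ walk 1 A) :
    ∃ D, d.2 ++ D ∈ P.rels ∧ mk (d.2 ++ D) = q⁻¹ * (mk (e ++ s))⁻¹ * q ∧
      (d.2 ++ D).length = (e ++ s).length := by
  have hc : cat (A ++ [(0, invRev e)]) = invRev (e ++ s) := by simp [hA]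
  have h' : (q, d) ∈ walk 1 (A ++ [(0, invRev e)]) := by simp [h]
  obtain ⟨D, h1, h2, h3⟩ := rotate_at (P := P) (by rw [hc]; exact rels_invRev hr) h'
  refine ⟨D, h1, ?_, ?_⟩
  · rw [h2, hc, FreeGroup.inv_mk]
  · rw [h3, hc, length_invRev']

namespace Diag

variable {P : C6Presentation S} {k : ℕ} {N N' : ℕ}
  {recs : List (List (ℕ × Word S))}

theorem nil (P : C6Presentation S) (k N : ℕ) : Diag P k [] N N [] [] :=
  ⟨rfl, le_rfl, by simp, by simp, by simp, by simp, by simp, by simp, by simp⟩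

theorem cell {e s w₂ : Word S} {A₁ A₂ : List (ℕ × Word S)} (he : e ≠ []) (hr : e ++ s ∈ P.rels)
    (hmin : ∀ j < k + 1, ¬ Ar P j (FreeGroup.mk (e ++ w₂)))
    (har : Ar P k (FreeGroup.mk (invRev s ++ w₂)))
    (hred : FreeGroup.IsReduced (invRev s ++ w₂))
    (h : Diag P k (invRev s ++ w₂) N N' (A₁ ++ A₂) recs) (h₁ : cat A₁ = invRev s)
    (h₂ : cat A₂ = w₂) :
    Diag P (k + 1) (e ++ w₂) N (N' + 1) ((N', e) :: A₂)
      (((N', e) :: revPath A₁) :: recs) := by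
  set g := FreeGroup.mk (e ++ s) with hg
  have hge : FreeGroup.mk e = g * (1 * FreeGroup.mk (cat A₁)) := by
    rw [h₁, hg, ← FreeGroup.inv_mk, ← FreeGroup.mul_mk]; group
  have hgw : FreeGroup.mk (e ++ w₂) = g * FreeGroup.mk (invRev s ++ w₂) := by
    rw [hg, ← FreeGroup.mul_mk, ← FreeGroup.mul_mk, ← FreeGroup.mul_mk, ← FreeGroup.inv_mk]; group
  have hgar : Ar P 1 g := Ar.rel hr
  have hgone : P.toGrp g = 1 := hgar.map_eq_one
  have hidA : ∀ d ∈ A₁ ++ A₂, d.1 < N' := fun d hd => (h.ids d (by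
    rw [List.mem_append]; exact Or.inl hd)).2
  have hidC : ∀ C ∈ recs, ∀ d ∈ C, d.1 < N' := fun C hC d hd => (h.ids d (by
    rw [List.mem_append]; exact Or.inr (List.mem_flatten.2 ⟨C, hC, hd⟩))).2
  have hwalk : ∀ {q d}, (q, d) ∈ walk (FreeGroup.mk e) A₂ →
      (g⁻¹ * q, d) ∈ walk (1 * FreeGroup.mk (cat A₁)) A₂ := by
    intro q d hq
    rw [hge] at hq
    exact mem_walk_mul.1 hq
  have hw12 := walk_append (1 : FreeGroup S) A₁ A₂
  have hwalk' : ∀ {q d}, (q, d) ∈ walk (FreeGroup.mk e) A₂ →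
      (g⁻¹ * q, d) ∈ walk 1 (A₁ ++ A₂) := by
    intro q d hq
    rw [hw12]
    exact List.mem_append.2 (Or.inr (hwalk hq))
  have hbr := h.br
  rw [hw12, List.pairwise_append] at hbr
  have hpiece : ∀ C ∈ recs, ∀ d ∈ C, ∀ α, (d.1, α) ∈ A₁ →
      α = d.2 ∧ 6 * α.length < (cat C).length ∧ 6 * α.length < (e ++ s).length := by
    rintro C hC ⟨i, β⟩ hd α hα
    obtain ⟨p, hp⟩ := exists_mem_walk 1 hd
    obtain ⟨q, hq⟩ := exists_mem_walk 1 hα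
    obtain ⟨v₀, hv⟩ := h.exp C hC
    obtain ⟨rfl, -, j, hj, har⟩ := hv p i β q α hp (by rw [hw12]; simp [hq])
    obtain ⟨D, hD1, hD2, hD3⟩ := rotate_at (h.rel C hC) hp
    obtain ⟨D', hD'1, hD'2, hD'3⟩ := inv_rotate_at hr h₁ hq
    have hne : β ++ D ≠ β ++ D' := by
      intro heq
      apply hmin j (by omega)
      rw [hgw]
      simp only [heq] at hD2
      simp only [hD2] at hD'2
      convert har using 2
      have : g = (q * (p⁻¹ * FreeGroup.mk (cat C) * p) * q⁻¹)⁻¹ := by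
        rw [hD'2, hg]; group
      rw [this]; group
    exact ⟨rfl, hD3 ▸ piece_bound hD1 hD'1 hne, hD'3 ▸ piece_bound hD'1 hD1 hne.symm⟩
  refine ⟨?_, ?_, ?_, ?_, ?_, ?_, ?_, ?_, ?_⟩
  · simp [h₂]
  · have := h.le; omega
  · intro d hd
    have hle := h.le
    simp only [List.flatten_cons, List.mem_append, List.mem_cons] at hd
    have key : d = (N', e) ∨ d ∈ A₂ ∨ d ∈ revPath A₁ ∨ d ∈ recs.flatten := by tauto
    rcases key with rfl | hd | hd | hd
    · simp only; omega
    · have := h.ids d (by simp [hd]); omega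
    · obtain ⟨α, hα, -⟩ := mem_revPath hd
      have := h.ids (d.1, α) (by simp [hα]); simp only at this; omega
    · have := h.ids d (by rw [List.mem_append]; exact Or.inr hd); omega
  · intro d hd
    simp only [List.flatten_cons, List.mem_append, List.mem_cons] at hd
    have key : d = (N', e) ∨ d ∈ A₂ ∨ d ∈ revPath A₁ ∨ d ∈ recs.flatten := by tauto
    rcases key with rfl | hd | hd | hd
    · exact he
    · exact h.ne d (by simp [hd])
    · obtain ⟨α, hα, hd⟩ := mem_revPath hd
      have := h.ne (d.1, α) (by simp [hα])
      rw [hd]; intro h0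
      have h1 := length_invRev' α
      rw [h0] at h1
      exact this (List.length_eq_zero_iff.1 h1.symm)
    · exact h.ne d (by rw [List.mem_append]; exact Or.inr hd)
  · intro C hC
    rcases List.mem_cons.1 hC with rfl | hC
    · rw [cat_cons, cat_revPath, h₁, FreeGroup.invRev_invRev]; exact hr
    · exact h.rel C hC
  · intro C hC
    rcases List.mem_cons.1 hC with rfl | hC
    · refine ⟨1, ?_⟩
      have hcat : FreeGroup.mk (cat ((N', e) :: revPath A₁)) = g := by
        rw [cat_cons, cat_revPath, h₁, FreeGroup.invRev_invRev]
      rw [hcat]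
      intro p i α q β hp hq
      simp only [walk_cons, List.mem_cons, Prod.mk.injEq, one_mul] at hp hq
      rcases hp with ⟨rfl, rfl, rfl⟩ | hp <;> rcases hq with ⟨rfl, hi, rfl⟩ | hq
      · refine ⟨rfl, by simp, 0 + k, by omega, ?_⟩
        simpa [hgw] using har
      · have := hidA _ (List.mem_append_right _ (mem_of_mem_walk hq)); simp at this
      · obtain ⟨γ, hγ, -⟩ := mem_revPath (mem_of_mem_walk hp)
        have := hidA _ (List.mem_append_left _ hγ); simp only at this; omega
      · rw [hge] at hp
        have hp' := mem_walk_mul.1 hp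
        obtain ⟨q₀, α₀, hq₀, rfl, hpq⟩ := mem_walk_revPath hp'
        obtain ⟨hβ, k₁, k₂, hk, hk1, hk2⟩ := hbr.2.2 _ hq₀ _ (hwalk hq) rfl
        simp only at hβ hk1 hk2
        have hp1 : p = g * (q₀ * FreeGroup.mk α₀) := by rw [← hpq]; group
        refine ⟨hβ.symm, ?_, k₁ + k₂, by omega, ?_⟩
        · have h1 : P.toGrp ((q₀ * FreeGroup.mk α₀)⁻¹ * (g⁻¹ * q)) = 1 := hk1.map_eq_one
          rw [← hpq] at h1
          simp only [map_mul, map_inv, hgone, inv_one, one_mul] at h1 ⊢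
          exact (inv_mul_eq_one.1 h1).symm
        · have h1 := hk1.conj (g * (q₀ * FreeGroup.mk α₀))
          convert h1.mul hk2 using 1
          rw [hgw, hp1, hβ, ← FreeGroup.inv_mk]; group
    · obtain ⟨v₀, hv⟩ := h.exp C hC
      refine ⟨v₀, ?_⟩
      intro p i α q β hp hq
      simp only [walk_cons, List.mem_cons, Prod.mk.injEq, one_mul] at hq
      rcases hq with ⟨-, hi, -⟩ | hq
      · have := hidC C hC _ (mem_of_mem_walk hp); simp only at this; omega
      · obtain ⟨h1, h2, j, hj, har⟩ := hv _ _ _ _ _ hp (hwalk' hq)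
        refine ⟨h1, ?_, j + 1, by omega, ?_⟩
        · simpa [hgone] using h2
        · rw [add_comm]
          convert hgar.mul har using 1
          rw [hgw]; group
  · intro C hC d hd hdA
    rcases List.mem_cons.1 hC with rfl | hC
    · rw [cat_cons, cat_revPath, h₁, FreeGroup.invRev_invRev]
      rcases List.mem_cons.1 hd with rfl | hd
      · simp at hdA
      · obtain ⟨α, hα, hd⟩ := mem_revPath hd
        rw [hd, length_invRev']
        have hcnt := h.cnt d.1 (List.mem_map.2 ⟨(d.1, α), by simp [hα], rfl⟩)
        have h0 : (A₂.map Prod.fst).count d.1 = 0 := by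
          apply List.count_eq_zero_of_not_mem
          intro h; apply hdA; simp at h ⊢; exact Or.inr h
        simp only [List.map_append, List.count_append, h0] at hcnt
        by_cases hrec : 0 < (recs.flatten.map Prod.fst).count d.1
        · obtain ⟨d', hd', hdd⟩ := List.mem_map.1 (List.count_pos_iff.1 hrec)
          obtain ⟨C, hC, hd'⟩ := List.mem_flatten.1 hd'
          exact (hpiece C hC d' hd' α (hdd ▸ hα)).2.2
        · obtain ⟨B₁, B₂, B₃, α₁, α₂, rfl⟩ := exists_two_of_count (A := A₁) (i := d.1) (by omega)
          have hne1 := h.ne (d.1, α₁) (by simp)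
          have hb : α₂ = invRev α₁ := by
            have := hbr.1
            rw [walk_append, List.pairwise_append] at this
            have h3 := this.2.1
            simp only [walk_cons, walk_append, List.pairwise_cons, List.mem_append,
              List.mem_cons] at h3
            exact (h3.1 _ (Or.inr (Or.inl rfl)) rfl).1
          subst hb
          have hlen : α.length = α₁.length := by
            rcases h.word_of_id (i := d.1) (α := α₁) (β := α) (by simp)
              (List.mem_append_left _ hα) with rfl | rfl
            · rfl
            · simp
          simp only [cat_append, cat_cons] at h₁
          have hr' := rels_invRev hr
          rw [invRev_append', ← h₁] at hr'
          have hr1 : α₁ ++ (cat B₂ ++ (invRev α₁ ++ cat B₃ ++ invRev e ++ cat B₁)) ∈ P.rels := by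
            have := rels_rotate (u := cat B₁)
              (v := α₁ ++ (cat B₂ ++ (invRev α₁ ++ cat B₃)) ++ invRev e)
              (by simpa using hr')
            simpa using this
          have hr2 : α₁ ++ (invRev (cat B₂) ++ (invRev α₁ ++ invRev (cat B₃ ++ invRev e ++ cat B₁)))
              ∈ P.rels := by
            have := rels_invRev hr1
            have := rels_rotate (u := invRev (cat B₃ ++ invRev e ++ cat B₁))
              (v := α₁ ++ invRev (cat B₂) ++ invRev α₁) (by simpa [invRev_append'] using this)
            simpa using this
          have hne : α₁ ++ (cat B₂ ++ (invRev α₁ ++ cat B₃ ++ invRev e ++ cat B₁)) ≠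
              α₁ ++ (invRev (cat B₂) ++ (invRev α₁ ++ invRev (cat B₃ ++ invRev e ++ cat B₁))) := by
            intro heq
            have h3 := (List.append_inj (List.append_cancel_left heq) (by simp)).1
            have hred1 : FreeGroup.IsReduced (cat B₂) := hred.subword
              ⟨cat B₁ ++ α₁, invRev α₁ ++ cat B₃ ++ w₂, by simp [← h₁]⟩
            have h4 := eq_nil_of_invRev_eq hred1 h3.symm
            rw [← h₁, h4] at hred
            exact not_isReduced_append_invRev (u := cat B₁) (v := cat B₃ ++ w₂) hne1
              (by simpa using hred)
          have := piece_bound hr1 hr2 hne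
          rw [hlen]
          refine this.trans_eq ?_
          have := congrArg List.length h₁
          simp at this ⊢
          omega
    · by_cases h3 : d.1 ∈ A₁.map Prod.fst
      · obtain ⟨⟨i, α⟩, hα, hi⟩ := List.mem_map.1 h3
        obtain ⟨rfl, h4, -⟩ := hpiece C hC d hd α (hi ▸ hα)
        exact h4
      · refine h.int C hC d hd ?_
        rw [List.map_append, List.mem_append]
        rintro (h4 | h4)
        · exact h3 h4
        · exact hdA (List.mem_cons_of_mem _ h4)
  · intro i hi
    simp only [List.map_cons, List.mem_cons] at hi
    have hc := ids_revPath A₁ i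
    have hsum : (((N', e) :: A₂ ++ (((N', e) :: revPath A₁) :: recs).flatten).map Prod.fst).count i
        = ((A₁ ++ A₂ ++ recs.flatten).map Prod.fst).count i + 2 * [N'].count i := by
      simp only [List.flatten_cons, List.map_append, List.map_cons, List.count_append,
        List.count_cons, List.count_nil, hc]
      omega
    rw [hsum]
    by_cases hiN : i = N'
    · subst hiN
      have : ((A₁ ++ A₂ ++ recs.flatten).map Prod.fst).count i = 0 := by
        apply List.count_eq_zero_of_not_mem
        intro h3
        obtain ⟨d, hd, rfl⟩ := List.mem_map.1 h3
        have := (h.ids d hd).2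
        omega
      rw [this]; simp
    · have h3 := h.cnt i (by
        rw [List.map_append, List.mem_append]; exact Or.inr (hi.resolve_left hiN))
      rw [h3, List.count_eq_zero_of_not_mem (by simpa using hiN)]
  · rw [walk_cons, List.pairwise_cons]
    constructor
    · rintro ⟨q, d⟩ hd hid
      have := hidA d (List.mem_append_right _ (mem_of_mem_walk hd))
      simp only at hid
      omega
    · rw [one_mul, hge, walk_mul, List.pairwise_map]
      refine hbr.2.1.imp ?_
      rintro ⟨q, d⟩ ⟨q', d'⟩ hb hid
      obtain ⟨h3, k₁, k₂, hk, h4, h5⟩ := hb hid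
      refine ⟨h3, k₁, 1 + k₂, by omega, ?_, ?_⟩
      · convert h4 using 1; simp only; group
      · convert hgar.mul h5 using 1
        rw [hgw]; simp only; group

end Diag

theorem BrRel.translate {P : C6Presentation S} {k l : ℕ} {w w' h : FreeGroup S}
    {x y : FreeGroup S × ℕ × Word S} (hw : ∀ j z, Ar P j (z * w) → Ar P (l + j) (h * z * h⁻¹ * w'))
    (hb : BrRel P k w x y) : BrRel P (l + k) w' (h * x.1, x.2) (h * y.1, y.2) := by
  intro hid
  obtain ⟨h3, k₁, k₂, hk, h4, h5⟩ := hb hid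
  refine ⟨h3, k₁, l + k₂, by omega, ?_, ?_⟩
  · convert h4 using 1; simp only; group
  · convert hw _ _ h5 using 1; simp only; group

theorem Exposed.translate {P : C6Presentation S} {k l : ℕ} {w w' h : FreeGroup S}
    {A A' C : List (ℕ × Word S)}
    (hw : ∀ j z, Ar P j (z * w) → Ar P (l + j) (h * z * h⁻¹ * w'))
    (hA : ∀ p q i α β, (p, i, α) ∈ walk 1 C → (q, i, β) ∈ walk 1 A' → (h⁻¹ * q, i, β) ∈ walk 1 A)
    (he : Exposed P k w A C) : Exposed P (l + k) w' A' C := by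
  obtain ⟨v₀, hv⟩ := he
  refine ⟨P.toGrp h * v₀, ?_⟩
  intro p i α q β hp hq
  obtain ⟨h1, h2, j, hj, har⟩ := hv _ _ _ _ _ hp (hA _ _ _ _ _ hp hq)
  refine ⟨h1, ?_, l + j, by omega, ?_⟩
  · rw [mul_assoc, ← h2, ← map_mul]; simp
  · convert hw _ _ har using 1
    group

namespace Diag

variable {P : C6Presentation S} {k : ℕ} {N N' : ℕ}
  {recs : List (List (ℕ × Word S))}

theorem bridge {kx ky N₁ N₂ : ℕ} {π x y : Word S} {Ax Ay : List (ℕ × Word S)}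
    {recsx recsy : List (List (ℕ × Word S))} (hπ : π ≠ [])
    (hx : Diag P kx x N N₁ Ax recsx) (hy : Diag P ky y (N₁ + 1) N₂ Ay recsy)
    (harx : Ar P kx (FreeGroup.mk x)) (hary : Ar P ky (FreeGroup.mk y)) :
    Diag P (kx + ky) (π ++ x ++ invRev π ++ y) N N₂
      ((N₁, π) :: (Ax ++ (N₁, invRev π) :: Ay)) (recsx ++ recsy) := by
  set h := FreeGroup.mk π * FreeGroup.mk x * (FreeGroup.mk π)⁻¹ with hh
  have hhar : Ar P kx h := harx.conj _
  have hw : FreeGroup.mk (π ++ x ++ invRev π ++ y) =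
      FreeGroup.mk π * FreeGroup.mk x * (FreeGroup.mk π)⁻¹ * FreeGroup.mk y := by
    rw [FreeGroup.inv_mk]; simp only [← FreeGroup.mul_mk]
  have hwx : ∀ j z, Ar P j (z * FreeGroup.mk x) → Ar P (ky + j) (FreeGroup.mk π * z *
      (FreeGroup.mk π)⁻¹ * FreeGroup.mk (π ++ x ++ invRev π ++ y)) := by
    intro j z hz
    rw [add_comm]
    convert (hz.conj (FreeGroup.mk π)).mul hary using 1
    rw [hw]; group
  have hwy : ∀ j z, Ar P j (z * FreeGroup.mk y) → Ar P (kx + j) (h * z * h⁻¹ *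
      FreeGroup.mk (π ++ x ++ invRev π ++ y)) := by
    intro j z hz
    convert hhar.mul hz using 1
    rw [hw, hh]; group
  have hidx := hx.ids
  have hidy := hy.ids
  have hlex := hx.le
  have hley := hy.le
  simp only [List.mem_append] at hidx hidy
  have hwalk : walk 1 ((N₁, π) :: (Ax ++ (N₁, invRev π) :: Ay)) = (1, N₁, π) ::
      (walk (FreeGroup.mk π * 1) Ax ++ (FreeGroup.mk π * FreeGroup.mk x, N₁, invRev π) ::
        walk (h * 1) Ay) := by
    simp [hx.cat_eq, hh, FreeGroup.inv_mk]
  have hidwx : ∀ {q i α}, (q, i, α) ∈ walk (FreeGroup.mk π * 1) Ax → N ≤ i ∧ i < N₁ :=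
    fun hq => hidx _ (Or.inl (mem_of_mem_walk hq))
  have hidwy : ∀ {q i α}, (q, i, α) ∈ walk (h * 1) Ay → N₁ + 1 ≤ i ∧ i < N₂ :=
    fun hq => hidy _ (Or.inl (mem_of_mem_walk hq))
  refine ⟨?_, ?_, ?_, ?_, ?_, ?_, ?_, ?_, ?_⟩
  · simp [hx.cat_eq, hy.cat_eq]
  · omega
  · intro d hd
    simp only [List.flatten_append, List.mem_append, List.mem_cons] at hd
    rcases hd with (rfl | hd | rfl | hd) | hd | hd
    · simp only; omega
    · have := hidx d (Or.inl hd); omega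
    · simp only; omega
    · have := hidy d (Or.inl hd); omega
    · have := hidx d (Or.inr hd); omega
    · have := hidy d (Or.inr hd); omega
  · intro d hd
    have hnex := hx.ne
    have hney := hy.ne
    simp only [List.flatten_append, List.mem_append, List.mem_cons] at hd hnex hney
    rcases hd with (rfl | hd | rfl | hd) | hd | hd
    · exact hπ
    · exact hnex d (Or.inl hd)
    · intro h0
      have := length_invRev' π
      simp only at h0
      rw [h0] at this
      exact hπ (List.length_eq_zero_iff.1 this.symm)
    · exact hney d (Or.inl hd)
    · exact hnex d (Or.inr hd)
    · exact hney d (Or.inr hd)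
  · intro C hC
    rcases List.mem_append.1 hC with hC | hC
    · exact hx.rel C hC
    · exact hy.rel C hC
  · intro C hC
    rcases List.mem_append.1 hC with hC | hC
    · rw [add_comm]
      refine (hx.exp C hC).translate hwx ?_
      intro p q i α β hp hq
      have hi := hidx (i, α) (Or.inr (List.mem_flatten.2 ⟨C, hC, mem_of_mem_walk hp⟩))
      rw [hwalk] at hq
      simp only [List.mem_cons, List.mem_append, Prod.mk.injEq] at hq hi
      rcases hq with ⟨-, hq, -⟩ | hq | ⟨-, hq, -⟩ | hq
      · omega
      · exact mem_walk_mul.1 hq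
      · omega
      · have := hidwy hq; omega
    · refine (hy.exp C hC).translate hwy ?_
      intro p q i α β hp hq
      have hi := hidy (i, α) (Or.inr (List.mem_flatten.2 ⟨C, hC, mem_of_mem_walk hp⟩))
      rw [hwalk] at hq
      simp only [List.mem_cons, List.mem_append, Prod.mk.injEq] at hq hi
      rcases hq with ⟨-, hq, -⟩ | hq | ⟨-, hq, -⟩ | hq
      · omega
      · have := hidwx hq; omega
      · omega
      · exact mem_walk_mul.1 hq
  · intro C hC e he hne
    simp only [List.map_cons, List.map_append, List.mem_cons, List.mem_append, not_or] at hne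
    rcases List.mem_append.1 hC with hC | hC
    · exact hx.int C hC e he hne.2.1
    · exact hy.int C hC e he hne.2.2.2
  · intro i hi
    have hsum : (((N₁, π) :: (Ax ++ (N₁, invRev π) :: Ay) ++ (recsx ++ recsy).flatten).map
        Prod.fst).count i = ((Ax ++ recsx.flatten).map Prod.fst).count i +
          ((Ay ++ recsy.flatten).map Prod.fst).count i + 2 * [N₁].count i := by
      simp only [List.flatten_append, List.map_append, List.map_cons, List.count_append,
        List.count_cons, List.count_nil, List.cons_append]
      omega
    have hzx : ¬ (N ≤ i ∧ i < N₁) → ((Ax ++ recsx.flatten).map Prod.fst).count i = 0 := by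
      intro hi
      apply List.count_eq_zero_of_not_mem
      intro h3
      obtain ⟨d, hd, rfl⟩ := List.mem_map.1 h3
      exact hi (hx.ids d hd)
    have hzy : ¬ (N₁ + 1 ≤ i ∧ i < N₂) → ((Ay ++ recsy.flatten).map Prod.fst).count i = 0 := by
      intro hi
      apply List.count_eq_zero_of_not_mem
      intro h3
      obtain ⟨d, hd, rfl⟩ := List.mem_map.1 h3
      exact hi (hy.ids d hd)
    rw [hsum]
    simp only [List.map_cons, List.map_append, List.mem_cons, List.mem_append] at hi
    have key : i = N₁ ∨ i ∈ Ax.map Prod.fst ∨ i ∈ Ay.map Prod.fst := by tauto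
    rcases key with rfl | hi | hi
    · rw [hzx (by omega), hzy (by omega)]; simp
    · obtain ⟨d, hd, hdi⟩ := List.mem_map.1 hi
      have := hidx d (Or.inl hd)
      rw [hx.cnt i hi, hzy (by omega), List.count_eq_zero_of_not_mem (by simp; omega)]
    · obtain ⟨d, hd, hdi⟩ := List.mem_map.1 hi
      have := hidy d (Or.inl hd)
      rw [hy.cnt i hi, hzx (by omega), List.count_eq_zero_of_not_mem (by simp; omega)]
  · rw [hwalk, List.pairwise_cons, List.pairwise_append, List.pairwise_cons]
    refine ⟨?_, ?_, ⟨?_, ?_⟩, ?_⟩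
    · rintro ⟨q, i, α⟩ hq hi
      simp only [List.mem_append, List.mem_cons, Prod.mk.injEq] at hq hi
      rcases hq with hq | ⟨rfl, rfl, rfl⟩ | hq
      · have := hidwx hq; omega
      · refine ⟨rfl, kx, ky, le_rfl, ?_, ?_⟩
        · convert harx using 1; simp only; group
        · convert hary using 1
          simp only [hw, ← FreeGroup.inv_mk]; group
      · have := hidwy hq; omega
    · rw [walk_mul, List.pairwise_map, add_comm]
      exact hx.br.imp fun hb => hb.translate hwx
    · rintro ⟨q, i, α⟩ hq hi
      have := hidwy hq
      simp only at hi; omega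
    · rw [walk_mul, List.pairwise_map]
      exact hy.br.imp fun hb => hb.translate hwy
    · rintro ⟨p, j, α⟩ hp ⟨q, i, β⟩ hq hi
      have h3 := hidwx hp
      simp only [List.mem_cons, Prod.mk.injEq] at hq hi
      rcases hq with ⟨-, rfl, -⟩ | hq
      · omega
      · have := hidwy hq; omega

end Diag

theorem exists_conj_cyclic {x : Word S} (hx : FreeGroup.IsReduced x) (hne : x ≠ []) :
    ∃ π x', x = π ++ x' ++ invRev π ∧ x' ≠ [] ∧ FreeGroup.IsReduced (x' ++ x') := by
  induction hn : x.length using Nat.strong_induction_on generalizing x with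
  | _ n ih =>
  by_cases hc : FreeGroup.IsReduced (x ++ x)
  · exact ⟨[], x, by simp, hne, hc⟩
  · obtain ⟨a, y, rfl⟩ := List.exists_cons_of_ne_nil hne
    rcases List.eq_nil_or_concat y with rfl | ⟨z, b, rfl⟩
    · exact absurd (by simp [FreeGroup.IsReduced]) hc
    · rw [List.concat_eq_append] at *
      have hb : b = linv a := by
        by_contra hb
        apply hc
        have h2 : FreeGroup.IsReduced [b, a] := by
          simp only [FreeGroup.IsReduced, List.isChain_cons_cons, List.isChain_singleton, and_true]
          intro h1
          by_contra h2
          apply hb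
          rcases a with ⟨a, e⟩
          rcases b with ⟨b, f⟩
          simp only [linv, Prod.mk.injEq] at *
          refine ⟨h1, ?_⟩
          cases e <;> cases f <;> simp_all
        have h3 : FreeGroup.IsReduced ((a :: z) ++ [b] ++ [a]) := by
          refine FreeGroup.IsReduced.append_overlap ?_ ?_ (by simp)
          · simpa using hx
          · simpa using h2
        have h4 : FreeGroup.IsReduced ((a :: z ++ [b]) ++ [a] ++ (z ++ [b])) :=
          FreeGroup.IsReduced.append_overlap h3 (by simpa using hx) (by simp)
        simpa using h4
      subst hb
      have hz : FreeGroup.IsReduced z := hx.subword ⟨[a], [linv a], by simp⟩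
      have hz0 : z ≠ [] := by
        rintro rfl
        exact @not_isReduced_pair S [] [] a (by simpa using hx)
      obtain ⟨π, x', rfl, h1, h2⟩ := ih z.length (by simp [← hn]) hz hz0 rfl
      exact ⟨a :: π, x', by simp [invRev_cons'], h1, h2⟩

theorem exists_diag {P : C6Presentation S} (k : ℕ) : ∀ (w : Word S), FreeGroup.IsReduced w →
    Ar P k (mk w) → (∀ j < k, ¬ Ar P j (mk w)) → w ≠ [] → ∀ N, ∃ N' A recs,
      Diag P k w N N' A recs ∧ 2 ≤ euler A recs ∧
        (FreeGroup.IsReduced (w ++ w) → 4 ≤ euler A recs) := by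
  induction k using Nat.strong_induction_on with
  | _ k ihk =>
  intro w
  induction hn : w.length using Nat.strong_induction_on generalizing w k with
  | _ n ihn =>
  intro hw har hmin hne N
  rcases peel_cases hw hne har with ⟨j, e, s, w₂, rfl, rfl, he, hr, har', hred⟩ |
    ⟨a, x, y, kx, ky, rfl, hx, hy, rfl⟩
  · have hmin' : ∀ i < j, ¬ Ar P i (mk (invRev s ++ w₂)) := by
      intro i hi hi'
      apply hmin (i + 1) (by omega)
      rw [add_comm]
      convert (Ar.rel hr).mul hi' using 1
      simp only [← FreeGroup.mul_mk, ← FreeGroup.inv_mk]; group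
    have key : ∃ N' A₁ A₂ recs, Diag P j (invRev s ++ w₂) N N' (A₁ ++ A₂) recs ∧
        cat A₁ = invRev s ∧ cat A₂ = w₂ ∧ 0 ≤ euler (A₁ ++ A₂) recs := by
      by_cases h0 : invRev s ++ w₂ = []
      · obtain ⟨h1, rfl⟩ := List.append_eq_nil_iff.1 h0
        rw [h1]
        exact ⟨N, [], [], [], Diag.nil P j N, rfl, rfl, by simp [euler]⟩
      · obtain ⟨N', A, recs, hD, h2, -⟩ := ihk j (by omega) _ hred har' hmin' h0 N
        obtain ⟨N'', A₁, A₂, recs', hD', h3, h4, h5⟩ := hD.cut hred rfl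
        exact ⟨N'', A₁, A₂, recs', hD', h3, h4, by omega⟩
    obtain ⟨N', A₁, A₂, recs, hD, h1, h2, h3⟩ := key
    refine ⟨_, _, _, Diag.cell he hr hmin har' hred hD h1 h2, ?_⟩
    rw [euler_eq] at h3 ⊢
    simp only [List.length_append, List.length_cons, List.flatten_cons, length_revPath] at h3 ⊢
    push_cast at h3 ⊢
    constructor
    · linarith
    · intro; linarith
  · have hmx : ∀ i < kx, ¬ Ar P i (mk x) := by
      intro i hi hi'
      apply hmin (i + ky) (by omega)
      convert (hi'.conj (mk [a])).mul hy using 1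
      simp [FreeGroup.inv_mk, invRev_singleton]
    have hmy : ∀ i < ky, ¬ Ar P i (mk y) := by
      intro i hi hi'
      apply hmin (kx + i) (by omega)
      convert (hx.conj (mk [a])).mul hi' using 1
      simp [FreeGroup.inv_mk, invRev_singleton]
    have hxr : FreeGroup.IsReduced x := hw.subword ⟨[a], linv a :: y, by simp⟩
    have hyr : FreeGroup.IsReduced y := hw.subword ⟨a :: x ++ [linv a], [], by simp⟩
    have hx0 : x ≠ [] := by
      rintro rfl
      exact @not_isReduced_pair S [] y a (by simpa using hw)
    obtain ⟨π, x', rfl, hx'0, hx'c⟩ := exists_conj_cyclic hxr hx0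
    have hconj : mk x' = (mk π)⁻¹ * mk (π ++ x' ++ invRev π) * (mk π)⁻¹⁻¹ := by
      simp only [← FreeGroup.mul_mk, ← FreeGroup.inv_mk]; group
    have hx' : Ar P kx (mk x') := by rw [hconj]; exact hx.conj _
    have hmx' : ∀ i < kx, ¬ Ar P i (mk x') := by
      intro i hi hi'
      apply hmx i hi
      convert hi'.conj (mk π) using 1
      simp only [← FreeGroup.mul_mk, ← FreeGroup.inv_mk]
    have hx'r : FreeGroup.IsReduced x' := hxr.subword ⟨π, invRev π, by simp⟩
    have key : ∀ l z, l ≤ kx + ky → z.length < n → FreeGroup.IsReduced z → Ar P l (mk z) →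
        (∀ j < l, ¬ Ar P j (mk z)) → z ≠ [] → ∀ N, ∃ N' A recs,
          Diag P l z N N' A recs ∧ 2 ≤ euler A recs ∧
          (FreeGroup.IsReduced (z ++ z) → 4 ≤ euler A recs) := by
      intro l z hl hz h1 h2 h3 h4
      rcases Nat.lt_or_ge l (kx + ky) with hl' | hl'
      · exact ihk l hl' z h1 h2 h3 h4
      · exact ihn z.length hz l (fun m hm => ihk m (by omega)) z rfl h1 h2 h3 h4
    obtain ⟨N₁, Ax, recsx, hDx, -, hex⟩ := key kx x' (by omega)
      (by simp [← hn]; omega) hx'r hx' hmx' hx'0 N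
    have hex := hex hx'c
    have hyd : ∃ N₂ Ay recsy, Diag P ky y (N₁ + 1) N₂ Ay recsy ∧ 0 ≤ euler Ay recsy ∧
        (y ≠ [] → 2 ≤ euler Ay recsy) := by
      by_cases hy0 : y = []
      · subst hy0
        exact ⟨_, [], [], Diag.nil P ky _, by simp [euler], fun h => absurd rfl h⟩
      · obtain ⟨N₂, Ay, recsy, hDy, h2, -⟩ := key ky y (by omega)
          (by simp [← hn]; omega) hyr hy hmy hy0 (N₁ + 1)
        exact ⟨N₂, Ay, recsy, hDy, by omega, fun _ => h2⟩
    obtain ⟨N₂, Ay, recsy, hDy, hey0, hey⟩ := hyd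
    have hD := Diag.bridge (π := a :: π) (by simp) hDx hDy hx' hy
    have hword : a :: π ++ x' ++ invRev (a :: π) ++ y =
        a :: (π ++ x' ++ invRev π ++ linv a :: y) := by simp [invRev_cons']
    rw [hword] at hD
    have heu : euler ((N₁, a :: π) :: (Ax ++ (N₁, invRev (a :: π)) :: Ay)) (recsx ++ recsy) =
        euler Ax recsx + euler Ay recsy - 2 := by
      simp only [euler_eq, List.length_append, List.length_cons, List.flatten_append]
      push_cast
      ring
    refine ⟨N₂, _, _, hD, ?_, ?_⟩
    · rw [heu]; omega
    · intro hcyc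
      have hy0 : y ≠ [] := by
        rintro rfl
        refine @not_isReduced_pair S (a :: (π ++ x' ++ invRev π))
          ((π ++ x' ++ invRev π) ++ [linv a]) (linv a) ?_
        simpa using hcyc
      have := hey hy0
      rw [heu]; omega

/-- Combinatorial data of a diagram whose exterior boundary path `A` spells a word without proper
null infixes. -/
structure DiskData (P : C6Presentation S) (z : Word S) (A : List (ℕ × Word S))
    (recs : List (List (ℕ × Word S))) : Prop where
  cat_eq : cat A = z
  ne_path : ∀ e ∈ A, e.2 ≠ []
  ne_cell : ∀ C ∈ recs, ∀ e ∈ C, e.2 ≠ []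
  rel : ∀ C ∈ recs, cat C ∈ P.rels
  exp : ∀ C ∈ recs, ∃ v₀ : P.Grp, ∀ p i α q β, (p, i, α) ∈ walk 1 C → (q, i, β) ∈ walk 1 A →
    α = β ∧ P.toGrp q = v₀ * P.toGrp p
  int : ∀ C ∈ recs, ∀ e ∈ C, e.1 ∉ A.map Prod.fst → 6 * e.2.length < (cat C).length
  nodup : (A.map Prod.fst).Nodup
  cnt : ∀ i ∈ A.map Prod.fst, (recs.flatten.map Prod.fst).count i = 1

namespace DiskData

variable {P : C6Presentation S} {z : Word S} {A A₁ A₂ C₁ C₂ : List (ℕ × Word S)}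
  {recs L₁ L₂ : List (List (ℕ × Word S))} {i j : ℕ} {α β : Word S}

theorem rotate (h : DiskData P z A (L₁ ++ (C₁ ++ C₂) :: L₂)) :
    DiskData P z A (L₁ ++ (C₂ ++ C₁) :: L₂) := by
  have hmem : ∀ C ∈ L₁ ++ (C₂ ++ C₁) :: L₂,
      C ∈ L₁ ++ (C₁ ++ C₂) :: L₂ ∨ C = C₂ ++ C₁ := by
    intro C hC
    simp only [List.mem_append, List.mem_cons] at hC ⊢
    tauto
  have hC0 : C₁ ++ C₂ ∈ L₁ ++ (C₁ ++ C₂) :: L₂ := by simp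
  refine ⟨h.cat_eq, h.ne_path, ?_, ?_, ?_, ?_, h.nodup, ?_⟩
  · intro C hC
    rcases hmem C hC with hC | rfl
    · exact h.ne_cell C hC
    · intro e he
      exact h.ne_cell _ hC0 e (by simp only [List.mem_append] at he ⊢; tauto)
  · intro C hC
    rcases hmem C hC with hC | rfl
    · exact h.rel C hC
    · have := h.rel _ hC0
      rw [cat_append] at this ⊢
      exact rels_rotate this
  · intro C hC
    rcases hmem C hC with hC | rfl
    · exact h.exp C hC
    · obtain ⟨v₀, hv⟩ := h.exp _ hC0
      refine ⟨v₀ * P.toGrp (FreeGroup.mk (cat C₁)), ?_⟩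
      intro p i α q β hp hq
      rw [walk_append, List.mem_append] at hp
      rcases hp with hp | hp
      · have h1 : (FreeGroup.mk (cat C₁) * p, i, α) ∈ walk 1 (C₁ ++ C₂) := by
          rw [walk_append, List.mem_append]
          right
          have : (1 : FreeGroup S) * FreeGroup.mk (cat C₁) = FreeGroup.mk (cat C₁) * 1 := by simp
          rw [this, mem_walk_mul, inv_mul_cancel_left]
          exact hp
        have := hv _ _ _ _ _ h1 hq
        rw [map_mul] at this
        rw [mul_assoc]
        exact this
      · have h1 : ((FreeGroup.mk (cat C₂))⁻¹ * p, i, α) ∈ walk 1 (C₁ ++ C₂) := by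
          rw [walk_append, List.mem_append]
          left
          have : (1 : FreeGroup S) * FreeGroup.mk (cat C₂) = FreeGroup.mk (cat C₂) * 1 := by simp
          rw [this, mem_walk_mul] at hp
          exact hp
        obtain ⟨h2, h3⟩ := hv _ _ _ _ _ h1 hq
        refine ⟨h2, ?_⟩
        have h4 : P.toGrp (FreeGroup.mk (cat C₁) * FreeGroup.mk (cat C₂)) = 1 := by
          have := h.rel _ hC0
          rw [cat_append] at this
          rw [FreeGroup.mul_mk]
          exact (Ar.rel this).map_eq_one
        rw [map_mul] at h4
        rw [h3, map_mul, map_inv, ← eq_inv_of_mul_eq_one_left h4, mul_assoc]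
  · intro C hC
    rcases hmem C hC with hC | rfl
    · exact h.int C hC
    · intro e he hA
      have := h.int _ hC0 e (by simp only [List.mem_append] at he ⊢; tauto) hA
      simp only [cat_append, List.length_append] at this ⊢
      omega
  · intro i hi
    have := h.cnt i hi
    simp only [List.flatten_append, List.flatten_cons, List.map_append, List.count_append]
      at this ⊢
    omega

theorem merge (h : DiskData P z (A₁ ++ (i, α) :: (j, β) :: A₂)
      (L₁ ++ (C₁ ++ (i, α) :: (j, β) :: C₂) :: L₂)) :
    DiskData P z (A₁ ++ (i, α ++ β) :: A₂) (L₁ ++ (C₁ ++ (i, α ++ β) :: C₂) :: L₂) := by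
  have hi := h.cnt i (by simp)
  have hj := h.cnt j (by simp)
  have hnd := h.nodup
  simp only [List.flatten_append, List.flatten_cons, List.map_append, List.count_append,
    List.map_cons, List.count_cons, beq_self_eq_true, if_true] at hi hj
  simp only [List.map_append, List.map_cons, List.nodup_append, List.nodup_cons,
    List.mem_cons, not_or] at hnd
  obtain ⟨hnd1, ⟨⟨hij, hiA2⟩, hjA2, hnd2⟩, hnd3⟩ := hnd
  have hij' : ((i == j) = false) := by simpa using hij
  have hji' : ((j == i) = false) := by simpa using Ne.symm hij
  rw [hij'] at hj
  rw [hji'] at hi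
  have hiA1 : i ∉ A₁.map Prod.fst := fun h => (hnd3 i h i (by simp)) rfl
  have hjA1 : j ∉ A₁.map Prod.fst := fun h => (hnd3 j h j (by simp)) rfl
  have hz : ∀ {k : ℕ} {L : List (ℕ × Word S)}, (L.map Prod.fst).count k = 0 →
      ∀ e ∈ L, e.1 ≠ k := by
    rintro k L hk e he rfl
    exact List.count_eq_zero.1 hk (List.mem_map.2 ⟨e, he, rfl⟩)
  have hL₁i := hz (k := i) (L := L₁.flatten) (by omega)
  have hL₂i := hz (k := i) (L := L₂.flatten) (by omega)
  have hC₁i := hz (k := i) (L := C₁) (by omega)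
  have hC₂i := hz (k := i) (L := C₂) (by omega)
  have hL₁j := hz (k := j) (L := L₁.flatten) (by omega)
  have hL₂j := hz (k := j) (L := L₂.flatten) (by omega)
  have hC₁j := hz (k := j) (L := C₁) (by omega)
  have hC₂j := hz (k := j) (L := C₂) (by omega)
  have hC0 : C₁ ++ (i, α) :: (j, β) :: C₂ ∈ L₁ ++ (C₁ ++ (i, α) :: (j, β) :: C₂) :: L₂ := by simp
  have hmem : ∀ C ∈ L₁ ++ (C₁ ++ (i, α ++ β) :: C₂) :: L₂,
      (C ∈ L₁ ++ (C₁ ++ (i, α) :: (j, β) :: C₂) :: L₂ ∧ ∀ e ∈ C, e.1 ≠ i ∧ e.1 ≠ j) ∨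
        C = C₁ ++ (i, α ++ β) :: C₂ := by
    intro C hC
    simp only [List.mem_append, List.mem_cons] at hC ⊢
    rcases hC with hC | hC | hC
    · exact Or.inl ⟨Or.inl hC, fun e he => ⟨hL₁i e (List.mem_flatten.2 ⟨C, hC, he⟩),
        hL₁j e (List.mem_flatten.2 ⟨C, hC, he⟩)⟩⟩
    · exact Or.inr hC
    · exact Or.inl ⟨Or.inr (Or.inr hC), fun e he => ⟨hL₂i e (List.mem_flatten.2 ⟨C, hC, he⟩),
        hL₂j e (List.mem_flatten.2 ⟨C, hC, he⟩)⟩⟩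
  have hw : ∀ {L M : List (ℕ × Word S)} {q k γ}, k ≠ i →
      (q, k, γ) ∈ walk 1 (L ++ (i, α ++ β) :: M) →
      (q, k, γ) ∈ walk 1 (L ++ (i, α) :: (j, β) :: M) := by
    intro L M q k γ hk hq
    simp only [walk_append, walk_cons, List.mem_append, List.mem_cons, Prod.mk.injEq] at hq ⊢
    rcases hq with hq | hq | hq
    · exact Or.inl hq
    · exact absurd hq.2.1 hk
    · rw [← FreeGroup.mul_mk, ← mul_assoc] at hq
      exact Or.inr (Or.inr (Or.inr hq))
  refine ⟨?_, ?_, ?_, ?_, ?_, ?_, ?_, ?_⟩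
  · rw [← h.cat_eq]; simp
  · intro e he
    simp only [List.mem_append, List.mem_cons] at he
    rcases he with he | rfl | he
    · exact h.ne_path e (by simp [he])
    · have := h.ne_path (i, α) (by simp)
      simpa using fun h1 => absurd h1 this
    · exact h.ne_path e (by simp [he])
  · intro C hC e he
    rcases hmem C hC with ⟨hC, -⟩ | rfl
    · exact h.ne_cell C hC e he
    · simp only [List.mem_append, List.mem_cons] at he
      rcases he with he | rfl | he
      · exact h.ne_cell _ hC0 e (by simp [he])
      · have := h.ne_path (i, α) (by simp)
        simpa using fun h1 => absurd h1 this
      · exact h.ne_cell _ hC0 e (by simp [he])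
  · intro C hC
    rcases hmem C hC with ⟨hC, -⟩ | rfl
    · exact h.rel C hC
    · simpa using h.rel _ hC0
  · intro C hC
    rcases hmem C hC with ⟨hC, hCi⟩ | rfl
    · obtain ⟨v₀, hv⟩ := h.exp C hC
      refine ⟨v₀, fun p k γ q δ hp hq => hv p k γ q δ hp (hw ?_ hq)⟩
      exact (hCi _ (mem_of_mem_walk hp)).1
    · obtain ⟨v₀, hv⟩ := h.exp _ hC0
      refine ⟨v₀, fun p k γ q δ hp hq => ?_⟩
      by_cases hk : k = i
      · subst hk
        have h1 : p = 1 * FreeGroup.mk (cat C₁) ∧ γ = α ++ β := by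
          simp only [walk_append, walk_cons, List.mem_append, List.mem_cons, Prod.mk.injEq] at hp
          rcases hp with hp | ⟨h1, -, h2⟩ | hp
          · exact absurd rfl (hC₁i _ (mem_of_mem_walk hp))
          · exact ⟨h1, h2⟩
          · exact absurd rfl (hC₂i _ (mem_of_mem_walk hp))
        have h2 : q = 1 * FreeGroup.mk (cat A₁) ∧ δ = α ++ β := by
          simp only [walk_append, walk_cons, List.mem_append, List.mem_cons, Prod.mk.injEq] at hq
          rcases hq with hq | ⟨h1, -, h2⟩ | hq
          · exact absurd (List.mem_map.2 ⟨_, mem_of_mem_walk hq, rfl⟩) hiA1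
          · exact ⟨h1, h2⟩
          · exact absurd (List.mem_map.2 ⟨_, mem_of_mem_walk hq, rfl⟩) hiA2
        refine ⟨h1.2.trans h2.2.symm, ?_⟩
        rw [h1.1, h2.1]
        exact (hv _ k α _ α (by simp) (by simp)).2
      · exact hv _ _ _ _ _ (hw hk hp) (hw hk hq)
  · intro C hC e he hne
    simp only [List.map_append, List.map_cons, List.mem_append, List.mem_cons, not_or] at hne
    have key : e.1 ≠ j → e.1 ∉ (A₁ ++ (i, α) :: (j, β) :: A₂).map Prod.fst := by
      intro h1
      simp only [List.map_append, List.map_cons, List.mem_append, List.mem_cons, not_or]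
      tauto
    rcases hmem C hC with ⟨hC, hCi⟩ | rfl
    · exact h.int C hC e he (key (hCi e he).2)
    · have : cat (C₁ ++ (i, α ++ β) :: C₂) = cat (C₁ ++ (i, α) :: (j, β) :: C₂) := by simp
      rw [this]
      simp only [List.mem_append, List.mem_cons] at he
      rcases he with he | rfl | he
      · exact h.int _ hC0 e (by simp [he]) (key (hC₁j e he))
      · exact absurd rfl hne.2.1
      · exact h.int _ hC0 e (by simp [he]) (key (hC₂j e he))
  · simp only [List.map_append, List.map_cons, List.nodup_append, List.nodup_cons,
      List.mem_cons]
    refine ⟨hnd1, ⟨hiA2, hnd2⟩, fun a ha b hb => hnd3 a ha b ?_⟩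
    tauto
  · intro k hk
    simp only [List.map_append, List.map_cons, List.mem_append, List.mem_cons] at hk
    have h1 := h.cnt k (by
      simp only [List.map_append, List.map_cons, List.mem_append, List.mem_cons]; tauto)
    have hkj : k ≠ j := by
      rintro rfl
      rcases hk with hk | hk | hk
      · exact hjA1 hk
      · exact hij hk.symm
      · exact hjA2 hk
    have hkj' : (j == k) = false := by simpa using hkj.symm
    simp only [List.flatten_append, List.flatten_cons, List.map_append, List.count_append,
      List.map_cons, List.count_cons, hkj'] at h1 ⊢
    simpa using h1

end DiskData

/-- A word without proper nonempty subwords representing the identity. -/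
def Tight (P : C6Presentation S) (z : Word S) : Prop :=
  ∀ u, u <:+: z → u ≠ [] → P.elt u = 1 → u = z

theorem Tight.cyclic {P : C6Presentation S} {z : Word S} (h : Tight P z)
    (hz : FreeGroup.IsReduced z) (hne : z ≠ []) (h1 : P.elt z = 1) :
    FreeGroup.IsReduced (z ++ z) := by
  obtain ⟨π, x, rfl, hx, hc⟩ := exists_conj_cyclic hz hne
  have hx1 : P.elt x = 1 := by
    rw [P.elt_append, P.elt_append, P.elt_invRev] at h1
    rw [mul_inv_eq_one] at h1
    exact mul_eq_left.1 h1
  have := h x ⟨π, invRev π, rfl⟩ hx hx1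
  have hl := congrArg List.length this
  simp only [List.length_append] at hl
  have hπ : π = [] := List.length_eq_zero_iff.1 (by omega)
  subst hπ
  simpa using hc

theorem nil_notMem_rels {P : C6Presentation S} {z : Word S} (hz : FreeGroup.IsReduced z)
    (hne : z ≠ []) (h1 : P.elt z = 1) : [] ∉ P.rels := by
  intro h0
  have hall : ∀ r ∈ P.rels, r = [] := by
    intro r hr
    by_contra hr0
    have := P.small_cancellation [] h0 [] (by simp)
      ⟨[], h0, r, hr, fun h => hr0 h.symm, by simp, by simp⟩
    simp at this
  obtain ⟨k, hk⟩ := elt_eq_one_iff.1 h1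
  have hone : ∀ (k : ℕ) (x : FreeGroup S), Ar P k x → x = 1 := by
    intro k x hx
    induction hx with
    | one k => rfl
    | @step k r x g hr hx ih =>
      rw [hall r hr, ih, ← FreeGroup.one_eq_mk]; simp
  have h2 := hone _ _ hk
  classical
  have h3 := congrArg FreeGroup.toWord h2
  rw [FreeGroup.toWord_mk, FreeGroup.toWord_one, hz.reduce_eq] at h3
  exact hne h3

theorem toGrp_mk (P : C6Presentation S) (u : Word S) : P.toGrp (mk u) = P.elt u :=
  (P.elt_eq_mk u).symm

theorem exists_diskData_of_tight {P : C6Presentation S} {z : Word S} (ht : Tight P z)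
    (hz : FreeGroup.IsReduced z) (hne : z ≠ []) (h1 : P.elt z = 1) :
    ∃ A recs, DiskData P z A recs ∧ 4 ≤ euler A recs := by
  classical
  have hex := elt_eq_one_iff.1 h1
  obtain ⟨N', A, recs, hD, -, h4⟩ := exists_diag (Nat.find hex) z hz (Nat.find_spec hex)
    (fun j hj => Nat.find_min hex hj) hne 0
  have hnd : (A.map Prod.fst).Nodup := by
    by_contra hnd
    obtain ⟨i, hi⟩ : ∃ i, 2 ≤ (A.map Prod.fst).count i := by
      by_contra hcon
      push Not at hcon
      exact hnd (List.nodup_iff_count_le_one.2 fun i => by have := hcon i; omega)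
    obtain ⟨B₁, B₂, B₃, α, β, rfl⟩ := exists_two_of_count hi
    have hbr := hD.br
    rw [walk_append, List.pairwise_append] at hbr
    have h5 := hbr.2.1
    simp only [walk_cons, walk_append, List.pairwise_cons, List.mem_append, List.mem_cons] at h5
    obtain ⟨h6, k₁, k₂, -, h7, -⟩ := h5.1 _ (Or.inr (Or.inl rfl)) rfl
    simp only at h6 h7
    subst h6
    have h8 : P.elt (cat B₂) = 1 := by
      apply elt_eq_one_iff.2 ⟨k₁, _⟩
      convert h7 using 1
      group
    have hcat := hD.cat_eq
    simp only [cat_append, cat_cons] at hcat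
    have hα : α ≠ [] := hD.ne (i, α) (by simp)
    by_cases hB : cat B₂ = []
    · rw [hB] at hcat
      rw [← hcat] at hz
      exact not_isReduced_append_invRev (u := cat B₁) (v := cat B₃) hα (by simpa using hz)
    · have h9 := ht (cat B₂) ⟨cat B₁ ++ α, invRev α ++ cat B₃, by simp [← hcat]⟩ hB h8
      have := congrArg List.length (hcat.trans h9.symm)
      have h10 : α.length ≠ 0 := fun h => hα (List.length_eq_zero_iff.1 h)
      simp at this
      omega
  refine ⟨A, recs, ⟨hD.cat_eq, fun e he => hD.ne e (by simp [he]), ?_, hD.rel, ?_, hD.int, hnd,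
    ?_⟩, h4 (ht.cyclic hz hne h1)⟩
  · intro C hC e he
    exact hD.ne e (List.mem_append.2 (Or.inr (List.mem_flatten.2 ⟨C, hC, he⟩)))
  · intro C hC
    obtain ⟨v₀, hv⟩ := hD.exp C hC
    exact ⟨v₀, fun p i α q β hp hq => ⟨(hv p i α q β hp hq).1, (hv p i α q β hp hq).2.1⟩⟩
  · intro i hi
    have h5 := hD.cnt i hi
    rw [List.map_append, List.count_append] at h5
    have h6 := List.count_eq_one_of_mem hnd hi
    omega

theorem exists_minimal_diskData {P : C6Presentation S} {z : Word S} (ht : Tight P z)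
    (hz : FreeGroup.IsReduced z) (hne : z ≠ []) (h1 : P.elt z = 1) :
    ∃ A recs, DiskData P z A recs ∧ 4 ≤ euler A recs ∧ ∀ A₁ e₁ e₂ A₂, A = A₁ ++ e₁ :: e₂ :: A₂ →
      ∀ C ∈ recs, (∀ C₁ C₂, C ≠ C₁ ++ e₁ :: e₂ :: C₂) ∧ (∀ C', C ≠ e₂ :: (C' ++ [e₁])) := by
  obtain ⟨A₀, recs₀, hD₀, he₀⟩ := exists_diskData_of_tight ht hz hne h1
  induction hn : A₀.length using Nat.strong_induction_on generalizing A₀ recs₀ with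
  | _ n ih =>
  have hlin : ∀ recs, DiskData P z A₀ recs → 4 ≤ euler A₀ recs →
      (∃ A₁ e₁ e₂ A₂, A₀ = A₁ ++ e₁ :: e₂ :: A₂ ∧ ∃ L₁ L₂ C₁ C₂,
        recs = L₁ ++ (C₁ ++ e₁ :: e₂ :: C₂) :: L₂) →
      ∃ A recs, DiskData P z A recs ∧ 4 ≤ euler A recs ∧
        ∀ A₁ e₁ e₂ A₂, A = A₁ ++ e₁ :: e₂ :: A₂ → ∀ C ∈ recs,
        (∀ C₁ C₂, C ≠ C₁ ++ e₁ :: e₂ :: C₂) ∧ (∀ C', C ≠ e₂ :: (C' ++ [e₁])) := by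
    rintro recs hD he ⟨A₁, ⟨i, α⟩, ⟨j, β⟩, A₂, rfl, L₁, L₂, C₁, C₂, rfl⟩
    refine ih (A₁ ++ (i, α ++ β) :: A₂).length (by simp [← hn]) _ _ hD.merge ?_ rfl
    rw [euler_eq] at he ⊢
    simp only [List.length_append, List.length_cons, List.flatten_append, List.flatten_cons]
      at he ⊢
    push_cast at he ⊢
    linarith
  by_cases hm : ∃ A₁ e₁ e₂ A₂, A₀ = A₁ ++ e₁ :: e₂ :: A₂ ∧ ∃ C ∈ recs₀,
      (∃ C₁ C₂, C = C₁ ++ e₁ :: e₂ :: C₂) ∨ (∃ C', C = e₂ :: (C' ++ [e₁]))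
  · obtain ⟨A₁, e₁, e₂, A₂, hA, C, hC, ⟨C₁, C₂, rfl⟩ | ⟨C', rfl⟩⟩ := hm
    · obtain ⟨L₁, L₂, rfl⟩ := List.append_of_mem hC
      exact hlin _ hD₀ he₀ ⟨A₁, e₁, e₂, A₂, hA, L₁, L₂, C₁, C₂, rfl⟩
    · obtain ⟨L₁, L₂, rfl⟩ := List.append_of_mem hC
      have hrot : DiskData P z A₀ (L₁ ++ ([e₁] ++ (e₂ :: C')) :: L₂) :=
        DiskData.rotate (C₁ := e₂ :: C') (C₂ := [e₁]) (by simpa using hD₀)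
      refine hlin _ hrot ?_ ⟨A₁, e₁, e₂, A₂, hA, L₁, L₂, [], C', rfl⟩
      rw [euler_eq] at he₀ ⊢
      simp only [List.length_append, List.length_cons, List.flatten_append, List.flatten_cons,
        List.length_nil] at he₀ ⊢
      push_cast at he₀ ⊢
      linarith
  · refine ⟨A₀, recs₀, hD₀, he₀, ?_⟩
    intro A₁ e₁ e₂ A₂ hA C hC
    constructor
    · intro C₁ C₂ h
      exact hm ⟨A₁, e₁, e₂, A₂, hA, C, hC, Or.inl ⟨C₁, C₂, h⟩⟩
    · intro C' h
      exact hm ⟨A₁, e₁, e₂, A₂, hA, C, hC, Or.inr ⟨C', h⟩⟩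

/-- A word none of whose subwords is more than half of a relator. -/
def Dehn (P : C6Presentation S) (x : Word S) : Prop :=
  ∀ u t, u <:+: x → u ++ t ∈ P.rels → 2 * u.length ≤ (u ++ t).length

/-- A word which is empty or less than a sixth of a relator. -/
def Thin (P : C6Presentation S) (s : Word S) : Prop :=
  s = [] ∨ ∃ t, s ++ t ∈ P.rels ∧ 6 * s.length < (s ++ t).length

theorem Dehn.subword {P : C6Presentation S} {x y : Word S} (h : Dehn P x) (hy : y <:+: x) :
    Dehn P y := fun u t hu ht => h u t (hu.trans hy) ht

theorem Thin.subword {P : C6Presentation S} {x y : Word S} (h : Thin P x) (hy : y <:+: x) :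
    Thin P y := by
  rcases h with rfl | ⟨t, ht, hl⟩
  · exact Or.inl (List.eq_nil_of_infix_nil hy)
  · obtain ⟨a, b, rfl⟩ := hy
    refine Or.inr ⟨b ++ t ++ a, ?_, ?_⟩
    · have := rels_rotate (P := P) (u := a) (v := y ++ (b ++ t)) (by simpa using ht)
      simpa using this
    · simp at hl ⊢; omega

theorem Thin.lt {P : C6Presentation S} {x D : Word S} (h : Thin P x) (h0 : [] ∉ P.rels)
    (hD : x ++ D ∈ P.rels) : 6 * x.length < (x ++ D).length := by
  rcases h with rfl | ⟨t, ht, hl⟩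
  · have : D ≠ [] := by rintro rfl; exact h0 (by simpa using hD)
    have := List.length_pos_iff.2 this
    simpa using this
  · by_cases heq : x ++ D = x ++ t
    · rw [heq]; exact hl
    · exact piece_bound hD ht heq

theorem countP_add_countP_le {α : Type*} (p : α → Bool) : ∀ (L₁ L₂ : List α),
    L₁.length = L₂.length → L₁.countP p + L₂.countP p ≤
      L₁.length + (L₁.zip L₂).countP (fun x => p x.1 && p x.2)
  | [], [], _ => by simp
  | a :: L₁, b :: L₂, h => by
    have := countP_add_countP_le p L₁ L₂ (by simpa using h)
    simp only [List.countP_cons, List.zip_cons_cons, List.length_cons]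
    cases p a <;> cases p b <;> simp <;> omega

theorem mem_zip_rotate {α : Type*} {e₁ e₂ b : α} : ∀ {a : α} {L : List α},
    (e₁, e₂) ∈ (a :: L).zip (L ++ [b]) →
    (∃ C₁ C₂, a :: L = C₁ ++ e₁ :: e₂ :: C₂) ∨ (e₂ = b ∧ ∃ C', a :: L = C' ++ [e₁])
  | a, [], h => by
    simp only [List.nil_append, List.zip_cons_cons, List.zip_nil_left, List.mem_singleton,
      Prod.mk.injEq] at h
    exact Or.inr ⟨h.2, [], by simp [h.1]⟩
  | a, c :: L, h => by
    rw [List.cons_append, List.zip_cons_cons, List.mem_cons] at h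
    rcases h with h | h
    · simp only [Prod.mk.injEq] at h
      exact Or.inl ⟨[], L, by simp [h.1, h.2]⟩
    · rcases mem_zip_rotate h with ⟨C₁, C₂, h⟩ | ⟨h1, C', h⟩
      · exact Or.inl ⟨a :: C₁, C₂, by simp [h]⟩
      · exact Or.inr ⟨h1, a :: C', by simp [h]⟩

theorem two_mul_countP_le {α : Type*} (p q : α → Bool) {C : List α} (hC : 2 ≤ C.length)
    (h₁ : ∀ C₁ e₁ e₂ C₂, C = C₁ ++ e₁ :: e₂ :: C₂ → p e₁ → p e₂ → q e₂)
    (h₂ : ∀ e₁ e₂ C', C = e₂ :: (C' ++ [e₁]) → p e₁ → p e₂ → q e₂) :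
    2 * C.countP p ≤ C.length + C.countP q := by
  match C, hC with
  | a :: c :: L, _ =>
    have h := countP_add_countP_le p (a :: c :: L) (c :: L ++ [a]) (by simp)
    have h3 : ((a :: c :: L).zip (c :: L ++ [a])).countP (fun x => p x.1 && p x.2) ≤
        ((a :: c :: L).zip (c :: L ++ [a])).countP (q ∘ Prod.snd) := by
      apply List.countP_mono_left
      rintro ⟨e₁, e₂⟩ he hp
      simp only [Bool.and_eq_true] at hp
      rcases mem_zip_rotate he with ⟨C₁, C₂, h⟩ | ⟨rfl, C', h⟩
      · exact h₁ _ _ _ _ h hp.1 hp.2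
      · match C', h with
        | [], h => simp at h
        | d :: C', h =>
          simp only [List.cons_append, List.cons.injEq] at h
          exact h₂ e₁ e₂ C' (by simp [h.2]) hp.1 hp.2
    rw [← List.countP_map, List.map_snd_zip (by simp)] at h3
    simp only [List.countP_append, List.countP_cons, List.countP_nil] at h h3 ⊢
    omega

theorem countP_mem_eq_length {I L : List ℕ} (hI : I.Nodup) (h : ∀ i ∈ I, L.count i = 1) :
    L.countP (fun i => decide (i ∈ I)) = I.length := by
  rw [List.countP_eq_length_filter]
  apply List.Perm.length_eq
  rw [List.perm_iff_count]
  intro a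
  by_cases ha : a ∈ I
  · rw [List.count_filter (by simpa using ha), h a ha, List.count_eq_one_of_mem hI ha]
  · rw [List.count_eq_zero_of_not_mem ha, List.count_eq_zero_of_not_mem (by simp [ha])]

theorem infix_append_cases {α : Type*} {X Y B u D : List α} (h : X ++ Y = B ++ u ++ D) :
    (∃ N, X = B ++ u ++ N) ∨ (∃ M, B = X ++ M ∧ Y = M ++ u ++ D) ∨
      ∃ u₁ u₂, u = u₁ ++ u₂ ∧ u₁ ≠ [] ∧ u₂ ≠ [] ∧ X = B ++ u₁ ∧ Y = u₂ ++ D := by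
  rw [List.append_assoc, List.append_eq_append_iff] at h
  rcases h with ⟨M, rfl, rfl⟩ | ⟨M, rfl, hM⟩
  · exact Or.inr (Or.inl ⟨M, by simp⟩)
  · rw [List.append_eq_append_iff] at hM
    rcases hM with ⟨N, rfl, rfl⟩ | ⟨N, rfl, rfl⟩
    · exact Or.inl ⟨N, by simp⟩
    · by_cases hM0 : M = []
      · subst hM0
        exact Or.inr (Or.inl ⟨[], by simp⟩)
      by_cases hN0 : N = []
      · subst hN0
        exact Or.inl ⟨[], by simp⟩
      · exact Or.inr (Or.inr ⟨M, N, rfl, hM0, hN0, rfl, rfl⟩)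

namespace DiskData

variable {P : C6Presentation S} {z : Word S} {A : List (ℕ × Word S)}
  {recs : List (List (ℕ × Word S))}

theorem infix_null (h : DiskData P z A recs) (ht : Tight P z) {A₁ M A₂ : List (ℕ × Word S)}
    (hA : A = A₁ ++ M ++ A₂) (hM : P.elt (cat M) = 1) : M = [] ∨ (A₁ = [] ∧ A₂ = []) := by
  by_cases hM0 : M = []
  · exact Or.inl hM0
  right
  have hcat0 : ∀ B : List (ℕ × Word S), (∀ e ∈ B, e ∈ A) → cat B = [] → B = [] := by
    intro B hB hc
    match B, hB, hc with
    | [], _, _ => rfl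
    | e :: B, hB, hc =>
      simp only [cat_cons, List.append_eq_nil_iff] at hc
      exact absurd hc.1 (h.ne_path e (hB e (by simp)))
  have hc := h.cat_eq
  rw [hA, cat_append, cat_append] at hc
  have h1 := ht (cat M) ⟨cat A₁, cat A₂, by simpa using hc⟩
    (fun h0 => hM0 (hcat0 M (by simp +contextual [hA]) h0)) hM
  rw [← h1] at hc
  have hl := congrArg List.length hc
  simp only [List.length_append] at hl
  exact ⟨hcat0 A₁ (by simp +contextual [hA]) (List.length_eq_zero_iff.1 (by omega)),
    hcat0 A₂ (by simp +contextual [hA]) (List.length_eq_zero_iff.1 (by omega))⟩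

theorem ext_pair (h : DiskData P z A recs) (ht : Tight P z) {a : ℕ × Word S}
    {A' : List (ℕ × Word S)} (hA : A = a :: A')
    (hmin : ∀ A₁ e₁ e₂ A₂, A = A₁ ++ e₁ :: e₂ :: A₂ → ∀ C ∈ recs,
      (∀ C₁ C₂, C ≠ C₁ ++ e₁ :: e₂ :: C₂) ∧ (∀ C', C ≠ e₂ :: (C' ++ [e₁])))
    {C : List (ℕ × Word S)} (hC : C ∈ recs) {e₁ e₂ : ℕ × Word S}
    (hpair : (∃ C₁ C₂, C = C₁ ++ e₁ :: e₂ :: C₂) ∨ ∃ C', C = e₂ :: (C' ++ [e₁]))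
    (h₁ : e₁.1 ∈ A.map Prod.fst) (h₂ : e₂.1 ∈ A.map Prod.fst) : e₂.1 = a.1 := by
  obtain ⟨v₀, hv⟩ := h.exp C hC
  obtain ⟨p₁, p₂, hp₁, hp₂, hp⟩ : ∃ p₁ p₂, (p₁, e₁) ∈ walk 1 C ∧ (p₂, e₂) ∈ walk 1 C ∧
      P.toGrp (p₁ * FreeGroup.mk e₁.2) = P.toGrp p₂ := by
    rcases hpair with ⟨C₁, C₂, rfl⟩ | ⟨C', rfl⟩
    · exact ⟨_, _, mem_walk_iff.2 ⟨C₁, e₂ :: C₂, rfl, rfl⟩,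
        mem_walk_iff.2 ⟨C₁ ++ [e₁], C₂, by simp, rfl⟩, by simp [← FreeGroup.mul_mk]⟩
    · refine ⟨_, _, mem_walk_iff.2 ⟨e₂ :: C', [], rfl, rfl⟩,
        mem_walk_iff.2 ⟨[], _, rfl, rfl⟩, ?_⟩
      have h3 : P.elt (cat (e₂ :: (C' ++ [e₁]))) = 1 :=
        elt_eq_one_iff.2 ⟨1, Ar.rel (h.rel _ hC)⟩
      rw [← toGrp_mk] at h3
      simpa [← FreeGroup.mul_mk, mul_assoc, ← FreeGroup.one_eq_mk] using h3
  obtain ⟨⟨i, β⟩, hd₁, hi⟩ := List.mem_map.1 h₁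
  obtain ⟨⟨j, γ⟩, hd₂, hj⟩ := List.mem_map.1 h₂
  obtain ⟨i', α₁⟩ := e₁
  obtain ⟨j', α₂⟩ := e₂
  simp only at hi hj
  subst hi hj
  obtain ⟨A₁, A₂, hA₁⟩ := List.append_of_mem hd₁
  obtain ⟨B₁, B₂, hB₁⟩ := List.append_of_mem hd₂
  obtain ⟨rfl, hq₁⟩ := hv _ _ _ _ _ hp₁ (mem_walk_iff.2 ⟨A₁, A₂, hA₁, rfl⟩)
  obtain ⟨rfl, hq₂⟩ := hv _ _ _ _ _ hp₂ (mem_walk_iff.2 ⟨B₁, B₂, hB₁, rfl⟩)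
  have heq : P.elt (cat (A₁ ++ [(i, α₁)])) = P.elt (cat B₁) := by
    rw [← toGrp_mk, ← toGrp_mk]
    simp only [cat_append, cat_cons, cat_nil, List.append_nil, ← FreeGroup.mul_mk, map_mul,
      one_mul] at hq₁ hq₂ hp ⊢
    rw [hq₁, hq₂, ← hp, mul_assoc]
  have hcons : B₁ ≠ A₁ ++ [(i, α₁)] := by
    rintro rfl
    have := hmin A₁ (i, α₁) (j, α₂) B₂ (by simpa using hB₁) C hC
    rcases hpair with ⟨C₁, C₂, hCC⟩ | ⟨C', hCC⟩
    · exact this.1 _ _ hCC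
    · exact this.2 _ hCC
  have hsplit : (A₁ ++ [(i, α₁)]) ++ A₂ = B₁ ++ (j, α₂) :: B₂ := by simp [← hB₁, hA₁]
  rw [List.append_eq_append_iff] at hsplit
  rcases hsplit with ⟨M, rfl, rfl⟩ | ⟨M, hM, hM'⟩
  · rw [cat_append _ M, P.elt_append] at heq
    rcases h.infix_null ht (A₁ := A₁ ++ [(i, α₁)]) (M := M) (A₂ := (j, α₂) :: B₂)
      (by simp [hA₁]) (left_eq_mul.1 heq) with rfl | ⟨h0, -⟩
    · simp at hcons
    · simp at h0
  · rw [hM, cat_append, P.elt_append] at heq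
    rcases h.infix_null ht (A₁ := B₁) (M := M) (A₂ := A₂)
      (by rw [hB₁, hM']; simp) (mul_eq_left.1 heq) with rfl | ⟨rfl, -⟩
    · exact absurd (by simpa using hM.symm) hcons
    · rw [hB₁] at hA
      simp only [List.nil_append, List.cons.injEq] at hA
      rw [← hA.1]

theorem straddle_id (h : DiskData P z A recs) (hA : A ≠ []) (c : ℕ) :
    ∃ i ∈ A.map Prod.fst, ∀ A₁ j α A₂, A = A₁ ++ (j, α) :: A₂ → (cat A₁).length < c →
      c < (cat A₁).length + α.length → j = i := by
  by_cases hex : ∃ A₁ j α A₂, A = A₁ ++ (j, α) :: A₂ ∧ (cat A₁).length < c ∧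
      c < (cat A₁).length + α.length
  · obtain ⟨A₁, j, α, A₂, rfl, h1, h2⟩ := hex
    refine ⟨j, by simp, ?_⟩
    intro B₁ k β B₂ hB h3 h4
    have hsplit : A₁ ++ (j, α) :: A₂ = B₁ ++ (k, β) :: B₂ := hB
    rw [List.append_eq_append_iff] at hsplit
    rcases hsplit with ⟨M, rfl, hM⟩ | ⟨M, rfl, hM⟩
    · match M, hM with
      | [], hM => simp at hM; exact hM.1.1.symm
      | m :: M, hM =>
        simp only [List.cons_append, List.cons.injEq] at hM
        rw [← hM.1] at h3
        simp at h3
        omega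
    · match M, hM with
      | [], hM => simp at hM; exact hM.1.1
      | m :: M, hM =>
        simp only [List.cons_append, List.cons.injEq] at hM
        rw [← hM.1] at h1
        simp at h1
        omega
  · obtain ⟨a, A', rfl⟩ := List.exists_cons_of_ne_nil hA
    refine ⟨a.1, by simp, ?_⟩
    intro A₁ j α A₂ h1 h2 h3
    exact absurd ⟨A₁, j, α, A₂, h1, h2, h3⟩ hex

end DiskData

theorem length_cat_le {C : List (ℕ × Word S)} {ℓ : ℕ} (hC : ∀ e ∈ C, 6 * e.2.length < ℓ) :
    6 * (cat C).length ≤ C.length * ℓ ∧ (C ≠ [] → 6 * (cat C).length < C.length * ℓ) := by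
  induction C with
  | nil => simp
  | cons e C ih =>
    have h1 := (ih (fun d hd => hC d (by simp [hd]))).1
    have h2 := hC e (by simp)
    have : 6 * (cat (e :: C)).length < (e :: C).length * ℓ := by
      simp only [cat_cons, List.length_append, List.length_cons]
      nlinarith
    exact ⟨this.le, fun _ => this⟩

theorem corner_cell {P : C6Presentation S} {X T Y : Word S} (hX : Dehn P X) (hY : Dehn P Y)
    (hT : Thin P T) (h0 : [] ∉ P.rels) {B α D δ : Word S} (hz : X ++ T ++ Y = B ++ α ++ D)
    (hαδ : α ++ δ ∈ P.rels) :
    2 * α.length ≤ (α ++ δ).length ∨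
    (6 * α.length < 4 * (α ++ δ).length ∧
      ((B.length < X.length ∧ X.length < B.length + α.length) ∨
      (B.length < X.length + T.length ∧ X.length + T.length < B.length + α.length))) ∨
    ∃ α₁ α₂, α = α₁ ++ T ++ α₂ ∧ α₁ ≠ [] ∧ α₂ ≠ [] ∧ X = B ++ α₁ ∧ Y = α₂ ++ D := by
  have hrot : ∀ α₁ α₂, α = α₁ ++ α₂ → α₂ ++ (δ ++ α₁) ∈ P.rels := by
    rintro α₁ α₂ rfl
    have := rels_rotate (P := P) (u := α₁) (v := α₂ ++ δ) (by simpa using hαδ)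
    simpa using this
  have hlr : ∀ α₁ α₂, α = α₁ ++ α₂ → (α₂ ++ (δ ++ α₁)).length = (α ++ δ).length := by
    rintro α₁ α₂ rfl
    simp; omega
  have hpos : ∀ w : Word S, w ≠ [] → 0 < w.length := fun w => List.length_pos_iff.2
  rw [List.append_assoc] at hz
  rcases infix_append_cases hz with ⟨N, hN⟩ | ⟨M, rfl, hM⟩ | ⟨α₁, β, rfl, h1, h2, rfl, h4⟩
  · exact Or.inl (hX _ _ ⟨B, N, hN.symm⟩ hαδ)
  · rcases infix_append_cases hM with ⟨N, hN⟩ | ⟨M', rfl, hM'⟩ | ⟨β₁, β₂, rfl, h1, h2, rfl, rfl⟩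
    · have := (hT.subword ⟨M, N, hN.symm⟩).lt h0 hαδ
      exact Or.inl (by omega)
    · exact Or.inl (hY _ _ ⟨M', D, hM'.symm⟩ hαδ)
    · right; left
      have e1 := (hT.subword (y := β₁) ⟨M, [], by simp⟩).lt h0 (D := β₂ ++ δ) (by simpa using hαδ)
      have e2 := hY β₂ _ ⟨[], D, rfl⟩ (hrot _ _ rfl)
      rw [hlr _ _ rfl] at e2
      have hp1 := hpos _ h1
      have hp2 := hpos _ h2
      simp only [List.length_append] at e1 e2 ⊢
      exact ⟨by omega, Or.inr (by omega)⟩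
  · have e1 := hX α₁ (β ++ δ) ⟨B, [], by simp⟩ (by simpa using hαδ)
    have h4' : T ++ Y = [] ++ β ++ D := by simpa using h4
    rcases infix_append_cases h4' with ⟨N, hN⟩ | ⟨M, hM, hM'⟩ | ⟨β₁, β₂, rfl, h1', h2', h3, rfl⟩
    · right; left
      have e2 := (hT.subword ⟨[], N, hN.symm⟩).lt h0 (hrot _ _ rfl)
      rw [hlr _ _ rfl] at e2
      have hp1 := hpos _ h1
      have hp2 := hpos _ h2
      simp only [List.length_append] at e1 e2 ⊢
      exact ⟨by omega, Or.inl (by omega)⟩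
    · rw [eq_comm, List.append_eq_nil_iff] at hM
      obtain ⟨rfl, rfl⟩ := hM
      exact Or.inr (Or.inr ⟨α₁, β, by simp, h1, h2, rfl, by simpa using hM'⟩)
    · simp only [List.nil_append] at h3
      subst h3
      exact Or.inr (Or.inr ⟨α₁, β₂, by simp, h1, h2', rfl, rfl⟩)

/-- A tight null word made of two Dehn-reduced words and a thin word in between admits a relator
containing the thin word and nonempty parts of both neighbours, up to a short remainder. -/
theorem exists_peel_of_tight {P : C6Presentation S} {X T Y : Word S} (hX : Dehn P X)
    (hY : Dehn P Y) (hT : Thin P T) (hz : FreeGroup.IsReduced (X ++ T ++ Y))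
    (ht : Tight P (X ++ T ++ Y)) (hne : X ++ T ++ Y ≠ []) (h1 : P.elt (X ++ T ++ Y) = 1) :
    ∃ X' α₁ α₂ Y' σ, X = X' ++ α₁ ∧ Y = α₂ ++ Y' ∧ α₁ ≠ [] ∧ α₂ ≠ [] ∧
      α₁ ++ T ++ α₂ ++ σ ∈ P.rels ∧ 6 * σ.length < (α₁ ++ T ++ α₂ ++ σ).length := by
  by_contra hcon
  have h0 := nil_notMem_rels hz hne h1
  obtain ⟨A, recs, h, he, hmin⟩ := exists_minimal_diskData ht hz hne h1
  have hA : A ≠ [] := by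
    rintro rfl
    exact hne h.cat_eq.symm
  obtain ⟨i₁, hi₁, hs₁⟩ := h.straddle_id hA X.length
  obtain ⟨i₂, hi₂, hs₂⟩ := h.straddle_id hA (X.length + T.length)
  obtain ⟨a, A', hAa⟩ := List.exists_cons_of_ne_nil hA
  have hi₃ : a.1 ∈ A.map Prod.fst := by simp [hAa]
  set p : ℕ × Word S → Bool := fun e => decide (e.1 ∈ A.map Prod.fst) with hp
  have hcell : ∀ C ∈ recs, 6 ≤ C.length + C.countP p + (C.map Prod.fst).count i₁ +
      (C.map Prod.fst).count i₂ + (C.map Prod.fst).count a.1 := by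
    intro C hC
    have hrel := h.rel C hC
    have hCpos : 0 < (cat C).length := by
      rw [List.length_pos_iff]
      intro h3
      exact h0 (h3 ▸ hrel)
    rcases Nat.lt_or_ge 1 (C.countP p) with hm | hm
    · have hle : C.countP p ≤ C.length := List.countP_le_length
      have := two_mul_countP_le p (fun e => e.1 == a.1) (C := C) (by omega)
        (fun C₁ e₁ e₂ C₂ hCC h1 h2 => by
          have := h.ext_pair ht hAa hmin hC (e₁ := e₁) (e₂ := e₂) (Or.inl ⟨_, _, hCC⟩)
            (by simpa [hp] using h1) (by simpa [hp] using h2)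
          simpa using this)
        (fun e₁ e₂ C' hCC h1 h2 => by
          have := h.ext_pair ht hAa hmin hC (e₁ := e₁) (e₂ := e₂) (Or.inr ⟨_, hCC⟩)
            (by simpa [hp] using h1) (by simpa [hp] using h2)
          simpa using this)
      have h3 : C.countP (fun e => e.1 == a.1) = (C.map Prod.fst).count a.1 := by
        rw [List.count, List.countP_map]; rfl
      omega
    by_cases hm0 : C.countP p = 0
    · rw [List.countP_eq_zero] at hm0
      have := (length_cat_le (C := C) (ℓ := (cat C).length)
        (fun e he => h.int C hC e he (by simpa [hp] using hm0 e he))).2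
        (by rintro rfl; simp at hCpos)
      have := lt_of_mul_lt_mul_right this (Nat.zero_le _)
      omega
    obtain ⟨⟨i, α⟩, he, hpe⟩ := List.countP_pos_iff.1 (Nat.pos_of_ne_zero hm0)
    obtain ⟨C₁, C₂, rfl⟩ := List.append_of_mem he
    have hi : i ∈ A.map Prod.fst := by simpa [hp] using hpe
    obtain ⟨v₀, hv⟩ := h.exp _ hC
    obtain ⟨⟨i', β⟩, hd, hi'⟩ := List.mem_map.1 hi
    simp only at hi'
    subst hi'
    obtain ⟨B, D, hB⟩ := List.append_of_mem hd
    obtain ⟨rfl, -⟩ := hv _ _ _ _ _ (mem_walk_iff.2 ⟨C₁, C₂, rfl, rfl⟩)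
      (mem_walk_iff.2 ⟨B, D, hB, rfl⟩)
    have hδ : α ++ cat (C₂ ++ C₁) ∈ P.rels := by
      have := rels_rotate (P := P) (u := cat C₁) (v := α ++ cat C₂) (by simpa using hrel)
      simpa using this
    have hcnt0 : ∀ e ∈ C₂ ++ C₁, p e = false := by
      simp only [List.countP_append, List.countP_cons, hpe, if_true] at hm
      intro e he
      by_contra hpe'
      rw [Bool.not_eq_false] at hpe'
      have : 0 < (C₂ ++ C₁).countP p := List.countP_pos_iff.2 ⟨e, he, hpe'⟩
      rw [List.countP_append] at this
      omega
    have hℓ : (α ++ cat (C₂ ++ C₁)).length = (cat (C₁ ++ (i', α) :: C₂)).length := by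
      simp; omega
    have hcatlen := length_cat_le (C := C₂ ++ C₁) (ℓ := (α ++ cat (C₂ ++ C₁)).length)
      (fun e he => by
        rw [hℓ]
        exact h.int _ hC e (by simp only [List.mem_append, List.mem_cons] at he ⊢; tauto)
          (by simpa [hp] using hcnt0 e he))
    have hn : (C₁ ++ (i', α) :: C₂).length = (C₂ ++ C₁).length + 1 := by simp; omega
    have hc1 : 1 ≤ (C₁ ++ (i', α) :: C₂).countP p := by omega
    have hci : 1 ≤ ((C₁ ++ (i', α) :: C₂).map Prod.fst).count i' :=
      List.one_le_count_iff.2 (by simp)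
    have hlen : (α ++ cat (C₂ ++ C₁)).length = α.length + (cat (C₂ ++ C₁)).length := by simp
    rw [← hℓ] at hCpos
    generalize hLdef : (α ++ cat (C₂ ++ C₁)).length = L at *
    have hk : ∀ k, k * L ≤ 6 * (cat (C₂ ++ C₁)).length → 0 < k → k + 1 ≤ (C₂ ++ C₁).length := by
      intro k hk hk0
      by_contra hcon
      by_cases hnil : C₂ ++ C₁ = []
      · rw [hnil] at hk
        have := Nat.mul_pos hk0 hCpos
        simp at hk
        omega
      · have h3 := hcatlen.2 hnil
        have h4 : (C₂ ++ C₁).length * L ≤ k * L := Nat.mul_le_mul_right _ (by omega)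
        omega
    have hz' : X ++ T ++ Y = cat B ++ α ++ cat D := by rw [← h.cat_eq, hB]; simp
    have hs₁' := hs₁ B i' α D hB
    have hs₂' := hs₂ B i' α D hB
    rcases corner_cell hX hY hT h0 hz' hδ with h3 | ⟨h3, h4⟩ | ⟨α₁, α₂, rfl, h3, h4, hX', hY'⟩
    · have := hk 3 (by omega) (by omega)
      omega
    · have := hk 2 (by omega) (by omega)
      rcases h4 with h4 | h4
      · rw [← hs₁' h4.1 h4.2]
        omega
      · rw [← hs₂' h4.1 h4.2]
        omega
    · have h5 : L ≤ 6 * (cat (C₂ ++ C₁)).length := by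
        by_contra h6
        exact hcon ⟨cat B, α₁, α₂, cat D, cat (C₂ ++ C₁), hX', hY', h3, h4, hδ, by
          rw [hLdef]; omega⟩
      have := hk 1 (by omega) (by omega)
      have hp1 := List.length_pos_iff.2 h3
      have hp2 := List.length_pos_iff.2 h4
      have hlX := congrArg List.length hX'
      simp only [List.length_append] at hs₁' hs₂' hlX
      have e1 := hs₁' (by omega) (by omega)
      have e2 := hs₂' (by omega) (by omega)
      rw [← e1, ← e2]
      omega
  have hsum : ∀ R : List (List (ℕ × Word S)), (∀ C ∈ R, C ∈ recs) →
      6 * R.length ≤ R.flatten.length + R.flatten.countP p + (R.flatten.map Prod.fst).count i₁ +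
      (R.flatten.map Prod.fst).count i₂ + (R.flatten.map Prod.fst).count a.1 := by
    intro R hR
    induction R with
    | nil => simp
    | cons C R ih =>
      have h3 := ih (fun D hD => hR D (by simp [hD]))
      have h4 := hcell C (hR C (by simp))
      simp only [List.flatten_cons, List.length_append, List.countP_append, List.map_append,
        List.count_append, List.length_cons]
      omega
  have hs := hsum recs (fun _ => id)
  rw [h.cnt _ hi₁, h.cnt _ hi₂, h.cnt _ hi₃] at hs
  have hcA : recs.flatten.countP p = A.length := by
    have := countP_mem_eq_length h.nodup h.cnt
    rw [List.countP_map, List.length_map] at this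
    exact this
  rw [euler_eq, List.length_append] at he
  push_cast at he
  omega

variable {P : C6Presentation S}

theorem isReduced_append_or {u v : Word S} (hu : FreeGroup.IsReduced u)
    (hv : FreeGroup.IsReduced v) : FreeGroup.IsReduced (u ++ v) ∨
      ∃ u' a v', u = u' ++ [a] ∧ v = linv a :: v' := by
  by_contra hcon
  push Not at hcon
  apply hcon.1
  rw [FreeGroup.IsReduced, List.isChain_append]
  refine ⟨hu, hv, ?_⟩
  rintro ⟨a, ε⟩ ha ⟨b, ε'⟩ hb hab
  by_contra hne
  simp only at hab
  subst hab
  obtain ⟨v', rfl⟩ := List.head?_eq_some_iff.1 hb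
  obtain ⟨u', rfl⟩ := List.getLast?_eq_some_iff.1 ha
  refine hcon.2 u' (a, ε) v' rfl ?_
  simp only [linv, List.cons.injEq, Prod.mk.injEq, true_and, and_true]
  cases ε <;> cases ε' <;> simp_all

theorem isReduced_invRev {u : Word S} (hu : FreeGroup.IsReduced u) :
    FreeGroup.IsReduced (invRev u) := by
  classical
  have h := FreeGroup.toWord_inv (x := mk u)
  rw [FreeGroup.toWord_mk, hu.reduce_eq] at h
  rw [← h]
  exact FreeGroup.isReduced_toWord

theorem elt_rel {r : Word S} (h : r ∈ P.rels) : P.elt r = 1 :=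
  elt_eq_one_iff.2 ⟨1, Ar.rel h⟩

theorem Dehn.invRev {x : Word S} (h : Dehn P x) : Dehn P (invRev x) := by
  rintro u t ⟨a, b, hab⟩ ht
  have h1 := rels_invRev (rels_rotate ht)
  rw [invRev_append'] at h1
  have h2 := h (FreeGroup.invRev u) (FreeGroup.invRev t)
    ⟨FreeGroup.invRev b, FreeGroup.invRev a, by
      rw [← FreeGroup.invRev_invRev (L₁ := x), ← hab]; simp⟩ h1
  simpa using h2

/-- A word of minimal length among those representing the same element. -/
def Geo (P : C6Presentation S) (x : Word S) : Prop :=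
  ∀ v, P.elt v = P.elt x → x.length ≤ v.length

theorem Geo.subword {x u : Word S} (h : Geo P x) (hu : u <:+: x) : Geo P u := by
  obtain ⟨a, b, rfl⟩ := hu
  intro v hv
  have := h (a ++ v ++ b) (by simp [P.elt_append, hv])
  simp at this
  omega

theorem Geo.reduced {x : Word S} (h : Geo P x) : FreeGroup.IsReduced x := by
  rw [isReduced_iff]
  by_contra hcon
  classical
  have hr : FreeGroup.IsReduced (FreeGroup.reduce x) := by
    rw [← FreeGroup.toWord_mk]; exact FreeGroup.isReduced_toWord
  have h1 := h (FreeGroup.reduce x) (by rw [P.elt_eq_mk, P.elt_eq_mk, FreeGroup.reduce.self])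
  have h2 : FreeGroup.reduce x = x :=
    (FreeGroup.reduce.red (L := x)).sublist.eq_of_length_le h1
  rw [h2] at hr
  exact hcon ((isReduced_iff _).1 hr)

theorem Geo.dehn {x : Word S} (h : Geo P x) : Dehn P x := by
  intro u t hu ht
  have h1 := elt_rel ht
  rw [P.elt_append] at h1
  have h2 := h.subword hu (FreeGroup.invRev t)
    (by rw [P.elt_invRev]; exact (eq_inv_of_mul_eq_one_left h1).symm)
  simp at h2 ⊢
  omega

theorem exists_tight_subword {z : Word S} (hne : z ≠ []) (h1 : P.elt z = 1) :
    ∃ u, u <:+: z ∧ u ≠ [] ∧ P.elt u = 1 ∧ Tight P u := by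
  induction hn : z.length using Nat.strong_induction_on generalizing z with
  | _ n ih =>
  by_cases ht : Tight P z
  · exact ⟨z, List.infix_rfl, hne, h1, ht⟩
  · unfold Tight at ht
    push Not at ht
    obtain ⟨u, hu, hu0, hu1, huz⟩ := ht
    have hl : u.length < z.length :=
      lt_of_le_of_ne hu.length_le fun h => huz (hu.sublist.eq_of_length h)
    obtain ⟨v, hv, hv'⟩ := ih u.length (by omega) hu0 hu1 rfl
    exact ⟨v, hv.trans hu, hv'⟩

theorem exists_peel {X T Y : Word S} (hX : Dehn P X)
    (hY : Dehn P Y) (hT : Thin P T) (hz : FreeGroup.IsReduced (X ++ T ++ Y))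
    (hne : X ++ T ++ Y ≠ []) (h1 : P.elt (X ++ T ++ Y) = 1) :
    ∃ X' α₁ α₂ Y' σ, X = X' ++ α₁ ∧ Y = α₂ ++ Y' ∧ α₁ ≠ [] ∧ α₂ ≠ [] ∧
      α₁ ++ T ++ α₂ ++ σ ∈ P.rels ∧ 6 * σ.length < (α₁ ++ T ++ α₂ ++ σ).length := by
  obtain ⟨u, hu, hu0, hu1, htu⟩ := exists_tight_subword hne h1
  have hru := hz.subword hu
  obtain ⟨B, D, hBD⟩ := hu
  have key : ∀ X₂ T₂ Y₂, X₂ <:+: X → T₂ <:+: T → Y₂ <:+: Y → u = X₂ ++ T₂ ++ Y₂ →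
      ∃ X' α₁ α₂ Y' σ, X₂ = X' ++ α₁ ∧ Y₂ = α₂ ++ Y' ∧ α₁ ≠ [] ∧ α₂ ≠ [] ∧
      α₁ ++ T₂ ++ α₂ ++ σ ∈ P.rels ∧ 6 * σ.length < (α₁ ++ T₂ ++ α₂ ++ σ).length := by
    rintro X₂ T₂ Y₂ h2 h3 h4 rfl
    exact exists_peel_of_tight (hX.subword h2) (hY.subword h4) (hT.subword h3) hru htu hu0 hu1
  have keyX : ∀ T₂ Y₂, T₂ <:+: T → Y₂ <:+: Y → u = T₂ ++ Y₂ → False := by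
    intro T₂ Y₂ h3 h4 h5
    obtain ⟨X', α₁, α₂, Y', σ, h6, -, h7, -⟩ :=
      key [] T₂ Y₂ nil_isInfix h3 h4 (by simpa using h5)
    simp at h6
    exact h7 h6.2
  have keyY : ∀ X₂ T₂, X₂ <:+: X → T₂ <:+: T → u = X₂ ++ T₂ → False := by
    intro X₂ T₂ h3 h4 h5
    obtain ⟨X', α₁, α₂, Y', σ, -, h6, -, h7, -⟩ :=
      key X₂ T₂ [] h3 h4 nil_isInfix (by simpa using h5)
    simp at h6
    exact h7 h6.1
  have fin : ∀ u₁ u₂, u = u₁ ++ T ++ u₂ → X = B ++ u₁ → Y = u₂ ++ D →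
      ∃ X' α₁ α₂ Y' σ, X = X' ++ α₁ ∧ Y = α₂ ++ Y' ∧ α₁ ≠ [] ∧ α₂ ≠ [] ∧
      α₁ ++ T ++ α₂ ++ σ ∈ P.rels ∧ 6 * σ.length < (α₁ ++ T ++ α₂ ++ σ).length := by
    rintro u₁ u₂ h2 rfl rfl
    obtain ⟨X', α₁, α₂, Y', σ, rfl, rfl, h⟩ := key u₁ T u₂ ⟨B, [], by simp⟩ List.infix_rfl
      ⟨[], D, by simp⟩ h2
    exact ⟨B ++ X', α₁, α₂, Y' ++ D, σ, by simp, by simp, h⟩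
  rw [List.append_assoc X] at hBD
  rcases infix_append_cases hBD.symm with ⟨N, hN⟩ | ⟨M, rfl, hM⟩ | ⟨u₁, u₂, hu', h2, h3, hX', h4⟩
  · exact (keyY u [] ⟨B, N, hN.symm⟩ nil_isInfix (by simp)).elim
  · rcases infix_append_cases hM with ⟨N, hN⟩ | ⟨M', rfl, hM'⟩ | ⟨β₁, β₂, hu', h1, h2, hT', hY'⟩
    · exact (keyX u [] ⟨M, N, hN.symm⟩ nil_isInfix (by simp)).elim
    · exact (keyX [] u nil_isInfix ⟨M', D, hM'.symm⟩ (by simp)).elim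
    · exact (keyX β₁ β₂ ⟨M, [], by simp [hT']⟩ ⟨[], D, by simp [hY']⟩ hu').elim
  · have h4' : T ++ Y = [] ++ u₂ ++ D := by simpa using h4
    have hu1X : u₁ <:+: X := ⟨B, [], by simp [hX']⟩
    rcases infix_append_cases h4' with ⟨N, hN⟩ | ⟨M, hM, hM'⟩ | ⟨β₁, β₂, rfl, h1', h2', h3, hY'⟩
    · exact (keyY u₁ u₂ hu1X ⟨[], N, hN.symm⟩ hu').elim
    · rw [eq_comm, List.append_eq_nil_iff] at hM
      obtain ⟨rfl, rfl⟩ := hM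
      exact fin u₁ u₂ (by simpa using hu') hX' (by simpa using hM')
    · simp only [List.nil_append] at h3
      subst h3
      exact fin u₁ β₂ (by simpa using hu') hX' hY'

/-- The result of removing one relator from the beginning of a thin bigon. -/
structure Peel (P : C6Presentation S) (s x y a b s' x' y' : Word S) : Prop where
  hx : x = a ++ x'
  hy : y = b ++ y'
  ha : a ≠ []
  hb : b ≠ []
  rel : invRev a ++ s ++ b ++ invRev s' ∈ P.rels
  short : 6 * s'.length < (invRev a ++ s ++ b ++ invRev s').length

theorem Peel.rel' {s x y a b s' x' y' : Word S} (h : Peel P s x y a b s' x' y') :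
    s' ++ (invRev b ++ invRev s ++ a) ∈ P.rels := by
  have := rels_invRev h.rel
  simpa [invRev_append'] using this

theorem Peel.thin {s x y a b s' x' y' : Word S} (h : Peel P s x y a b s' x' y') : Thin P s' := by
  refine Or.inr ⟨_, h.rel', ?_⟩
  have := h.short
  simp at this ⊢
  omega

theorem Peel.cell_eq {s x y a b s' x' y' : Word S} (h : Peel P s x y a b s' x' y') :
    P.elt s * P.elt b = P.elt a * P.elt s' := by
  have h2 := elt_rel h.rel
  simp only [P.elt_append, P.elt_invRev, mul_assoc] at h2
  rw [inv_mul_eq_one, ← mul_assoc, eq_mul_inv_iff_mul_eq] at h2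
  exact h2.symm

theorem Peel.elt_eq {s x y a b s' x' y' : Word S} (h : Peel P s x y a b s' x' y')
    (h1 : P.elt x = P.elt (s ++ y)) : P.elt x' = P.elt (s' ++ y') := by
  rw [h.hx, h.hy] at h1
  simp only [P.elt_append] at h1 ⊢
  rw [← mul_assoc, h.cell_eq, mul_assoc] at h1
  exact mul_left_cancel h1

theorem Peel.exists_reduced {s x y : Word S} (hx : Geo P x) (hy : FreeGroup.IsReduced y)
    (hyD : Dehn P y) (hs : Thin P s) (hz : FreeGroup.IsReduced (invRev x ++ s ++ y))
    (hne : invRev x ++ s ++ y ≠ []) (h1 : P.elt x = P.elt (s ++ y)) :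
    ∃ a b s' x' y', Peel P s x y a b s' x' y' ∧
      (s' ≠ [] → FreeGroup.IsReduced (invRev x' ++ s' ++ y')) := by
  have hex : ∃ n a b s' x' y', Peel P s x y a b s' x' y' ∧ s'.length = n := by
    obtain ⟨X', α₁, α₂, Y', σ, h2, rfl, h3, h4, h5, h6⟩ := exists_peel hx.dehn.invRev hyD hs hz hne
      (by
        rw [P.elt_append] at h1
        rw [P.elt_append, P.elt_append, P.elt_invRev, h1]; group)
    refine ⟨_, invRev α₁, α₂, invRev σ, invRev X', Y', ⟨?_, rfl, ?_, h4, ?_, ?_⟩, rfl⟩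
    · rw [← FreeGroup.invRev_invRev (L₁ := x), h2, invRev_append']
    · rw [← List.length_pos_iff] at h3 ⊢
      simpa using h3
    · simpa using h5
    · simpa using h6
  classical
  obtain ⟨a, b, s', x', y', hP, hn⟩ := Nat.find_spec hex
  refine ⟨a, b, s', x', y', hP, fun hs' => ?_⟩
  have hmin : ∀ a b s'' x' y', Peel P s x y a b s'' x' y' → s''.length < s'.length → False :=
    fun a b s'' x' y' h2 h3 => Nat.find_min hex (hn ▸ h3) ⟨a, b, s'', x', y', h2, rfl⟩
  have hx' : FreeGroup.IsReduced (invRev x') :=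
    isReduced_invRev (hx.reduced.subword ⟨a, [], by simp [hP.hx]⟩)
  have hsr : FreeGroup.IsReduced s' := (rels_reduced hP.rel').subword ⟨[], _, rfl⟩
  have hyr : FreeGroup.IsReduced y' := hy.subword ⟨b, [], by simp [hP.hy]⟩
  refine FreeGroup.IsReduced.append_overlap ?_ ?_ hs'
  · rcases isReduced_append_or hx' hsr with h | ⟨u, c, v, h2, h3⟩
    · exact h
    · have h4 : x' = linv c :: invRev u := by
        rw [← FreeGroup.invRev_invRev (L₁ := x'), h2, invRev_append', invRev_singleton]; rfl
      exfalso
      have hrel := hP.rel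
      have hsh := hP.short
      rw [h3, invRev_cons', linv_linv] at hrel hsh
      have hrel2 := rels_rotate (P := P) (u := invRev a ++ s ++ b ++ invRev v) (v := [c])
        (by simpa using hrel)
      refine hmin (a ++ [linv c]) b v (invRev u) y' ⟨by rw [hP.hx, h4]; simp, hP.hy, by simp, hP.hb,
        ?_, ?_⟩ (by simp [h3])
      · simpa [invRev_append', invRev_singleton] using hrel2
      · simp at hsh ⊢; omega
  · rcases isReduced_append_or hsr hyr with h | ⟨u, c, v, h2, h3⟩
    · exact h
    · exfalso
      have hrel := hP.rel
      have hsh := hP.short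
      rw [h2, invRev_append', invRev_singleton] at hrel hsh
      refine hmin a (b ++ [linv c]) u x' v ⟨hP.hx, by rw [hP.hy, h3]; simp, hP.ha, by simp,
        ?_, ?_⟩ (by simp [h2])
      · simpa using hrel
      · simp at hsh ⊢; omega

theorem cell_length_lt {W : ℕ} {s x y a b s' x' y' : Word S} (hx : Geo P x)
    (hy : FreeGroup.IsReduced y) (hyD : Dehn P y)
    (hyO : ∀ u τ, u <:+: y → u ++ τ ∈ P.rels → 6 * u.length < (u ++ τ).length + 6 * W)
    (h0 : [] ∉ P.rels) (hs : Thin P s) (h1 : P.elt x = P.elt (s ++ y))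
    (h : Peel P s x y a b s' x' y')
    (hr : s' ≠ [] → FreeGroup.IsReduced (invRev x' ++ s' ++ y')) :
    (invRev a ++ s ++ b ++ invRev s').length < 24 * W := by
  have hov : ∀ s₁ x₁ y₁ a₁ b₁ s₂ x₂ y₂, y₁ <:+: y → Peel P s₁ x₁ y₁ a₁ b₁ s₂ x₂ y₂ →
      6 * b₁.length < (invRev a₁ ++ s₁ ++ b₁ ++ invRev s₂).length + 6 * W := by
    intro s₁ x₁ y₁ a₁ b₁ s₂ x₂ y₂ h2 h3
    have h4 := rels_rotate (P := P) (u := invRev a₁ ++ s₁) (v := b₁ ++ invRev s₂)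
      (by simpa using h3.rel)
    have h5 : b₁ <:+: y₁ := ⟨[], y₂, by simp [h3.hy]⟩
    have := hyO b₁ (invRev s₂ ++ (invRev a₁ ++ s₁)) (h5.trans h2) (by simpa using h4)
    simp at this ⊢
    omega
  have hthin : ∀ s₁ x₁ y₁ a₁ b₁ s₂ x₂ y₂, Thin P s₁ → Peel P s₁ x₁ y₁ a₁ b₁ s₂ x₂ y₂ →
      6 * s₁.length < (invRev a₁ ++ s₁ ++ b₁ ++ invRev s₂).length := by
    intro s₁ x₁ y₁ a₁ b₁ s₂ x₂ y₂ h2 h3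
    have h4 := rels_rotate (P := P) (u := invRev a₁) (v := s₁ ++ (b₁ ++ invRev s₂))
      (by simpa using h3.rel)
    have := h2.lt (D := b₁ ++ invRev s₂ ++ invRev a₁) h0 (by simpa using h4)
    simp at this ⊢
    omega
  have e1 := hov _ _ _ _ _ _ _ _ List.infix_rfl h
  have e2 := hthin _ _ _ _ _ _ _ _ hs h
  have e3 := h.short
  have r1 := h.cell_eq
  by_cases hs' : s' = []
  · have g := (hx.subword ⟨[], x', by simp [h.hx]⟩ : Geo P a) (s ++ b)
      (by
        rw [hs'] at r1
        simpa [P.elt_append] using r1)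
    subst hs'
    simp at *
    omega
  · have hy' : FreeGroup.IsReduced y' := hy.subword ⟨b, [], by simp [h.hy]⟩
    have hyi : y' <:+: y := ⟨b, [], by simp [h.hy]⟩
    obtain ⟨a₂, b₂, s₂, x₂, y₂, h2, -⟩ := Peel.exists_reduced
      (hx.subword ⟨a, [], by simp [h.hx]⟩ : Geo P x') hy' (hyD.subword hyi) h.thin (hr hs')
      (by simp [hs']) (h.elt_eq h1)
    have f1 := hov _ _ _ _ _ _ _ _ hyi h2
    have f2 := hthin _ _ _ _ _ _ _ _ h.thin h2
    have f3 := h2.short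
    have r2 := h2.cell_eq
    have g := (hx.subword ⟨[], x₂, by simp [h.hx, h2.hx]⟩ : Geo P (a ++ a₂))
      (s ++ b ++ b₂ ++ invRev s₂)
      (by
        simp only [P.elt_append, P.elt_invRev]
        rw [r1, mul_assoc (P.elt a), r2, ← mul_assoc, mul_inv_cancel_right])
    simp at *
    omega

theorem exists_close {W : ℕ} {x y s : Word S} (hx : Geo P x)
    (hy : FreeGroup.IsReduced y) (hyD : Dehn P y)
    (hyO : ∀ u τ, u <:+: y → u ++ τ ∈ P.rels → 6 * u.length < (u ++ τ).length + 6 * W)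
    (hs : Thin P s) (hz : s ≠ [] → FreeGroup.IsReduced (invRev x ++ s ++ y))
    (h1 : P.elt x = P.elt (s ++ y)) {x₁ : Word S} (hx₁ : x₁ <+: x) :
    ∃ y₁ p, y₁ <+: y ∧ P.elt x₁ = P.elt (s ++ y₁ ++ p) ∧ p.length ≤ 16 * W := by
  induction hn : x.length using Nat.strong_induction_on generalizing x y s x₁ with
  | _ n ih =>
  by_cases hnil : x₁ = [] ∧ s = []
  · obtain ⟨rfl, rfl⟩ := hnil
    exact ⟨[], [], by simp, by simp, by simp⟩
  by_cases hstrip : s = [] ∧ ∃ c x' y', x = c :: x' ∧ y = c :: y'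
  · obtain ⟨rfl, c, x', y', rfl, rfl⟩ := hstrip
    obtain ⟨c', x₂, rfl⟩ := List.exists_cons_of_ne_nil (fun h => hnil ⟨h, rfl⟩)
    rw [List.cons_prefix_cons] at hx₁
    obtain ⟨rfl, hx₂⟩ := hx₁
    have hi : ∀ w : Word S, w <:+: c' :: w := fun w => ⟨[c'], [], by simp⟩
    obtain ⟨y₁, p, h2, h3, h4⟩ := ih x'.length (by simp [← hn]) (hx.subword (hi _))
      (hy.subword (hi _)) (hyD.subword (hi _)) (fun u τ hu => hyO u τ (hu.trans (hi _))) hs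
      (by simp) (by
        have h5 : P.elt ([c'] ++ x') = P.elt ([c'] ++ y') := by simpa using h1
        rw [P.elt_append, P.elt_append] at h5
        simpa using h5) hx₂ rfl
    refine ⟨c' :: y₁, p, by simpa using h2, ?_, h4⟩
    rw [← List.singleton_append, P.elt_append, h3, ← P.elt_append]
    simp
  have hz' : FreeGroup.IsReduced (invRev x ++ s ++ y) := by
    by_cases hs0 : s = []
    · subst hs0
      rw [List.append_nil]
      rcases isReduced_append_or (isReduced_invRev hx.reduced) hy with h | ⟨u, c, v, h2, h3⟩
      · exact h
      · exact absurd ⟨rfl, linv c, invRev u, v, by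
          rw [← FreeGroup.invRev_invRev (L₁ := x), h2, invRev_append', invRev_singleton]; rfl,
          h3⟩ hstrip
    · exact hz hs0
  have hne : invRev x ++ s ++ y ≠ [] := by
    intro h
    simp only [List.append_eq_nil_iff] at h
    obtain ⟨⟨h2, h3⟩, h4⟩ := h
    have h5 : x = [] := by rw [← FreeGroup.invRev_invRev (L₁ := x), h2]; rfl
    subst h5
    exact hnil ⟨by simpa using hx₁, h3⟩
  have h0 : [] ∉ P.rels := nil_notMem_rels hz' hne (by
    rw [P.elt_append] at h1
    rw [P.elt_append, P.elt_append, P.elt_invRev, h1]; group)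
  obtain ⟨a, b, s', x', y', hP, hr⟩ := Peel.exists_reduced hx hy hyD hs hz' hne h1
  have hlen := cell_length_lt hx hy hyD hyO h0 hs h1 hP hr
  have hsrel := rels_rotate (P := P) (u := invRev a) (v := s ++ (b ++ invRev s'))
      (by simpa using hP.rel)
  have hsl := hs.lt (D := b ++ invRev s' ++ invRev a) h0 (by simpa using hsrel)
  have harel := rels_invRev hP.rel
  have hal := hx.dehn a (invRev (s ++ (b ++ invRev s'))) ⟨[], x', by simp [hP.hx]⟩ (by
    have := rels_rotate (P := P) (u := invRev (s ++ (b ++ invRev s'))) (v := a)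
      (by simpa [invRev_append'] using harel)
    simpa using this)
  by_cases hcase : x₁ <+: a
  · refine ⟨[], invRev s ++ x₁, by simp, ?_, ?_⟩
    · simp [P.elt_append, P.elt_invRev]
    · have := hcase.length_le
      simp at hlen hsl hal ⊢
      omega
  · obtain ⟨x₂, rfl, hx₂⟩ : ∃ x₂, x₁ = a ++ x₂ ∧ x₂ <+: x' := by
      rw [hP.hx] at hx₁
      obtain ⟨t, ht⟩ := hx₁
      rw [List.append_eq_append_iff] at ht
      rcases ht with ⟨M, h2, h3⟩ | ⟨M, h2, h3⟩
      · exact absurd ⟨M, h2.symm⟩ hcase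
      · exact ⟨M, h2, t, h3.symm⟩
    have hxi : x' <:+: x := ⟨a, [], by simp [hP.hx]⟩
    have hyi : y' <:+: y := ⟨b, [], by simp [hP.hy]⟩
    have hap := List.length_pos_iff.2 hP.ha
    obtain ⟨y₁, p, h2, h3, h4⟩ := ih x'.length (by rw [← hn, hP.hx]; simp; omega) (hx.subword hxi)
      (hy.subword hyi) (hyD.subword hyi) (fun u τ hu => hyO u τ (hu.trans hyi)) hP.thin hr
      (hP.elt_eq h1) hx₂ rfl
    refine ⟨b ++ y₁, p, ?_, ?_, h4⟩
    · rw [hP.hy]; simpa using h2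
    · simp only [P.elt_append] at h3 ⊢
      rw [h3, ← mul_assoc, ← mul_assoc, ← mul_assoc, hP.cell_eq]

/-- The `n`-fold concatenation of a word with itself. -/
def wpow {α : Type*} (c : List α) (n : ℕ) : List α := (List.replicate n c).flatten

section wpow

variable {α : Type*}

@[simp] theorem wpow_zero (c : List α) : wpow c 0 = [] := rfl

theorem wpow_succ (c : List α) (n : ℕ) : wpow c (n + 1) = c ++ wpow c n := rfl

theorem wpow_add (c : List α) (m n : ℕ) : wpow c (m + n) = wpow c m ++ wpow c n := by
  rw [wpow, List.replicate_add, List.flatten_append]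
  rfl

theorem wpow_shift (a b : List α) (n : ℕ) :
    wpow (a ++ b) (n + 1) = a ++ wpow (b ++ a) n ++ b := by
  induction n with
  | zero => simp [wpow]
  | succ n ih => rw [wpow_succ, ih, wpow_succ]; simp

theorem wpow_nil (n : ℕ) : wpow ([] : List α) n = [] := by
  induction n with
  | zero => rfl
  | succ n ih => rw [wpow_succ, ih]; rfl

theorem exists_wpow_of_comm : ∀ {x y : List α}, x ++ y = y ++ x →
    ∃ z i j, x = wpow z i ∧ y = wpow z j := by
  intro x y h
  induction hn : x.length + y.length using Nat.strong_induction_on generalizing x y with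
  | _ n ih =>
  by_cases hx : x = []
  · exact ⟨y, 0, 1, by simp [hx], by simp [wpow]⟩
  by_cases hy : y = []
  · exact ⟨x, 1, 0, by simp [wpow], by simp [hy]⟩
  have hx' := List.length_pos_iff.2 hx
  have hy' := List.length_pos_iff.2 hy
  rcases List.append_eq_append_iff.1 h with ⟨y', rfl, h2⟩ | ⟨x', rfl, h2⟩
  · obtain ⟨z, i, j, h3, h4⟩ := ih (x.length + y'.length) (by simp at hn; omega)
      (by simpa using h) rfl
    exact ⟨z, i, i + j, h3, by rw [wpow_add, ← h3, ← h4]⟩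
  · obtain ⟨z, i, j, h3, h4⟩ := ih (x'.length + y.length) (by simp at hn; omega)
      (by simpa using h) rfl
    exact ⟨z, j + i, j, by rw [wpow_add, ← h3, ← h4], h4⟩

/-- Every subword of a power of `c` is a prefix of a power of a rotation of `c`. -/
theorem exists_prefix_of_infix_wpow {c u : List α} {n : ℕ} (h : u <:+: wpow c n) :
    ∃ p q, c = p ++ q ∧ u <+: wpow (q ++ p) n := by
  induction n with
  | zero => exact ⟨[], c, rfl, by simpa using h⟩
  | succ n ih =>
    obtain ⟨B, D, hBD⟩ := h
    rw [wpow_succ] at hBD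
    rcases infix_append_cases hBD.symm with ⟨N, hN⟩ | ⟨M, rfl, hM⟩ | ⟨u₁, u₂, rfl, -, -, hc, h4⟩
    · exact ⟨B, u ++ N, by simp [hN], by rw [wpow_succ]; simp⟩
    · obtain ⟨p, q, hpq, h5⟩ := ih ⟨M, D, hM.symm⟩
      refine ⟨p, q, hpq, h5.trans ?_⟩
      rw [wpow_add]
      exact List.prefix_append _ _
    · refine ⟨B, u₁, hc, ?_⟩
      rw [wpow_shift, ← hc, h4]
      simp

theorem wpow_infix_wpow_rotate (p q : List α) (n : ℕ) :
    wpow (q ++ p) n <:+: wpow (p ++ q) (n + 1) := by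
  rw [wpow_shift]
  exact ⟨p, q, rfl⟩

end wpow

theorem elt_wpow (c : Word S) (n : ℕ) : P.elt (wpow c n) = P.elt c ^ n := by
  induction n with
  | zero => simp
  | succ n ih => rw [wpow_succ, P.elt_append, ih, pow_succ']

theorem isReduced_wpow {c : Word S} (h : FreeGroup.IsReduced (c ++ c)) (n : ℕ) :
    FreeGroup.IsReduced (wpow c n) := by
  by_cases hc : c = []
  · subst hc; rw [wpow_nil]; exact h
  induction n with
  | zero => exact FreeGroup.IsReduced.nil
  | succ n ih =>
    match n, ih with
    | 0, _ => simpa [wpow] using h.subword (x := c) ⟨[], c, by simp⟩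
    | n + 1, ih =>
      rw [wpow_succ, wpow_succ, ← List.append_assoc]
      exact FreeGroup.IsReduced.append_overlap h (by rwa [← wpow_succ]) hc

theorem isOfFinOrder_of_isConj {G : Type*} [Group G] {a b : G} (h : IsConj a b)
    (ha : IsOfFinOrder a) : IsOfFinOrder b := by
  obtain ⟨k, rfl⟩ := isConj_iff.1 h
  rw [isOfFinOrder_iff_pow_eq_one] at ha ⊢
  obtain ⟨n, hn, h1⟩ := ha
  exact ⟨n, hn, by rw [conj_pow, h1]; simp⟩

theorem isConj_rotate (P : C6Presentation S) (p q : Word S) :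
    IsConj (P.elt (p ++ q)) (P.elt (q ++ p)) :=
  isConj_iff.2 ⟨(P.elt p)⁻¹, by simp only [P.elt_append]; group⟩

theorem overlap_of_isPrefix {v u τ : Word S} {n : ℕ} (hv : ¬ IsOfFinOrder (P.elt v))
    (hu : u <+: wpow v n) (hl : v.length < u.length) (hr : u ++ τ ∈ P.rels) :
    ∃ u', u = v ++ u' ∧ u' <+: u ∧ 6 * u'.length < (u ++ τ).length := by
  obtain ⟨k, rfl⟩ : ∃ k, n = k + 1 := by
    rcases n with - | k
    · simp at hu; subst hu; simp at hl
    · exact ⟨k, rfl⟩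
  obtain ⟨u', rfl⟩ : v <+: u := List.prefix_of_prefix_length_le
    (by rw [wpow_succ]; exact List.prefix_append _ _) hu hl.le
  have h1 : u' <+: wpow v (k + 1) := by
    rw [wpow_succ, List.prefix_append_right_inj] at hu
    rw [wpow_add]
    exact hu.trans (List.prefix_append _ _)
  have h2 : u' <+: v ++ u' := List.prefix_of_prefix_length_le h1 hu (by simp)
  refine ⟨u', rfl, h2, ?_⟩
  obtain ⟨D, hD⟩ := h2
  have h3 : u' ++ (τ ++ v) ∈ P.rels := by
    have := rels_rotate (P := P) (u := v) (v := u' ++ τ) (by simpa using hr)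
    simpa using this
  have h4 : u' ++ (D ++ τ) ∈ P.rels := by rwa [← List.append_assoc, hD]
  by_cases heq : u' ++ (D ++ τ) = u' ++ (τ ++ v)
  · exfalso
    rw [← List.append_assoc, hD, List.append_assoc, ← List.append_assoc u'] at heq
    obtain ⟨z, i, j, h5, h6⟩ := exists_wpow_of_comm heq
    apply hv
    have h7 := elt_rel hr
    rw [List.append_assoc, P.elt_append, h6, h5, elt_wpow, elt_wpow, ← pow_add] at h7
    rw [isOfFinOrder_iff_pow_eq_one]
    refine ⟨i + j, ?_, by rw [h5, elt_wpow, ← pow_mul, mul_comm, pow_mul, h7, one_pow]⟩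
    by_contra h8
    have : i = 0 := by omega
    subst this
    rw [wpow_zero] at h5
    subst h5
    exact hv (by simp)
  · have := piece_bound h4 h3 heq
    rwa [← List.append_assoc, hD] at this

theorem overlap_wpow {c u τ : Word S} {n : ℕ} (hc : ¬ IsOfFinOrder (P.elt c))
    (hu : u <:+: wpow c n) (hr : u ++ τ ∈ P.rels) :
    6 * u.length < (u ++ τ).length + 6 * c.length := by
  have hc0 : 0 < c.length := by
    rw [List.length_pos_iff]
    rintro rfl
    exact hc (by simp)
  obtain ⟨p, q, rfl, h1⟩ := exists_prefix_of_infix_wpow hu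
  rcases Nat.lt_or_ge (q ++ p).length u.length with hl | hl
  · obtain ⟨u', rfl, -, h2⟩ := overlap_of_isPrefix
      (fun h => hc (isOfFinOrder_of_isConj (isConj_rotate P q p) h)) h1 hl hr
    simp at h2 ⊢
    omega
  · simp at hl hc0 ⊢
    rcases Nat.eq_zero_or_pos u.length with h | h <;> omega

theorem dehn_of_half {s t : Word S} (h : s ++ t ∈ P.rels) (hl : 2 * s.length ≤ (s ++ t).length) :
    Dehn P s := by
  rintro u τ ⟨a, b, rfl⟩ hτ
  have h1 : u ++ (b ++ t ++ a) ∈ P.rels := by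
    have := rels_rotate (P := P) (u := a) (v := u ++ (b ++ t)) (by simpa using h)
    simpa using this
  by_cases heq : u ++ τ = u ++ (b ++ t ++ a)
  · rw [heq]
    simp at hl ⊢
    omega
  · have := piece_bound hτ h1 heq
    omega

/-- The shape of the subwords of powers of `x ++ y`. -/
theorem infix_wpow_append_cases {α : Type*} {x y u : List α} {n : ℕ} (h : u <:+: wpow (x ++ y) n) :
    u <:+: x ∨ u <:+: y ∨
    (∃ u₁ u₂, u = u₁ ++ u₂ ∧ u₁ ≠ [] ∧ u₂ ≠ [] ∧ u₁ <:+ y ∧ u₂ <+: x) ∨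
    (∃ u₁ u₂, u = u₁ ++ u₂ ∧ u₁ ≠ [] ∧ u₂ ≠ [] ∧ u₁ <:+ x ∧ u₂ <+: y) ∨
    (∃ u₁ u₂, u = u₁ ++ x ++ u₂ ∧ u₁ ≠ [] ∧ u₂ ≠ [] ∧ u₁ <:+ y ∧ u₂ <+: y) ∨
    ∃ u₁ u₂, u₁ ≠ [] ∧ u = u₁ ++ y ++ u₂ ∧ (u₁ <:+ x ∨ x <:+ u₁) := by
  induction n with
  | zero => exact Or.inl (by simp at h; simp [h])
  | succ n ih =>
    have split : ∀ {a b c : List α}, a <+: b ++ c →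
        a <+: b ∨ ∃ a', a' ≠ [] ∧ a = b ++ a' ∧ a' <+: c := by
      rintro a b c ⟨D, hD⟩
      rcases List.append_eq_append_iff.1 hD with ⟨M, h1, h2⟩ | ⟨M, h1, h2⟩
      · exact Or.inl ⟨M, h1.symm⟩
      · by_cases hM : M = []
        · subst hM; exact Or.inl (by simp [h1])
        · exact Or.inr ⟨M, hM, h1, D, h2.symm⟩
    obtain ⟨B, D, hBD⟩ := h
    rw [wpow_succ, List.append_assoc x] at hBD
    rcases infix_append_cases hBD.symm with ⟨N, hN⟩ | ⟨M, rfl, hM⟩ |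
      ⟨u₁, u₂, rfl, hu₁, hu₂, hx, hy⟩
    · exact Or.inl ⟨B, N, hN.symm⟩
    · rcases infix_append_cases hM with ⟨N, hN⟩ | ⟨M', rfl, hM'⟩ | ⟨u₁, u₂, rfl, hu₁, hu₂, hy, hz⟩
      · exact Or.inr (Or.inl ⟨M, N, hN.symm⟩)
      · exact ih ⟨M', D, hM'.symm⟩
      · have hs : u₁ <:+ y := ⟨M, hy.symm⟩
        rcases n with - | n
        · simp at hz; exact absurd hz.1 hu₂
        rw [wpow_succ, List.append_assoc] at hz
        rcases split (a := u₂) ⟨D, hz.symm⟩ with h1 | ⟨u₃, hu₃, rfl, h1⟩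
        · exact Or.inr (Or.inr (Or.inl ⟨u₁, u₂, rfl, hu₁, hu₂, hs, h1⟩))
        · rcases split h1 with h2 | ⟨u₄, hu₄, rfl, h2⟩
          · exact Or.inr (Or.inr (Or.inr (Or.inr (Or.inl ⟨u₁, u₃, by simp, hu₁, hu₃, hs, h2⟩))))
          · exact Or.inr (Or.inr (Or.inr (Or.inr (Or.inr ⟨u₁ ++ x, u₄, by simp [hu₁], by simp,
              Or.inr (List.suffix_append _ _)⟩))))
    · have hs : u₁ <:+ x := ⟨B, hx.symm⟩
      rcases split (a := u₂) ⟨D, hy.symm⟩ with h1 | ⟨u₃, hu₃, rfl, h1⟩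
      · exact Or.inr (Or.inr (Or.inr (Or.inl ⟨u₁, u₂, rfl, hu₁, hu₂, hs, h1⟩)))
      · exact Or.inr (Or.inr (Or.inr (Or.inr (Or.inr ⟨u₁, u₃, hu₁, by simp, Or.inl hs⟩))))

theorem piece_next {s ρ ρ' : Word S} {a b : S × Bool} (h₁ : s ++ a :: ρ ∈ P.rels)
    (h₂ : s ++ b :: ρ' ∈ P.rels) (hab : a ≠ b) : 6 * s.length < (s ++ a :: ρ).length :=
  piece_bound h₁ h₂ fun h => hab (by simpa using (List.cons.inj (List.append_cancel_left h)).1)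

theorem piece_prev {s ρ ρ' : Word S} {a b : S × Bool} (h₁ : s ++ (ρ ++ [a]) ∈ P.rels)
    (h₂ : s ++ (ρ' ++ [b]) ∈ P.rels) (hab : a ≠ b) :
    6 * s.length < (s ++ (ρ ++ [a])).length :=
  piece_bound h₁ h₂ fun h => hab <| by
    simpa using List.append_inj_right' (List.append_cancel_left h) rfl

theorem ne_linv_of_isReduced {u v u' v' : Word S} {a b : S × Bool}
    (h : FreeGroup.IsReduced (u ++ v)) (hu : u = u' ++ [a]) (hv : v = b :: v') :
    b ≠ linv a := by
  rintro rfl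
  subst hu hv
  exact not_isReduced_pair (u := u') (a := a) (v := v') (by simpa using h)

/-- `w` is a shortest word among those representing a conjugate of the same element. -/
def MinConj (P : C6Presentation S) (w : Word S) : Prop :=
  ∀ v, IsConj (P.elt w) (P.elt v) → w.length ≤ v.length

theorem MinConj.geo {w : Word S} (h : MinConj P w) : Geo P w :=
  fun v hv => h v (by rw [hv])

theorem MinConj.rotate {p q : Word S} (h : MinConj P (p ++ q)) : MinConj P (q ++ p) := by
  intro v hv
  have := h v ((isConj_rotate P p q).trans hv)
  simp at this ⊢
  omega

theorem MinConj.isReduced_sq {w : Word S} (h : MinConj P w) (hne : w ≠ []) :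
    FreeGroup.IsReduced (w ++ w) := by
  obtain ⟨π, x', hw, -, h1⟩ := exists_conj_cyclic h.geo.reduced hne
  have h2 := h x' (isConj_iff.2 ⟨(P.elt π)⁻¹, by
    rw [hw, P.elt_append, P.elt_append, P.elt_invRev]; group⟩)
  have h3 : π = [] := by
    rw [hw] at h2
    simp at h2
    exact List.length_eq_zero_iff.1 (by omega)
  subst h3
  simp at hw
  rwa [hw]

/-- A prefix of a power of a conjugacy-minimal word `v` which is more than half of a relator
overlaps itself in a short word. -/
theorem MinConj.exists_overlap {v u t : Word S} {n : ℕ} (hmin : MinConj P v)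
    (hv : ¬ IsOfFinOrder (P.elt v)) (hu : u <+: wpow v n) (hr : u ++ t ∈ P.rels)
    (hl : (u ++ t).length < 2 * u.length) :
    ∃ b x, v = b ++ x ∧ u = b ++ x ++ b ∧ 6 * b.length < (u ++ t).length ∧
      x.length ≤ t.length := by
  obtain ⟨k, rfl⟩ : ∃ k, n = k + 1 := by
    rcases n with - | k
    · simp at hu; subst hu; simp at hl
    · exact ⟨k, rfl⟩
  rw [wpow_succ] at hu
  rcases Nat.lt_or_ge v.length u.length with h | h
  · obtain ⟨b, rfl, h1, h2⟩ := overlap_of_isPrefix (n := k + 1) hv (by rwa [wpow_succ]) h hr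
    obtain ⟨x, rfl⟩ : b <+: v :=
      List.prefix_of_prefix_length_le h1 (List.prefix_append _ _) (by simp at hl h2; omega)
    refine ⟨b, x, rfl, rfl, h2, ?_⟩
    have h3 := hmin (invRev (b ++ t)) (by
      have h4 := elt_rel hr
      rw [List.append_assoc, P.elt_append] at h4
      rw [P.elt_invRev, eq_inv_of_mul_eq_one_left h4])
    simp at h3
    omega
  · exfalso
    have h1 : u <+: v := List.prefix_of_prefix_length_le hu (List.prefix_append _ _) h
    have := hmin.geo.dehn u t h1.isInfix hr
    omega

/-- If `b ++ x ++ b ++ t` is a relator in which `b` is short and `x`, `t` have different first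
letters and different last letters, then powers of `x ++ invRev t` contain no more than half of
a relator. -/
theorem dehn_wpow_of_relator {b x t : Word S} (hr : b ++ (x ++ (b ++ t)) ∈ P.rels)
    (hb : 6 * b.length < (b ++ (x ++ (b ++ t))).length) (hxt : x.length ≤ t.length)
    (ht : t.length < 2 * b.length + x.length)
    (hhead : ∀ a x' t', x = a :: x' → t = a :: t' → False)
    (hlast : ∀ a x' t', x = x' ++ [a] → t = t' ++ [a] → False) :
    FreeGroup.IsReduced ((x ++ invRev t) ++ (x ++ invRev t)) ∧
      ∀ n, Dehn P (wpow (x ++ invRev t) n) := by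
  have hlen : (b ++ (x ++ (b ++ t))).length = 2 * b.length + x.length + t.length := by
    simp; omega
  have hx0 : x ≠ [] := by rintro rfl; simp at hlen hb ht; omega
  have ht0 : t ≠ [] := by rintro rfl; simp at hlen hb ht hxt; exact hx0 hxt
  have hb0 : b ≠ [] := by rintro rfl; simp at ht; omega
  have hrr := rels_cyclic hr
  have hy0 : invRev t ≠ [] := by
    intro h
    have := congrArg List.length h
    simp at this
    exact ht0 this
  have hxr : FreeGroup.IsReduced x := hrr.subword ⟨b, b ++ t ++ (b ++ (x ++ (b ++ t))), by simp⟩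
  have htr : FreeGroup.IsReduced t := hrr.subword ⟨b ++ x ++ b, b ++ (x ++ (b ++ t)), by simp⟩
  have hxy : FreeGroup.IsReduced (x ++ invRev t) := by
    refine (isReduced_append_or hxr (isReduced_invRev htr)).resolve_right ?_
    rintro ⟨u', a, v', h1, h2⟩
    refine hlast a u' (invRev v') h1 ?_
    rw [← FreeGroup.invRev_invRev (L₁ := t), h2, invRev_cons']
    simp [linv]
  have hyx : FreeGroup.IsReduced (invRev t ++ x) := by
    refine (isReduced_append_or (isReduced_invRev htr) hxr).resolve_right ?_
    rintro ⟨u', a, v', h1, h2⟩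
    refine hhead (linv a) v' (invRev u') h2 ?_
    rw [← FreeGroup.invRev_invRev (L₁ := t), h1, invRev_append', invRev_singleton]
    rfl
  refine ⟨?_, ?_⟩
  · have h1 := FreeGroup.IsReduced.append_overlap hxy hyx hy0
    have h2 := FreeGroup.IsReduced.append_overlap h1 hxy hx0
    simpa using h2
  obtain ⟨xh, x₀, hxh⟩ := List.exists_cons_of_ne_nil hx0
  obtain ⟨th, t₀, hth⟩ := List.exists_cons_of_ne_nil ht0
  obtain ⟨bh, b₀, hbh⟩ := List.exists_cons_of_ne_nil hb0
  obtain ⟨x₁, xl, hxl⟩ := List.eq_nil_or_concat x |>.resolve_left hx0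
  obtain ⟨t₁, tl, htl⟩ := List.eq_nil_or_concat t |>.resolve_left ht0
  obtain ⟨b₁, bl, hbl⟩ := List.eq_nil_or_concat b |>.resolve_left hb0
  rw [List.concat_eq_append] at hxl htl hbl
  have hbx : xh ≠ linv bl := ne_linv_of_isReduced
    (hrr.subword ⟨[], b ++ t ++ (b ++ (x ++ (b ++ t))), by simp⟩) hbl hxh
  have hxb : bh ≠ linv xl := ne_linv_of_isReduced
    (hrr.subword ⟨b, t ++ (b ++ (x ++ (b ++ t))), by simp⟩) hxl hbh
  have hbt : th ≠ linv bl := ne_linv_of_isReduced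
    (hrr.subword ⟨b ++ x, b ++ (x ++ (b ++ t)), by simp⟩) hbl hth
  have htb : bh ≠ linv tl := ne_linv_of_isReduced
    (hrr.subword ⟨b ++ x ++ b, x ++ (b ++ t), by simp⟩) htl hbh
  have hyh : invRev t = linv tl :: invRev t₁ := by rw [htl, invRev_append', invRev_singleton]; rfl
  have hyl : invRev t = invRev t₀ ++ [linv th] := by rw [hth, invRev_cons']
  have hbih : invRev b = linv bl :: invRev b₁ := by rw [hbl, invRev_append', invRev_singleton]; rfl
  have hbil : invRev b = invRev b₀ ++ [linv bh] := by rw [hbh, invRev_cons']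
  have hr' : invRev t ++ (invRev b ++ (invRev x ++ invRev b)) ∈ P.rels := by
    simpa [invRev_append'] using rels_invRev hr
  have hr'len : (invRev t ++ (invRev b ++ (invRev x ++ invRev b))).length =
      2 * b.length + x.length + t.length := by
    simp; omega
  have hinv : ∀ {a b : S × Bool}, a ≠ linv b → b ≠ linv a := by
    rintro a b h rfl
    exact h (by simp [linv])
  have xpre : ∀ s ρ, s <+: x → s ++ (ρ ++ [linv th]) ∈ P.rels →
      6 * s.length < (s ++ (ρ ++ [linv th])).length := by
    rintro s ρ ⟨s', hs⟩ h
    refine piece_prev h (b := bl) (ρ' := s' ++ (b ++ (t ++ b₁))) ?_ (hinv hbt).symm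
    have := rels_rotate (P := P) hr
    rw [← hs, hbl] at this
    simpa [hbl] using this
  have ysuf : ∀ s ρ, s <:+ invRev t → s ++ xh :: ρ ∈ P.rels →
      6 * s.length < (s ++ xh :: ρ).length := by
    rintro s ρ ⟨s', hs⟩ h
    refine piece_next h (b := linv bl) (ρ' := invRev b₁ ++ (invRev x ++ (invRev b ++ s'))) ?_ hbx
    rw [← hs, List.append_assoc] at hr'
    have := rels_rotate (P := P) hr'
    rw [hbih] at this ⊢
    simpa using this
  have xsuf : ∀ s ρ, s <:+ x → s ++ linv tl :: ρ ∈ P.rels →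
      6 * s.length < (s ++ linv tl :: ρ).length := by
    rintro s ρ ⟨s', hs⟩ h
    refine piece_next h (b := bh) (ρ' := b₀ ++ (t ++ (b ++ s'))) ?_ htb.symm
    have := rels_rotate (P := P) (u := b ++ s') (v := s ++ (b ++ t)) (by simpa [← hs] using hr)
    rw [hbh] at this ⊢
    simpa using this
  have ypre : ∀ s ρ, s <+: invRev t → s ++ (ρ ++ [xl]) ∈ P.rels →
      6 * s.length < (s ++ (ρ ++ [xl])).length ∧
      6 * s.length < 2 * b.length + x.length + t.length := by
    rintro s ρ ⟨s', hs⟩ h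
    have h1 : s ++ ((s' ++ (invRev b ++ (invRev x ++ invRev b₀))) ++ [linv bh]) =
        invRev t ++ (invRev b ++ (invRev x ++ invRev b)) := by
      rw [← hs, hbil]; simp
    have h2 := h1 ▸ hr'
    refine ⟨piece_prev h h2 (hinv hxb), ?_⟩
    have := piece_prev h2 h (hinv hxb).symm
    rwa [h1, hr'len] at this
  have rot : ∀ {a b c : Word S}, a ++ b ++ c ∈ P.rels → b ++ (c ++ a) ∈ P.rels := by
    intro a b c h
    have := rels_rotate (P := P) (u := a) (v := b ++ c) (by simpa using h)
    simpa using this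
  have prefix_head : ∀ {s l l' : Word S} {a : S × Bool}, l = a :: l' → s ≠ [] → s <+: l →
      ∃ s', s = a :: s' := by
    rintro s l l' a rfl hs ⟨D, hD⟩
    rcases s with - | ⟨d, s⟩
    · exact absurd rfl hs
    · exact ⟨s, by simp at hD; rw [hD.1]⟩
  have suffix_last : ∀ {s l l' : Word S} {a : S × Bool}, l = l' ++ [a] → s ≠ [] → s <:+ l →
      ∃ s', s = s' ++ [a] := by
    rintro s l l' a rfl hs ⟨D, hD⟩
    obtain ⟨s', d, rfl⟩ := (List.eq_nil_or_concat s).resolve_left hs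
    rw [List.concat_eq_append, ← List.append_assoc] at hD
    exact ⟨s', by rw [List.concat_eq_append, (List.append_inj' hD rfl).2]⟩
  intro n u τ hu hτ
  rcases infix_wpow_append_cases hu with h | h | ⟨u₁, u₂, rfl, h1, h2, h3, h4⟩ |
    ⟨u₁, u₂, rfl, h1, h2, h3, h4⟩ | ⟨u₁, u₂, rfl, h1, h2, h3, h4⟩ | ⟨u₁, u₂, h1, rfl, h3⟩
  · have h1 : x ++ (b ++ t ++ b) ∈ P.rels := by simpa using rels_rotate (P := P) hr
    exact dehn_of_half h1 (by simp; omega) u τ h hτ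
  · exact dehn_of_half hr' (by rw [hr'len]; simp; omega) u τ h hτ
  · obtain ⟨u₁', h5⟩ := suffix_last hyl h1 h3
    obtain ⟨u₂', h6⟩ := prefix_head hxh h2 h4
    have h7 := xpre u₂ (τ ++ u₁') h4 (by simpa [h5] using rot (a := u₁) (b := u₂) (c := τ) hτ)
    have h8 := ysuf u₁ (u₂' ++ τ) h3 (by simpa [h6] using hτ)
    simp [h5, h6] at h7 h8 ⊢
    omega
  · obtain ⟨u₁', h5⟩ := suffix_last hxl h1 h3
    obtain ⟨u₂', h6⟩ := prefix_head hyh h2 h4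
    have h7 := (ypre u₂ (τ ++ u₁') h4
      (by simpa [h5] using rot (a := u₁) (b := u₂) (c := τ) hτ)).1
    have h8 := xsuf u₁ (u₂' ++ τ) h3 (by simpa [h6] using hτ)
    simp [h5, h6] at h7 h8 ⊢
    omega
  · obtain ⟨u₁', h5⟩ := suffix_last hyl h1 h3
    have h7 := xpre x (u₂ ++ τ ++ u₁') List.prefix_rfl
      (by simpa [h5] using rot (a := u₁) (b := x) (c := u₂ ++ τ) (by simpa using hτ))
    have h8 := ysuf u₁ (x₀ ++ u₂ ++ τ) h3 (by simpa [hxh] using hτ)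
    have h9 := (ypre u₂ (τ ++ u₁ ++ x₁) h4 (by
      simpa [hxl] using rot (a := u₁ ++ x) (b := u₂) (c := τ) (by simpa using hτ))).1
    have h10 := congrArg List.length hxh
    have h11 := congrArg List.length hxl
    simp [h5] at h7 h8 h9 h10 h11 ⊢
    omega
  · exfalso
    obtain ⟨u₁', h5⟩ : ∃ u₁', u₁ = u₁' ++ [xl] := by
      rcases h3 with h3 | ⟨D, h3⟩
      · exact suffix_last hxl h1 h3
      · exact ⟨D ++ x₁, by rw [← h3, hxl]; simp⟩
    have h7 := (ypre (invRev t) (u₂ ++ τ ++ u₁') List.prefix_rfl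
      (by simpa [h5] using rot (a := u₁) (b := invRev t) (c := u₂ ++ τ) (by simpa using hτ))).2
    rw [hlen] at hb
    simp at h7
    omega

theorem exists_axis {w : Word S} (hmin : MinConj P w) (hw : ¬ IsOfFinOrder (P.elt w)) :
    ∃ (N : ℕ) (c : Word S), 0 < N ∧ IsConj (P.elt w ^ N) (P.elt c) ∧
      FreeGroup.IsReduced (c ++ c) ∧ ∀ n, Dehn P (wpow c n) := by
  have hw0 : w ≠ [] := by
    rintro rfl
    exact hw (by simp)
  by_cases hD : ∀ n, Dehn P (wpow w n)
  · exact ⟨1, w, one_pos, by rw [pow_one], hmin.isReduced_sq hw0, hD⟩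
  set Bad : Word S → Prop := fun u => (∃ k, u <:+: wpow w k) ∧
    ∃ t, u ++ t ∈ P.rels ∧ (u ++ t).length < 2 * u.length with hBad
  have key : ∀ u, Bad u → ∃ b x t, IsConj (P.elt w) (P.elt (b ++ x)) ∧ (b ++ x).length = w.length ∧
      (∀ n, wpow (b ++ x) n <:+: wpow w (n + 1)) ∧
      u = b ++ x ++ b ∧ b ++ x ++ b ++ t ∈ P.rels ∧
      6 * b.length < (b ++ x ++ b ++ t).length ∧
      (b ++ x ++ b ++ t).length < 2 * (b ++ x ++ b).length ∧ x.length ≤ t.length := by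
    rintro u ⟨⟨k, hk⟩, t, ht, hl⟩
    obtain ⟨p, q, rfl, h1⟩ := exists_prefix_of_infix_wpow hk
    have hc := isConj_rotate P p q
    obtain ⟨b, x, h2, rfl, h3, h4⟩ := hmin.rotate.exists_overlap
      (fun h => hw (isOfFinOrder_of_isConj hc.symm h)) h1 ht hl
    refine ⟨b, x, t, h2 ▸ hc, ?_, fun n => ?_, rfl, ht, h3, hl, h4⟩
    · rw [← h2]; simp; omega
    · rw [← h2]; exact wpow_infix_wpow_rotate p q n
  have hbound : ∀ u, Bad u → u.length ≤ 2 * w.length := by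
    intro u hu
    obtain ⟨b, x, t, -, h1, -, rfl, -⟩ := key u hu
    simp at h1 ⊢
    omega
  obtain ⟨u, hu, hmax⟩ : ∃ u, Bad u ∧ ∀ u', Bad u' → u'.length ≤ u.length := by
    have hne : ∃ m u, Bad u ∧ 2 * w.length - u.length = m := by
      simp only [not_forall, Dehn] at hD
      obtain ⟨n, u, t, h1, h2, h3⟩ := hD
      exact ⟨_, u, ⟨⟨n, h1⟩, t, h2, by omega⟩, rfl⟩
    classical
    obtain ⟨u, hu, hm⟩ := Nat.find_spec hne
    refine ⟨u, hu, fun u' hu' => ?_⟩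
    have h1 := Nat.find_min' hne ⟨u', hu', rfl⟩
    have h2 := hbound u hu
    have h3 := hbound u' hu'
    omega
  obtain ⟨b, x, t, hc, -, hpow, rfl, hr, hb, hl, hxt⟩ := key u hu
  obtain ⟨h1, h2⟩ := dehn_wpow_of_relator (P := P) (b := b) (x := x) (t := t)
    (by simpa using hr) (by simpa using hb) hxt (by simp at hl; omega)
    (by
      rintro a x' t' rfl rfl
      have := hmax (b ++ a :: x' ++ b ++ [a]) ⟨⟨3, List.IsInfix.trans ⟨[], x', ?_⟩ (hpow 2)⟩,
        t', by simpa using hr, by simp at hl ⊢; omega⟩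
      · simp at this
      · simp [wpow])
    (by
      rintro a x' t' rfl rfl
      have := hmax (a :: (b ++ (x' ++ [a]) ++ b)) ⟨⟨4, List.IsInfix.trans ⟨b ++ x', x' ++ [a], ?_⟩
        (hpow 3)⟩, t', ?_, by simp at hl ⊢; omega⟩
      · simp at this
      · simp [wpow]
      · simpa using rels_rotate (P := P) (u := b ++ (x' ++ [a]) ++ b ++ t') (v := [a])
          (by simpa using hr))
  refine ⟨2, x ++ invRev t, two_pos, ?_, h1, h2⟩
  refine (hc.pow 2).trans (isConj_iff.2 ⟨(P.elt b)⁻¹, ?_⟩)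
  have h3 := elt_rel hr
  simp only [P.elt_append] at h3 ⊢
  rw [P.elt_invRev, pow_two, ← eq_inv_of_mul_eq_one_left h3]
  group

section length

open Filter Topology

variable {G : Type*} [Group G]

theorem subadditive_length_pow {L : G → ℕ} (hmul : ∀ a b, L (a * b) ≤ L a + L b) (g : G) :
    Subadditive fun n : ℕ => (L (g ^ n) : ℝ) := by
  intro m n
  beta_reduce
  rw [pow_add]
  exact_mod_cast hmul _ _

theorem bddBelow_length_pow (L : G → ℕ) (g : G) :
    BddBelow (Set.range fun n : ℕ => (L (g ^ n) : ℝ) / n) :=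
  ⟨0, by rintro _ ⟨n, rfl⟩; positivity⟩

theorem exists_pos_gap (T : Finset ℝ) : ∃ ε > 0, ∀ t ∈ T, t ≤ 0 ∨ ε ≤ t := by
  induction T using Finset.induction_on with
  | empty => exact ⟨1, one_pos, by simp⟩
  | insert a T _ ih =>
    obtain ⟨ε, hε, h⟩ := ih
    rcases le_or_gt a 0 with ha | ha
    · exact ⟨ε, hε, by simpa [ha] using h⟩
    · refine ⟨min ε a, lt_min hε ha, fun t ht => ?_⟩
      rcases Finset.mem_insert.1 ht with rfl | ht
      · exact Or.inr (min_le_right _ _)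
      · exact (h t ht).imp_right (min_le_left _ _).trans

/-- The Busemann-type function of the axis of `h`, normalised by the translation length `τ`. -/
noncomputable def axisHeight (L : G → ℕ) (h : G) (τ : ℝ) (z : G) : ℝ :=
  ⨅ k : ℤ, ((L (h ^ k * z) : ℝ) - k * τ)

variable {L : G → ℕ} {h : G} {τ : ℝ}

theorem bddBelow_axisHeight (hmul : ∀ a b, L (a * b) ≤ L a + L b) (hτ0 : 0 ≤ τ)
    (hτ : ∀ n : ℕ, n * τ ≤ L (h ^ n)) (z : G) (k : ℤ) :
    -(L z⁻¹ : ℝ) ≤ (L (h ^ k * z) : ℝ) - k * τ := by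
  rcases le_or_gt 0 k with hk | hk
  · lift k to ℕ using hk
    have h1 := hmul (h ^ k * z) z⁻¹
    rw [mul_inv_cancel_right] at h1
    have h2 : (L (h ^ k) : ℝ) ≤ L (h ^ k * z) + L z⁻¹ := by exact_mod_cast h1
    have h3 := hτ k
    simp
    linarith
  · have h1 : (k : ℝ) * τ ≤ 0 :=
      mul_nonpos_of_nonpos_of_nonneg (by exact_mod_cast hk.le) hτ0
    have h2 : (0 : ℝ) ≤ L (h ^ k * z) := by positivity
    have h3 : (0 : ℝ) ≤ L z⁻¹ := by positivity
    linarith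

theorem axisHeight_le (hmul : ∀ a b, L (a * b) ≤ L a + L b) (hτ0 : 0 ≤ τ)
    (hτ : ∀ n : ℕ, n * τ ≤ L (h ^ n)) (z : G) (k : ℤ) :
    axisHeight L h τ z ≤ (L (h ^ k * z) : ℝ) - k * τ :=
  ciInf_le ⟨_, by rintro _ ⟨k, rfl⟩; exact bddBelow_axisHeight hmul hτ0 hτ z k⟩ k

theorem axisHeight_mul_le (hmul : ∀ a b, L (a * b) ≤ L a + L b) (hτ0 : 0 ≤ τ)
    (hτ : ∀ n : ℕ, n * τ ≤ L (h ^ n)) (z s : G) :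
    axisHeight L h τ (z * s) ≤ axisHeight L h τ z + L s := by
  rw [← sub_le_iff_le_add]
  refine le_ciInf fun k => ?_
  have h1 := axisHeight_le hmul hτ0 hτ (z * s) k
  have h2 : (L (h ^ k * (z * s)) : ℝ) ≤ L (h ^ k * z) + L s := by
    rw [← mul_assoc]
    exact_mod_cast hmul _ _
  linarith

theorem axisHeight_pow_mul (hmul : ∀ a b, L (a * b) ≤ L a + L b) (hτ0 : 0 ≤ τ)
    (hτ : ∀ n : ℕ, n * τ ≤ L (h ^ n)) (z : G) (j : ℕ) :
    axisHeight L h τ (h ^ j * z) = axisHeight L h τ z + j * τ := by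
  apply le_antisymm
  · rw [← sub_le_iff_le_add]
    refine le_ciInf fun k => ?_
    have h1 := axisHeight_le hmul hτ0 hτ (h ^ j * z) (k - j)
    rw [← mul_assoc, ← zpow_natCast, ← zpow_add, sub_add_cancel] at h1
    rw [← zpow_natCast]
    push_cast at h1
    linarith
  · refine le_ciInf fun k => ?_
    have h1 := axisHeight_le hmul hτ0 hτ z (k + j)
    rw [zpow_add, zpow_natCast, mul_assoc] at h1
    push_cast at h1
    linarith

theorem axisHeight_one (hone : L 1 = 0) (hmul : ∀ a b, L (a * b) ≤ L a + L b) (hτ0 : 0 ≤ τ)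
    (hτ : ∀ n : ℕ, n * τ ≤ L (h ^ n)) : axisHeight L h τ 1 = 0 := by
  apply le_antisymm
  · simpa [hone] using axisHeight_le hmul hτ0 hτ (1 : G) 0
  · refine le_ciInf fun k => ?_
    simpa [hone] using bddBelow_axisHeight hmul hτ0 hτ (1 : G) k

/-- If geodesics from `1` to `h ^ n` stay uniformly close to the powers of `h`, then `h` has
rational translation length. -/
theorem exists_rat_tendsto_of_close (hone : L 1 = 0) (hmul : ∀ a b, L (a * b) ≤ L a + L b)
    (hfin : ∀ r, {x | L x ≤ r}.Finite) (h : G) (K : ℕ)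
    (hclose : ∀ n, ∃ z : ℕ → G, z 0 = 1 ∧ z (L (h ^ n)) = h ^ n ∧
      (∀ i < L (h ^ n), L ((z i)⁻¹ * z (i + 1)) ≤ 1) ∧
      ∀ i ≤ L (h ^ n), ∃ (k : ℕ) (b : G), L b ≤ K ∧ z i = h ^ k * b) :
    ∃ q : ℚ, Tendsto (fun n : ℕ => (L (h ^ n) : ℝ) / n) atTop (𝓝 (q : ℝ)) := by
  have hsub := subadditive_length_pow hmul h
  have hbdd := bddBelow_length_pow L h
  set τ := hsub.lim with hτdef
  have hlim : Tendsto (fun n : ℕ => (L (h ^ n) : ℝ) / n) atTop (𝓝 τ) := hsub.tendsto_lim hbdd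
  have hτ0 : 0 ≤ τ := ge_of_tendsto' hlim fun n => by positivity
  have hτ : ∀ n : ℕ, n * τ ≤ L (h ^ n) := by
    intro n
    rcases Nat.eq_zero_or_pos n with rfl | hn
    · simp
    · have := hsub.lim_le_div hbdd hn.ne'
      rw [le_div_iff₀ (by exact_mod_cast hn)] at this
      linarith
  suffices hq : ∃ q : ℚ, (q : ℝ) = τ by
    obtain ⟨q, hq⟩ := hq
    exact ⟨q, hq ▸ hlim⟩
  rcases hτ0.eq_or_lt with h0 | hpos
  · exact ⟨0, by simpa using h0⟩
  set Ψ := axisHeight L h τ with hΨ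
  set B := (hfin K).toFinset with hB
  set T := (B ×ˢ (hfin 1).toFinset).image (fun p : G × G => 1 - (Ψ (p.1 * p.2) - Ψ p.1)) with hT
  obtain ⟨ε, hε, hgap⟩ := exists_pos_gap T
  set M := B.card + 1 with hM
  have hMpos : (0 : ℝ) < M := by simp only [hM]; positivity
  have hstep : ∀ (z z' : G) (k : ℕ) (b : G), L b ≤ K → z = h ^ k * b → L (z⁻¹ * z') ≤ 1 →
      0 ≤ 1 - (Ψ z' - Ψ z) ∧ (1 - (Ψ z' - Ψ z) = 0 ∨ ε ≤ 1 - (Ψ z' - Ψ z)) := by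
    rintro z z' k b hb hz hz'
    have h1 : Ψ z' - Ψ z = Ψ (b * (z⁻¹ * z')) - Ψ b := by
      have e1 := axisHeight_pow_mul hmul hτ0 hτ (b * (z⁻¹ * z')) k
      have e2 := axisHeight_pow_mul hmul hτ0 hτ b k
      rw [← mul_assoc, ← hz, mul_inv_cancel_left] at e1
      rw [← hz] at e2
      rw [hΨ]
      linarith
    have h2 : Ψ z' ≤ Ψ z + L (z⁻¹ * z') := by
      simpa using axisHeight_mul_le hmul hτ0 hτ z (z⁻¹ * z')
    have h3 : (L (z⁻¹ * z') : ℝ) ≤ 1 := by exact_mod_cast hz'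
    have h4 : 0 ≤ 1 - (Ψ z' - Ψ z) := by linarith
    refine ⟨h4, (hgap (1 - (Ψ z' - Ψ z)) ?_).imp_left fun h5 => le_antisymm h5 h4⟩
    rw [h1]
    exact Finset.mem_image.2 ⟨(b, z⁻¹ * z'), by simp [hB, hb, hz'], rfl⟩
  by_cases hstretch : ∃ (n : ℕ) (z : ℕ → G) (a : ℕ), a + M ≤ L (h ^ n) ∧
      (∀ i ≤ L (h ^ n), ∃ (k : ℕ) (b : G), L b ≤ K ∧ z i = h ^ k * b) ∧
      ∀ i < M, 1 - (Ψ (z (a + i + 1)) - Ψ (z (a + i))) = 0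
  · obtain ⟨n, z, a, ha, hz, hcost⟩ := hstretch
    have hlin : ∀ i ≤ M, Ψ (z (a + i)) = Ψ (z a) + i := by
      intro i hi
      induction i with
      | zero => simp
      | succ i ih =>
        have h1 := ih (by omega)
        have h2 := hcost i (by omega)
        push_cast
        rw [← add_assoc]
        linarith
    choose! k b hb hzk using hz
    obtain ⟨i, hi, j, hj, hij, hbij⟩ := Finset.exists_ne_map_eq_of_card_lt_of_maps_to
      (s := Finset.range M) (t := B) (f := fun i => b (a + i)) (by simp [hM]) (by
        intro i hi
        simp at hi
        simpa [hB] using hb (a + i) (by omega))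
    have hi' : i < M := by simpa using hi
    have hj' : j < M := by simpa using hj
    have e1 := axisHeight_pow_mul hmul hτ0 hτ (b (a + i)) (k (a + i))
    have e2 := axisHeight_pow_mul hmul hτ0 hτ (b (a + j)) (k (a + j))
    rw [← hzk _ (by omega), ← hΨ, hlin i hi'.le] at e1
    rw [← hzk _ (by omega), ← hΨ, hlin j hj'.le, ← hbij] at e2
    have e3 : ((k (a + j) : ℝ) - k (a + i)) * τ = (j : ℝ) - i := by linarith
    have e4 : (j : ℝ) - i ≠ 0 := by
      rw [sub_ne_zero]
      exact_mod_cast hij.symm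
    have e5 : (k (a + j) : ℝ) - k (a + i) ≠ 0 := by
      intro h0
      rw [h0, zero_mul] at e3
      exact e4 e3.symm
    refine ⟨((j : ℚ) - i) / ((k (a + j) : ℚ) - k (a + i)), ?_⟩
    push_cast
    rw [div_eq_iff e5]
    linarith
  · exfalso
    push Not at hstretch
    have hbound : ∀ n : ℕ, ε * (n * τ / M - 1) ≤ L (h ^ n) - n * τ := by
      intro n
      obtain ⟨z, hz0, hzn, hz1, hzK⟩ := hclose n
      have hc : ∀ i < L (h ^ n), 0 ≤ 1 - (Ψ (z (i + 1)) - Ψ (z i)) ∧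
          (1 - (Ψ (z (i + 1)) - Ψ (z i)) = 0 ∨ ε ≤ 1 - (Ψ (z (i + 1)) - Ψ (z i))) := by
        intro i hi
        obtain ⟨k, b, hb, hzk⟩ := hzK i hi.le
        exact hstep _ _ k b hb hzk (hz1 i hi)
      have hmono : ∀ i j, i ≤ j → j ≤ L (h ^ n) → (i : ℝ) - Ψ (z i) ≤ j - Ψ (z j) := by
        intro i j hij
        induction j, hij using Nat.le_induction with
        | base => simp
        | succ j hij ih =>
          intro hj
          have h1 := ih (by omega)
          have h2 := (hc j (by omega)).1
          push_cast
          linarith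
      have hwin : ∀ q : ℕ, q * M ≤ L (h ^ n) → ε * q ≤ (q * M : ℕ) - Ψ (z (q * M)) := by
        intro q
        induction q with
        | zero =>
          intro _
          have := axisHeight_one (h := h) hone hmul hτ0 hτ
          simp [hz0, hΨ, this]
        | succ q ih =>
          intro hq
          rw [Nat.succ_mul] at hq ⊢
          have h1 := ih (by omega)
          obtain ⟨i, hi, hne⟩ := hstretch n z (q * M) hq hzK
          have h2 := (hc (q * M + i) (by omega)).2.resolve_left hne
          have h3 := hmono (q * M) (q * M + i) (by omega) (by omega)
          have h4 := hmono (q * M + i + 1) (q * M + M) (by omega) hq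
          push_cast at h1 h2 h3 h4 ⊢
          linarith
      have h1 := hwin (L (h ^ n) / M) (Nat.div_mul_le_self _ _)
      have h2 := hmono _ _ (Nat.div_mul_le_self (L (h ^ n)) M) le_rfl
      have h3 : Ψ (z (L (h ^ n))) = n * τ := by
        have := axisHeight_pow_mul hmul hτ0 hτ 1 n
        rw [axisHeight_one hone hmul hτ0 hτ, mul_one, zero_add] at this
        rw [hzn, hΨ, this]
      have h4 : (n : ℝ) * τ / M - 1 ≤ (L (h ^ n) / M : ℕ) := by
        have h5 := Nat.lt_div_mul_add (a := L (h ^ n)) (b := M) (by omega)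
        have h6 : (L (h ^ n) : ℝ) < (L (h ^ n) / M : ℕ) * M + M := by exact_mod_cast h5
        rw [sub_le_iff_le_add, div_le_iff₀ hMpos]
        have := hτ n
        linarith
      rw [h3] at h2
      exact (mul_le_mul_of_nonneg_left h4 hε.le).trans (h1.trans h2)
    have hl1 : Tendsto (fun n : ℕ => (L (h ^ n) : ℝ) / n - τ + ε * (1 / (n : ℝ))) atTop
        (𝓝 (τ - τ + ε * 0)) :=
      (hlim.sub_const τ).add (tendsto_one_div_atTop_nhds_zero_nat.const_mul ε)
    have hl2 : ε * (τ / M) ≤ τ - τ + ε * 0 := by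
      refine ge_of_tendsto hl1 ?_
      filter_upwards [eventually_gt_atTop 0] with n hn
      have hn' : (0 : ℝ) < n := by exact_mod_cast hn
      have h1 := div_le_div_of_nonneg_right (hbound n) hn'.le
      have e1 : ε * (n * τ / M - 1) / n = ε * (τ / M) - ε * (1 / (n : ℝ)) := by
        field_simp
      have e2 : ((L (h ^ n) : ℝ) - n * τ) / n = (L (h ^ n) : ℝ) / n - τ := by
        field_simp
      rw [e1, e2] at h1
      linarith
    have : 0 < ε * (τ / M) := by positivity
    linarith

/-- Translation lengths are conjugacy invariant and homogeneous. -/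
theorem exists_rat_tendsto_of_isConj_pow (hmul : ∀ a b, L (a * b) ≤ L a + L b) {g h : G} {N : ℕ}
    (hN : 0 < N) (hc : IsConj (g ^ N) h) {q : ℚ}
    (hq : Tendsto (fun n : ℕ => (L (h ^ n) : ℝ) / n) atTop (𝓝 (q : ℝ))) :
    ∃ q : ℚ, Tendsto (fun n : ℕ => (L (g ^ n) : ℝ) / n) atTop (𝓝 (q : ℝ)) := by
  have hN' : (0 : ℝ) < N := by exact_mod_cast hN
  have hlim := (subadditive_length_pow hmul g).tendsto_lim (bddBelow_length_pow L g)
  set σ := (subadditive_length_pow hmul g).lim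
  obtain ⟨k, rfl⟩ := isConj_iff.1 hc
  have hdiff : ∀ n : ℕ, |(L ((k * g ^ N * k⁻¹) ^ n) : ℝ) - L (g ^ (n * N))| ≤ L k + L k⁻¹ := by
    intro n
    rw [conj_pow, ← pow_mul, mul_comm N n]
    set y := g ^ (n * N)
    have h1 : (L (k * y * k⁻¹) : ℝ) ≤ L k + L y + L k⁻¹ := by
      exact_mod_cast (hmul _ _).trans (Nat.add_le_add_right (hmul _ _) _)
    have h2 : (L y : ℝ) ≤ L k⁻¹ + L (k * y * k⁻¹) + L k := by
      have := (hmul (k⁻¹ * (k * y * k⁻¹)) k).trans (Nat.add_le_add_right (hmul _ _) _)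
      have e : k⁻¹ * (k * y * k⁻¹) * k = y := by group
      rw [e] at this
      exact_mod_cast this
    rw [abs_le]
    constructor <;> linarith
  have hl1 : Tendsto (fun n : ℕ => (L (g ^ (n * N)) : ℝ) / (n * N : ℕ)) atTop (𝓝 σ) :=
    hlim.comp (tendsto_id.atTop_mul_const' hN)
  have hl2 : Tendsto (fun n : ℕ => (L ((k * g ^ N * k⁻¹) ^ n) : ℝ) / n -
      (L (g ^ (n * N)) : ℝ) / (n * N : ℕ) * N) atTop (𝓝 0) := by
    refine squeeze_zero_norm' ?_ (tendsto_const_div_atTop_nhds_zero_nat ((L k : ℝ) + L k⁻¹))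
    filter_upwards [eventually_gt_atTop 0] with n hn
    have hn' : (0 : ℝ) < n := by exact_mod_cast hn
    have e : (L ((k * g ^ N * k⁻¹) ^ n) : ℝ) / n - (L (g ^ (n * N)) : ℝ) / (n * N : ℕ) * N =
        ((L ((k * g ^ N * k⁻¹) ^ n) : ℝ) - L (g ^ (n * N))) / n := by
      push_cast
      field_simp
    rw [e, Real.norm_eq_abs, abs_div, abs_of_pos hn']
    exact div_le_div_of_nonneg_right (hdiff n) hn'.le
  have h3 : (q : ℝ) - σ * N = 0 :=
    tendsto_nhds_unique (hq.sub (hl1.mul_const (N : ℝ))) hl2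
  refine ⟨q / N, ?_⟩
  have h4 : ((q / N : ℚ) : ℝ) = σ := by
    push_cast
    rw [div_eq_iff hN'.ne']
    linarith
  rwa [h4]

end length

theorem exists_elt_eq (P : C6Presentation S) (g : P.Grp) : ∃ w, P.elt w = g := by
  classical
  obtain ⟨x, rfl⟩ := PresentedGroup.mk_surjective (wordVal '' P.rels) g
  exact ⟨x.toWord, by rw [P.elt_eq_mk, FreeGroup.mk_toWord]⟩

theorem exists_word_iff (g : P.Grp) (n : ℕ) :
    (∃ l : List P.Grp, l.length = n ∧ (∀ x ∈ l, x ∈ P.gens ∨ x⁻¹ ∈ P.gens) ∧ l.prod = g) ↔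
      ∃ w : Word S, w.length = n ∧ P.elt w = g := by
  constructor
  · rintro ⟨l, rfl, hl, rfl⟩
    induction l with
    | nil => exact ⟨[], rfl, P.elt_nil⟩
    | cons a l ih =>
      obtain ⟨w, hw, hwl⟩ := ih fun x hx => hl x (List.mem_cons_of_mem _ hx)
      rcases hl a List.mem_cons_self with ⟨s, hs⟩ | ⟨s, hs⟩
      · exact ⟨(s, true) :: w, by simp [hw], by
          rw [List.prod_cons, ← hwl, ← hs]; simp [C6Presentation.elt]⟩
      · exact ⟨(s, false) :: w, by simp [hw], by
          rw [List.prod_cons, ← hwl, ← inv_inv a, ← hs]; simp [C6Presentation.elt]⟩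
  · rintro ⟨w, rfl, rfl⟩
    refine ⟨w.map fun l => (PresentedGroup.of l.1 : P.Grp) ^ (if l.2 then (1 : ℤ) else -1),
      by simp, ?_, rfl⟩
    intro x hx
    obtain ⟨⟨s, e⟩, -, rfl⟩ := List.mem_map.1 hx
    cases e
    · exact Or.inr ⟨s, by simp⟩
    · exact Or.inl ⟨s, by simp⟩

theorem wordLength_eq (g : P.Grp) :
    wordLength P.gens g = sInf {n | ∃ w : Word S, w.length = n ∧ P.elt w = g} := by
  simp only [wordLength, exists_word_iff]

theorem wordLength_elt_le (w : Word S) : wordLength P.gens (P.elt w) ≤ w.length := by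
  rw [wordLength_eq]
  exact Nat.sInf_le ⟨w, rfl, rfl⟩

theorem exists_geo (g : P.Grp) :
    ∃ w, P.elt w = g ∧ w.length = wordLength P.gens g ∧ Geo P w := by
  obtain ⟨v, hv⟩ := exists_elt_eq P g
  obtain ⟨w, hw, hwg⟩ := Nat.sInf_mem
    (s := {n | ∃ w : Word S, w.length = n ∧ P.elt w = g}) ⟨_, v, rfl, hv⟩
  rw [← wordLength_eq] at hw
  refine ⟨w, hwg, hw, fun u hu => ?_⟩
  rw [hw, ← hwg, ← hu]
  exact wordLength_elt_le u

theorem wordLength_one : wordLength P.gens (1 : P.Grp) = 0 := by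
  simpa using wordLength_elt_le (P := P) []

theorem wordLength_mul_le (a b : P.Grp) :
    wordLength P.gens (a * b) ≤ wordLength P.gens a + wordLength P.gens b := by
  obtain ⟨u, rfl, hu, -⟩ := exists_geo a
  obtain ⟨v, rfl, hv, -⟩ := exists_geo b
  rw [← P.elt_append, ← hu, ← hv, ← List.length_append]
  exact wordLength_elt_le _

theorem finite_wordLength_le [Finite S] (r : ℕ) : {x : P.Grp | wordLength P.gens x ≤ r}.Finite := by
  refine ((List.finite_length_le (S × Bool) r).image P.elt).subset fun x hx => ?_
  obtain ⟨w, rfl, hw, -⟩ := exists_geo x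
  exact ⟨w, hw.trans_le hx, rfl⟩

theorem exists_eq_wpow_append {α : Type*} {c y : List α} {n : ℕ} (h : y <+: wpow c n) :
    ∃ k p, y = wpow c k ++ p ∧ p.length ≤ c.length := by
  induction n generalizing y with
  | zero => exact ⟨0, [], by simpa using h, by simp⟩
  | succ n ih =>
    obtain ⟨D, hD⟩ := h
    rw [wpow_succ] at hD
    rcases List.append_eq_append_iff.1 hD with ⟨M, h1, h2⟩ | ⟨M, rfl, h2⟩
    · exact ⟨0, y, by simp, by simp [h1]⟩
    · obtain ⟨k, p, rfl, hp⟩ := ih ⟨D, h2.symm⟩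
      exact ⟨k + 1, p, by simp [wpow_succ], hp⟩

theorem exists_minConj (P : C6Presentation S) (g : P.Grp) :
    ∃ w, IsConj g (P.elt w) ∧ MinConj P w := by
  obtain ⟨v, rfl⟩ := exists_elt_eq P g
  have hne : ∃ n, ∃ w, w.length = n ∧ IsConj (P.elt v) (P.elt w) := ⟨_, v, rfl, .refl _⟩
  classical
  obtain ⟨w, hw, hc⟩ := Nat.find_spec hne
  exact ⟨w, hc, fun u hu => hw ▸ Nat.find_min' hne ⟨u, rfl, hc.trans hu⟩⟩

theorem exists_rat_tendsto_of_dehn [Finite S] {c : Word S} (hc : ¬ IsOfFinOrder (P.elt c))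
    (hred : FreeGroup.IsReduced (c ++ c)) (hD : ∀ n, Dehn P (wpow c n)) :
    ∃ q : ℚ, Filter.Tendsto (fun n : ℕ => (wordLength P.gens (P.elt c ^ n) : ℝ) / n)
      Filter.atTop (nhds (q : ℝ)) := by
  refine exists_rat_tendsto_of_close wordLength_one wordLength_mul_le finite_wordLength_le
    (P.elt c) (17 * c.length) fun n => ?_
  obtain ⟨x, hx, hlen, hgeo⟩ := exists_geo (P.elt c ^ n)
  rw [← hlen]
  refine ⟨fun i => P.elt (x.take i), by simp, by simpa using hx, fun i hi => ?_, fun i _ => ?_⟩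
  · beta_reduce
    rw [List.take_succ_eq_append_getElem hi, P.elt_append, inv_mul_cancel_left]
    exact wordLength_elt_le _
  · obtain ⟨y₁, p, hy, h1, hp⟩ := exists_close (W := c.length) (s := []) hgeo
      (isReduced_wpow hred n) (hD n) (fun u τ hu hr => overlap_wpow hc hu hr) (Or.inl rfl)
      (fun h => absurd rfl h) (by rw [hx, List.nil_append, elt_wpow])
      ⟨x.drop i, List.take_append_drop i x⟩
    obtain ⟨k, p', rfl, hp'⟩ := exists_eq_wpow_append hy
    refine ⟨k, P.elt (p' ++ p), (wordLength_elt_le _).trans (by simp; omega), ?_⟩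
    beta_reduce
    rw [h1, ← elt_wpow, ← P.elt_append]
    simp

end GSC
namespace GSC

/-- In a classical C'(1/6) group over a finite alphabet, every
infinite-order element has rational translation length: `|gⁿ|_S / n` converges to a
rational number. -/
theorem statement7 {S : Type} [Finite S] (P : C6Presentation S) (g : P.Grp)
    (hg : ¬ IsOfFinOrder g) :
    ∃ q : ℚ, Filter.Tendsto
      (fun n : ℕ => (wordLength P.gens (g ^ n) : ℝ) / (n : ℝ))
      Filter.atTop (nhds (q : ℝ)) := by
  obtain ⟨w, hgw, hmin⟩ := exists_minConj P g
  obtain ⟨N, c, hN, hwc, hred, hD⟩ :=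
    exists_axis hmin fun h => hg (isOfFinOrder_of_isConj hgw.symm h)
  have hgc := (hgw.pow N).trans hwc
  obtain ⟨q, hq⟩ := exists_rat_tendsto_of_dehn
    (fun h => hg ((isOfFinOrder_pow.1 (isOfFinOrder_of_isConj hgc.symm h)).resolve_right hN.ne'))
    hred hD
  exact exists_rat_tendsto_of_isConj_pow wordLength_mul_le hN hgc hq

end GSC
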